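/- Let (R, m, k) be a commutative noetherian local ring. If the residue field k has finite upper reducing projective dimension, then R is a complete intersection. -/

import Mathlib

/-!
Formalization of a statement from:
T. Araya and R. Takahashi, "On reducing homological dimensions over noetherian
rings" (arXiv:2010.10765).
-/

open Function Filter CategoryTheory

universe u

/-- A resolution of `M` by finitely generated free `A`-modules:
`⋯ → A^{rank 2} → A^{rank 1} → A^{rank 0} → M → 0`. -/
structure FreeResolution (A : Type u) [Ring A] (M : Type u) [AddCommGroup M]
    [Module A M] where
  rank : ℕ → ℕ
  d : ∀ i : ℕ, ((Fin (rank (i + 1)) → A) →ₗ[A] (Fin (rank i) → A))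
  aug : (Fin (rank 0) → A) →ₗ[A] M
  aug_surjective : Function.Surjective aug
  exact_aug : Function.Exact (d 0) aug
  exact : ∀ i : ℕ, Function.Exact (d (i + 1)) (d i)

/-- `ExtVanish A M N j` says that `Ext_A^{j+1}(M, N) = 0`: for every resolution `F`
of `M` by finitely generated free modules, the complex `Hom_A(F, N)` is exact at
homological position `j + 1`. -/
def ExtVanish (A : Type u) [Ring A] (M : Type u) [AddCommGroup M] [Module A M]
    (N : Type u) [AddCommGroup N] [Module A N] (j : ℕ) : Prop :=
  ∀ F : FreeResolution A M,
    Function.Exact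
      (fun φ : (Fin (F.rank j) → A) →ₗ[A] N => φ.comp (F.d j))
      (fun φ : (Fin (F.rank (j + 1)) → A) →ₗ[A] N => φ.comp (F.d (j + 1)))

/-- `extNonzero A M N i` says that `Ext_A^i(M, N) ≠ 0`
(for `i = 0` this reads `Hom_A(M, N) ≠ 0`). -/
def extNonzero (A : Type u) [Ring A] (M : Type u) [AddCommGroup M] [Module A M]
    (N : Type u) [AddCommGroup N] [Module A N] : ℕ → Prop
  | 0 => ∃ φ : M →ₗ[A] N, φ ≠ 0
  | (j + 1) => ¬ ExtVanish A M N j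

/-- The `A`-dual `Hom_A(-, A)`, as an `Aᵐᵒᵖ`-linear map between dual modules. -/
def dualMap {A : Type u} [Ring A] {M N : Type u} [AddCommGroup M] [Module A M]
    [AddCommGroup N] [Module A N] (f : M →ₗ[A] N) :
    (N →ₗ[A] A) →ₗ[Aᵐᵒᵖ] (M →ₗ[A] A) where
  toFun φ := φ.comp f
  map_add' _ _ := rfl
  map_smul' _ _ := rfl

/-- The (Auslander) transpose of `M` computed from the finite free presentation
`A^{rank 1} → A^{rank 0} → M → 0` contained in the resolution `F`, that is, the
cokernel of `Hom_A(A^{rank 0}, A) → Hom_A(A^{rank 1}, A)`; it is an `Aᵐᵒᵖ`-module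
(i.e. a module on the other side), well defined up to projective summands. -/
abbrev FreeResolution.transpose {A : Type u} [Ring A] {M : Type u} [AddCommGroup M]
    [Module A M] (F : FreeResolution A M) : Type u :=
  ((Fin (F.rank 1) → A) →ₗ[A] A) ⧸ LinearMap.range (dualMap (F.d 0))

/-- `M` is `(m,n)`-torsionfree: `Ext_A^i(M, A) = 0` for all `1 ≤ i ≤ m` and
`Ext_{Aᵒᵖ}^j(tr M, A) = 0` for all `1 ≤ j ≤ n` (read as "for all `i ≥ 1`", resp.
"for all `j ≥ 1`", when `m = ∞`, resp. `n = ∞`). -/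
def IsMNTorsionFree (A : Type u) [Ring A] (M : Type u) [AddCommGroup M] [Module A M]
    (m n : ℕ∞) : Prop :=
  (∀ j : ℕ, (j : ℕ∞) + 1 ≤ m → ExtVanish A M A j) ∧
  (∀ F : FreeResolution A M, ∀ j : ℕ, (j : ℕ∞) + 1 ≤ n →
    ExtVanish Aᵐᵒᵖ F.transpose A j)

/-- `M` is totally reflexive (= Gorenstein projective), i.e. `(∞,∞)`-torsionfree:
`Ext_A^i(M, A) = 0 = Ext_{Aᵒᵖ}^i(tr M, A)` for all `i ≥ 1`. -/
def IsTotallyReflexive (A : Type u) [Ring A] (M : Type u) [AddCommGroup M]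
    [Module A M] : Prop :=
  IsMNTorsionFree A M ⊤ ⊤

/-- `M` has finite projective dimension: it admits a finite resolution by finitely
generated free modules. -/
def HasFinitePd (A : Type u) [Ring A] (M : Type u) [AddCommGroup M] [Module A M] :
    Prop :=
  ∃ F : FreeResolution A M, ∃ t : ℕ, ∀ i : ℕ, t ≤ i → F.rank i = 0

/-- `GdimLE A t M` : the Gorenstein dimension of `M` is at most `t`, i.e. `M` admits
a resolution `0 → G_t → ⋯ → G_0 → M → 0` by totally reflexive modules. -/
def GdimLE (A : Type u) [Ring A] :
    ℕ → ∀ (M : Type u) [AddCommGroup M] [Module A M], Prop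
  | 0, M, _, _ => IsTotallyReflexive A M
  | (t + 1), M, _, _ =>
      ∃ (G : Type u) (_ : AddCommGroup G) (_ : Module A G) (g : G →ₗ[A] M),
        IsTotallyReflexive A G ∧ Function.Surjective g ∧
        GdimLE A t (LinearMap.ker g)

/-- `M` has finite Gorenstein dimension. -/
def HasFiniteGdim (A : Type u) [Ring A] (M : Type u) [AddCommGroup M] [Module A M] :
    Prop :=
  ∃ t : ℕ, GdimLE A t M

/-- The Gorenstein dimension of `M`, as an element of `ℕ∞` (`⊤` if infinite). -/
noncomputable def gdimension (A : Type u) [Ring A] (M : Type u) [AddCommGroup M]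
    [Module A M] : ℕ∞ :=
  sInf {s : ℕ∞ | ∃ t : ℕ, s = t ∧ GdimLE A t M}

/-- `IsNthSyzygy A M t S` : `S` is a `t`-th syzygy `Ω^t M` of `M`, computed from a
resolution of `M` by finitely generated free modules (with `Ω^0 M = M`). -/
def IsNthSyzygy (A : Type u) [Ring A] (M : Type u) [AddCommGroup M] [Module A M] :
    ℕ → ∀ (S : Type u) [AddCommGroup S] [Module A S], Prop
  | 0, S, _, _ => Nonempty (S ≃ₗ[A] M)
  | (j + 1), S, _, _ =>
      ∃ F : FreeResolution A M, Nonempty (S ≃ₗ[A] LinearMap.range (F.d j))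

/-- `RedChain A fin s M` : there are short exact sequences
`0 → M_{i-1}^{⊕ a_i} → M_i → Ω^{n_i} M_{i-1}^{⊕ b_i} → 0` (`i = 1, …, s`) of finitely
generated `A`-modules with `n_i ≥ 0`, `a_i, b_i > 0`, `M₀ = M` and `fin (M_s)`. -/
def RedChain (A : Type u) [Ring A]
    (fin : ∀ (M : Type u) [AddCommGroup M] [Module A M], Prop) :
    ℕ → ∀ (M : Type u) [AddCommGroup M] [Module A M], Prop
  | 0, M, _, _ => fin M
  | (s + 1), M, _, _ =>
      ∃ (M₁ : Type u) (_ : AddCommGroup M₁) (_ : Module A M₁)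
        (_ : Module.Finite A M₁)
        (S : Type u) (_ : AddCommGroup S) (_ : Module A S) (_ : Module.Finite A S)
        (a b n : ℕ) (f : (Fin a → M) →ₗ[A] M₁) (g : M₁ →ₗ[A] (Fin b → S)),
        0 < a ∧ 0 < b ∧ IsNthSyzygy A M n S ∧
        Function.Injective f ∧ Function.Surjective g ∧ Function.Exact f g ∧
        RedChain A fin s M₁

/-- `URedChain A fin s M` : there are short exact sequences
`0 → M_{i-1} → M_i → Ω^{n_i} M_{i-1} → 0` (`i = 1, …, s`) of finitely generated
`A`-modules with `n_i ≥ 0`, `M₀ = M` and `fin (M_s)`. -/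
def URedChain (A : Type u) [Ring A]
    (fin : ∀ (M : Type u) [AddCommGroup M] [Module A M], Prop) :
    ℕ → ∀ (M : Type u) [AddCommGroup M] [Module A M], Prop
  | 0, M, _, _ => fin M
  | (s + 1), M, _, _ =>
      ∃ (M₁ : Type u) (_ : AddCommGroup M₁) (_ : Module A M₁)
        (_ : Module.Finite A M₁)
        (S : Type u) (_ : AddCommGroup S) (_ : Module A S) (_ : Module.Finite A S)
        (n : ℕ) (f : M →ₗ[A] M₁) (g : M₁ →ₗ[A] S),
        IsNthSyzygy A M n S ∧
        Function.Injective f ∧ Function.Surjective g ∧ Function.Exact f g ∧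
        URedChain A fin s M₁

/-- The reducing dimension of `M` with respect to the homological dimension whose
finiteness is recorded by the predicate `fin`: taking `fin = HasFinitePd A` gives
the reducing projective dimension `red-pd_A M`, and `fin = HasFiniteGdim A` gives
the reducing Gorenstein dimension `red-Gdim_A M`.  It is the least length of a
chain of short exact sequences as in `RedChain` (`0` iff `fin M` holds, `⊤` if
there is no such chain). -/
noncomputable def redDim (A : Type u) [Ring A]
    (fin : ∀ (M : Type u) [AddCommGroup M] [Module A M], Prop)
    (M : Type u) [AddCommGroup M] [Module A M] : ℕ∞ :=
  sInf {s : ℕ∞ | ∃ t : ℕ, s = t ∧ RedChain A fin t M}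

/-- The upper reducing dimension of `M` with respect to `fin`: taking
`fin = HasFinitePd A` gives the upper reducing projective dimension, and
`fin = HasFiniteGdim A` gives the upper reducing Gorenstein dimension. -/
noncomputable def uredDim (A : Type u) [Ring A]
    (fin : ∀ (M : Type u) [AddCommGroup M] [Module A M], Prop)
    (M : Type u) [AddCommGroup M] [Module A M] : ℕ∞ :=
  sInf {s : ℕ∞ | ∃ t : ℕ, s = t ∧ URedChain A fin t M}

/-- A commutative ring is a regular local ring iff it is noetherian local and its
maximal ideal can be generated by a regular sequence. -/
def IsRegularLocal (Q : Type u) [CommRing Q] : Prop :=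
  IsNoetherianRing Q ∧ ∃ (_ : IsLocalRing Q) (rs : List Q),
    RingTheory.Sequence.IsRegular Q rs ∧
    Ideal.span {x | x ∈ rs} = IsLocalRing.maximalIdeal Q

/-- `R` is a complete intersection: the `𝔪`-adic completion of `R` is isomorphic to
the quotient of a regular local ring by an ideal generated by a regular sequence. -/
def IsCompleteIntersection (R : Type u) [CommRing R] [IsLocalRing R] : Prop :=
  ∃ (Q : Type u) (_ : CommRing Q), IsRegularLocal Q ∧
    ∃ rs : List Q, RingTheory.Sequence.IsRegular Q rs ∧
      Nonempty ((AdicCompletion (IsLocalRing.maximalIdeal R) R) ≃+*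
        (Q ⧸ Ideal.span {x | x ∈ rs}))

/-- A (possibly curved) graded-commutative differential algebra: a graded-commutative algebra
with a degree `-1` derivation `d`; the relation `d ∘ d = 0` is not part of the structure. -/
structure GA (R : Type u) [CommRing R] (A : Type u) [Ring A] [Algebra R A] where
  gr : ℤ → Submodule R A
  σ : A →ₐ[R] A
  d : A →ₗ[R] A
  one_mem : (1 : A) ∈ gr 0
  mul_mem : ∀ {i j : ℤ} {a b : A}, a ∈ gr i → b ∈ gr j → a * b ∈ gr (i + j)
  gr_neg : ∀ n : ℤ, n < 0 → gr n = ⊥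
  σ_even : ∀ {n : ℤ} {a : A}, Even n → a ∈ gr n → σ a = a
  σ_odd : ∀ {n : ℤ} {a : A}, Odd n → a ∈ gr n → σ a = -a
  σσ : ∀ a, σ (σ a) = a
  σd : ∀ a, σ (d a) = -d (σ a)
  d_mem : ∀ {n : ℤ} {a : A}, a ∈ gr n → d a ∈ gr (n - 1)
  leib : ∀ a b, d (a * b) = d a * b + σ a * d b
  comm_even : ∀ {n : ℤ} {a : A}, Even n → a ∈ gr n → ∀ b, a * b = b * a
  comm_odd : ∀ {n : ℤ} {a : A}, Odd n → a ∈ gr n → ∀ b, a * b = σ b * a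
  sq_odd : ∀ {n : ℤ} {a : A}, Odd n → a ∈ gr n → a * a = 0

namespace GA

variable {R : Type u} [CommRing R] {A : Type u} [Ring A] [Algebra R A]

/-- The ground ring, concentrated in degree zero. -/
def base (R : Type u) [CommRing R] : GA R R where
  gr n := if n = 0 then ⊤ else ⊥
  σ := AlgHom.id R R
  d := 0
  one_mem := by simp
  mul_mem := by
    intro i j a b ha hb
    split_ifs at * <;> simp_all
  gr_neg n hn := by rw [if_neg hn.ne]
  σ_even := by simp
  σ_odd := by
    intro n a hn ha
    have : n ≠ 0 := by rintro rfl; simp at hn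
    simp_all
  σσ := by simp
  σd := by simp
  d_mem := by simp
  leib := by simp
  comm_even := by intro n a _ _ b; exact mul_comm _ _
  comm_odd := by intro n a _ _ b; exact mul_comm _ _
  sq_odd := by
    intro n a hn ha
    have : n ≠ 0 := by rintro rfl; simp at hn
    simp_all

/-- The twist by which an element of degree `n` commutes with scalars. -/
noncomputable def tw (G : GA R A) (n : ℤ) : A →ₐ[R] A :=
  open Classical in if Even n then AlgHom.id R A else G.σ

lemma tw_even (G : GA R A) {n : ℤ} (h : Even n) (a : A) : G.tw n a = a := by
  simp [tw, h]

lemma tw_odd (G : GA R A) {n : ℤ} (h : Odd n) (a : A) : G.tw n a = G.σ a := by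
  simp [tw, Int.not_even_iff_odd.2 h]

lemma σ_mem (G : GA R A) {n : ℤ} {a : A} (ha : a ∈ G.gr n) : G.σ a ∈ G.gr n := by
  rcases Int.even_or_odd n with h | h
  · rwa [G.σ_even h ha]
  · rw [G.σ_odd h ha]; exact neg_mem ha

lemma tw_mem (G : GA R A) (m : ℤ) {n : ℤ} {a : A} (ha : a ∈ G.gr n) : G.tw m a ∈ G.gr n := by
  rcases Int.even_or_odd m with h | h
  · rwa [G.tw_even h]
  · rw [G.tw_odd h]; exact G.σ_mem ha

lemma eq_zero_of_neg (G : GA R A) {n : ℤ} (hn : n < 0) {a : A} (ha : a ∈ G.gr n) : a = 0 := by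
  rw [G.gr_neg n hn] at ha; simpa using ha

lemma gr_of_eq (G : GA R A) {m n : ℤ} {a : A} (ha : a ∈ G.gr n) (h : n = m) : a ∈ G.gr m := h ▸ ha

/-- The sign `(-1)^n`. -/
noncomputable def sg (n : ℤ) : ℤ := open Classical in if Even n then 1 else -1

lemma sg_even {n : ℤ} (h : Even n) : sg n = 1 := by simp [sg, h]
lemma sg_odd {n : ℤ} (h : Odd n) : sg n = -1 := by simp [sg, Int.not_even_iff_odd.2 h]
lemma sg_mul_sg (n : ℤ) : sg n * sg n = 1 := by
  rcases Int.even_or_odd n with h | h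
  · simp [sg_even h]
  · simp [sg_odd h]

/-- Derivations lowering the degree by `n` which commute with `d` up to the usual sign. -/
structure Der (G : GA R A) (n : ℤ) where
  θ : A →ₗ[R] A
  mem : ∀ {i : ℤ} {a : A}, a ∈ G.gr i → θ a ∈ G.gr (i - n)
  leib : ∀ a b, θ (a * b) = θ a * b + G.tw n a * θ b
  comm : ∀ a, G.d (θ a) = sg n • θ (G.d a)
  σθ : ∀ a, G.σ (θ a) = sg n • θ (G.σ a)

/-- The zero derivation. -/
def Der.zero (G : GA R A) (n : ℤ) : Der G n where
  θ := 0
  mem := by simp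
  leib := by simp
  comm := by simp
  σθ := by simp

/-- `Adj G G' p z` presents `G'` as the extension of `G` by a variable `v` of degree `p` with
`d v = z`: `co i` reads off the coefficient of the `i`-th divided power of `v`,
and `ins i a` is `a v⁽ⁱ⁾`. -/
structure Adj {B : Type u} [Ring B] [Algebra R B] (G : GA R A) (G' : GA R B) (p : ℤ) (z : A)
    where
  al : ℕ → Prop
  al_zero : al 0
  al_one : al 1
  al_succ : ∀ i, al (i + 1) → al i
  cf : ℕ → ℕ → ℕ
  co : ℕ → B →ₗ[R] A
  ins : ℕ → A →ₗ[R] B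
  co_ext : ∀ f g : B, (∀ i, co i f = co i g) → f = g
  co_al : ∀ i f, ¬ al i → co i f = 0
  co_ins : ∀ i j a, al i → co j (ins i a) = if j = i then a else 0
  mem_gr : ∀ n f, f ∈ G'.gr n ↔ ∀ i : ℕ, co i f ∈ G.gr (n - i * p)
  co_d : ∀ i f, co i (G'.d f) = G.d (co i f) + G.σ (co (i + 1) f) * z
  co_mul : ∀ n f g, co n (f * g) = ∑ ij ∈ Finset.HasAntidiagonal.antidiagonal n,
    cf ij.1 ij.2 • (co ij.1 f * G.tw (ij.1 * p) (co ij.2 g))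
  ins_one : ins 0 1 = 1
  p_pos : 1 ≤ p
  z_mem : z ∈ G.gr (p - 1)
  z_sq : al 2 → z * z = 0
  der : ∀ (n : ℤ) (D : Der G n) (c : A), c ∈ G.gr (p - n) → G.d c = sg n • D.θ z →
    ∃ D' : Der G' n, ∀ i f, co i (D'.θ f) = D.θ (co i f) + G.tw n (co (i + 1) f) * c

end GA

namespace GA
variable {R : Type u} [CommRing R] {A : Type u} [Ring A] [Algebra R A]

/-- The carrier of the extension by an exterior variable `x`: pairs `(a, b) = a + b x`. -/
@[ext] structure OddExt (G : GA R A) where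
  re : A
  im : A

namespace OddExt
variable {G : GA R A}

/-- Pairs. -/
def equiv (G : GA R A) : OddExt G ≃ A × A where
  toFun f := (f.re, f.im)
  invFun f := ⟨f.1, f.2⟩
  left_inv _ := rfl
  right_inv _ := rfl

instance : AddCommGroup (OddExt G) := (equiv G).addCommGroup
instance : Module R (OddExt G) := (equiv G).module R
instance : Mul (OddExt G) := ⟨fun f g => ⟨f.re * g.re, f.re * g.im + f.im * G.σ g.re⟩⟩
instance : One (OddExt G) := ⟨⟨1, 0⟩⟩

@[simp] lemma re_add (f g : OddExt G) : (f + g).re = f.re + g.re := rfl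
@[simp] lemma im_add (f g : OddExt G) : (f + g).im = f.im + g.im := rfl
@[simp] lemma re_neg (f : OddExt G) : (-f).re = -f.re := rfl
@[simp] lemma im_neg (f : OddExt G) : (-f).im = -f.im := rfl
@[simp] lemma re_zero : (0 : OddExt G).re = 0 := rfl
@[simp] lemma im_zero : (0 : OddExt G).im = 0 := rfl
@[simp] lemma re_one : (1 : OddExt G).re = 1 := rfl
@[simp] lemma im_one : (1 : OddExt G).im = 0 := rfl
@[simp] lemma re_smul (r : R) (f : OddExt G) : (r • f).re = r • f.re := rfl
@[simp] lemma im_smul (r : R) (f : OddExt G) : (r • f).im = r • f.im := rfl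
@[simp] lemma re_mul (f g : OddExt G) : (f * g).re = f.re * g.re := rfl
@[simp] lemma im_mul (f g : OddExt G) : (f * g).im = f.re * g.im + f.im * G.σ g.re := rfl

instance : Ring (OddExt G) :=
  { (inferInstance : AddCommGroup (OddExt G)), (inferInstance : Mul (OddExt G)),
    (inferInstance : One (OddExt G)) with
    left_distrib := by intro a b c; ext <;> simp [mul_add]; abel
    right_distrib := by intro a b c; ext <;> simp [add_mul]; abel
    zero_mul := by intro a; ext <;> simp
    mul_zero := by intro a; ext <;> simp
    mul_assoc := by intro a b c; ext <;> simp [mul_assoc, mul_add, add_mul, add_assoc]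
    one_mul := by intro a; ext <;> simp
    mul_one := by intro a; ext <;> simp }

instance : Algebra R (OddExt G) := Algebra.ofModule
  (by intro r a b; ext <;> simp) (by intro r a b; ext <;> simp)

end OddExt

/-- Extension by an exterior variable of odd degree `p` with differential `z`. -/
def odd (G : GA R A) (p : ℤ) (z : A) (hp : Odd p) (hp1 : 1 ≤ p) (hz : z ∈ G.gr (p - 1)) :
    GA R (OddExt G) where
  gr n :=
    { carrier := {f | f.re ∈ G.gr n ∧ f.im ∈ G.gr (n - p)}
      add_mem' := fun ha hb => ⟨add_mem ha.1 hb.1, add_mem ha.2 hb.2⟩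
      zero_mem' := ⟨zero_mem _, zero_mem _⟩
      smul_mem' := fun r _ ha => ⟨Submodule.smul_mem _ r ha.1, Submodule.smul_mem _ r ha.2⟩ }
  σ := AlgHom.ofLinearMap
    { toFun := fun f => ⟨G.σ f.re, -G.σ f.im⟩
      map_add' := by intro a b; ext <;> simp; abel
      map_smul' := by intro a b; ext <;> simp }
    (by ext <;> simp) (by intro a b; ext <;> simp; abel)
  d :=
    { toFun := fun f => ⟨G.d f.re + G.σ f.im * z, G.d f.im⟩
      map_add' := by intro a b; ext <;> simp [add_mul]; abel
      map_smul' := by intro a b; ext <;> simp }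
  one_mem := ⟨G.one_mem, zero_mem _⟩
  mul_mem := by
    rintro i j a b ⟨h1, h2⟩ ⟨h3, h4⟩
    exact ⟨G.mul_mem h1 h3, add_mem (G.gr_of_eq (G.mul_mem h1 h4) (by ring))
      (G.gr_of_eq (G.mul_mem h2 (G.σ_mem h3)) (by ring))⟩
  gr_neg n hn := by
    rw [eq_bot_iff]
    rintro a ⟨h1, h2⟩
    exact OddExt.ext (G.eq_zero_of_neg hn h1) (G.eq_zero_of_neg (by omega) h2)
  σ_even := by
    rintro n a hn ⟨h1, h2⟩
    ext
    · exact G.σ_even hn h1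
    · simp [G.σ_odd (hn.sub_odd hp) h2]
  σ_odd := by
    rintro n a hn ⟨h1, h2⟩
    ext
    · exact G.σ_odd hn h1
    · simp [G.σ_even (hn.sub_odd hp) h2]
  σσ := by intro a; ext <;> simp [G.σσ]
  σd := by
    intro a
    have hz' : G.σ z = z := G.σ_even (hp.sub_odd odd_one) hz
    ext <;> simp [G.σd, G.σσ, hz']
    abel
  d_mem := by
    rintro n a ⟨h1, h2⟩
    exact ⟨add_mem (G.d_mem h1) (G.gr_of_eq (G.mul_mem (G.σ_mem h2) hz) (by ring)),
      G.gr_of_eq (G.d_mem h2) (by ring)⟩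
  leib := by
    intro a b
    have hz' := G.comm_even (hp.sub_odd odd_one) hz
    ext
    · simp [G.leib, mul_add, add_mul, G.σσ, mul_assoc, hz']
      abel
    · have hσz : G.σ z = z := G.σ_even (hp.sub_odd odd_one) hz
      simp [G.leib, mul_add, add_mul, G.σσ, mul_assoc, hz', G.σd, hσz]
      abel
  comm_even := by
    rintro n a hn ⟨h1, h2⟩ b
    ext
    · simp [G.comm_even hn h1]
    · simp only [OddExt.im_mul]
      rw [G.comm_even hn h1, G.comm_odd (hn.sub_odd hp) h2, G.σσ, G.σ_even hn h1]
      abel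
  comm_odd := by
    rintro n a hn ⟨h1, h2⟩ b
    ext
    · exact G.comm_odd hn h1 _
    · simp only [OddExt.im_mul, AlgHom.ofLinearMap_apply, LinearMap.coe_mk, AddHom.coe_mk]
      rw [G.comm_odd hn h1, G.comm_even (hn.sub_odd hp) h2, G.σ_odd hn h1]
      simp [add_comm]
  sq_odd := by
    rintro n a hn ⟨h1, h2⟩
    ext
    · exact G.sq_odd hn h1
    · simp [G.σ_odd hn h1, G.comm_even (hn.sub_odd hp) h2]

lemma tw_odd_re {G : GA R A} {p : ℤ} {z : A} (hp : Odd p) (hp1 : 1 ≤ p) (hz : z ∈ G.gr (p - 1))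
   (n : ℤ) (f : OddExt G) : OddExt.re ((G.odd p z hp hp1 hz).tw n f) = G.tw n f.re := by
  rcases Int.even_or_odd n with h | h
  · rw [tw_even _ h, tw_even _ h]
  · rw [tw_odd _ h, tw_odd _ h]; rfl

lemma tw_odd_im {G : GA R A} {p : ℤ} {z : A} (hp : Odd p) (hp1 : 1 ≤ p) (hz : z ∈ G.gr (p - 1))
   (n : ℤ) (f : OddExt G) : OddExt.im ((G.odd p z hp hp1 hz).tw n f) = sg n • G.tw n f.im := by
  rcases Int.even_or_odd n with h | h
  · rw [tw_even _ h, tw_even _ h, sg_even h, one_smul]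
  · rw [tw_odd _ h, tw_odd _ h, sg_odd h, neg_one_smul]; rfl

/-- Extension of a derivation to an exterior variable. -/
lemma odd_der {G : GA R A} {p : ℤ} {z : A} (hp : Odd p) (hp1 : 1 ≤ p) (hz : z ∈ G.gr (p - 1))
    (n : ℤ) (D : Der G n) (c : A) (hc : c ∈ G.gr (p - n)) (hdc : G.d c = sg n • D.θ z) :
    ∃ D' : Der (G.odd p z hp hp1 hz) n, ∀ f : OddExt G, OddExt.re (D'.θ f) =
      D.θ f.re + G.tw n f.im * c ∧ OddExt.im (D'.θ f) = D.θ f.im := by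
  have hz' := G.comm_even (hp.sub_odd odd_one) hz
  have hσz : G.σ z = z := G.σ_even (hp.sub_odd odd_one) hz
  refine ⟨{ θ :=
    { toFun := fun f => (⟨D.θ f.re + G.tw n f.im * c, D.θ f.im⟩ : OddExt G)
      map_add' := by intro a b; exact OddExt.ext (by simp [add_mul]; abel) (by simp)
      map_smul' := by intro a b; exact OddExt.ext (by simp) (by simp) }
            mem := ?_, leib := ?_, comm := ?_, σθ := ?_ }, ?_⟩
  · rintro i a ⟨h1, h2⟩
    exact ⟨add_mem (D.mem h1) (G.gr_of_eq (G.mul_mem (G.tw_mem n h2) hc) (by ring)),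
      G.gr_of_eq (D.mem h2) (by ring)⟩
  · intro a b
    refine OddExt.ext ?_ ?_
    · simp only [LinearMap.coe_mk, AddHom.coe_mk]
      erw [OddExt.re_add, OddExt.re_mul, OddExt.re_mul, OddExt.re_mul, OddExt.im_mul, tw_odd_re]
      rcases Int.even_or_odd n with h | h
      · simp only [tw_even _ h, D.leib]
        rw [add_mul, mul_add, add_mul, mul_assoc (OddExt.im a) (G.σ _),
          mul_assoc (OddExt.im a) c, G.comm_odd (hp.sub_even h) hc]
        noncomm_ring
      · simp only [tw_odd _ h, D.leib]
        rw [map_add, map_mul, map_mul, G.σσ, add_mul, mul_add, add_mul,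
          mul_assoc (G.σ (OddExt.im a)) (OddExt.re b),
          mul_assoc (G.σ (OddExt.im a)) c, G.comm_even (hp.sub_odd h) hc]
        noncomm_ring
    · simp only [LinearMap.coe_mk, AddHom.coe_mk]
      erw [OddExt.im_add, OddExt.im_mul, OddExt.im_mul, OddExt.im_mul, tw_odd_re, tw_odd_im]
      simp only [map_add, D.leib]
      rcases Int.even_or_odd n with h | h
      · simp only [tw_even _ h, sg_even h, one_smul]
        have h1 := G.σ_odd (hp.sub_even h) hc
        have h2 := D.σθ (OddExt.re b)
        rw [sg_even h, one_smul] at h2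
        have h3 := G.comm_odd (hp.sub_even h) hc
        simp only [add_mul, mul_add, map_mul, h1, h2, mul_assoc, mul_neg]
        rw [h3]
        abel
      · simp only [tw_odd _ h, sg_odd h, neg_one_smul]
        have h1 := G.σ_even (hp.sub_odd h) hc
        have h2 := D.σθ (OddExt.re b)
        rw [sg_odd h, neg_one_smul] at h2
        have h3 := G.comm_even (hp.sub_odd h) hc
        simp only [add_mul, mul_add, map_mul, h1, h2, mul_assoc, mul_neg, neg_mul, G.σσ]
        rw [h3]
        abel
  · intro a
    refine OddExt.ext ?_ ?_
    · change G.d (D.θ (OddExt.re a) + G.tw n (OddExt.im a) * c) + G.σ (D.θ (OddExt.im a)) * z =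
        OddExt.re (sg n • (⟨D.θ (G.d (OddExt.re a) + G.σ (OddExt.im a) * z) +
          G.tw n (G.d (OddExt.im a)) * c, D.θ (G.d (OddExt.im a))⟩ : OddExt G))
      rcases Int.even_or_odd n with h | h
      · rw [sg_even h, one_smul] at hdc ⊢
        simp only [tw_even _ h, map_add, G.leib, D.leib, hdc, D.comm, D.σθ, sg_even h, one_smul]
        abel
      · rw [sg_odd h, neg_one_smul] at hdc ⊢
        simp only [tw_odd _ h, map_add, G.leib, D.leib, hdc, D.comm, D.σθ, sg_odd h, neg_one_smul,
          G.σσ, OddExt.re_neg, G.σd]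
        noncomm_ring
    · change G.d (D.θ (OddExt.im a)) =
        OddExt.im (sg n • (⟨D.θ (G.d (OddExt.re a) + G.σ (OddExt.im a) * z) +
          G.tw n (G.d (OddExt.im a)) * c, D.θ (G.d (OddExt.im a))⟩ : OddExt G))
      rw [D.comm]
      rcases Int.even_or_odd n with h | h
      · simp [sg_even h]
      · simp [sg_odd h]
  · intro a
    have key : ∀ f : OddExt G, OddExt.re (sg n • f) = sg n • OddExt.re f ∧
        OddExt.im (sg n • f) = sg n • OddExt.im f := by
      intro f
      rcases Int.even_or_odd n with h | h
      · simp [sg_even h]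
      · simp [sg_odd h]
    refine OddExt.ext ?_ ?_
    · refine Eq.trans ?_ (key _).1.symm
      change G.σ (D.θ (OddExt.re a) + G.tw n (OddExt.im a) * c) = sg n •
        (D.θ (G.σ (OddExt.re a)) + G.tw n (-G.σ (OddExt.im a)) * c)
      rcases Int.even_or_odd n with h | h
      · simp [tw_even _ h, sg_even h, D.σθ, G.σ_odd (hp.sub_even h) hc]
      · simp [tw_odd _ h, sg_odd h, D.σθ, G.σ_even (hp.sub_odd h) hc, G.σσ]
        try abel
    · refine Eq.trans ?_ (key _).2.symm
      change -G.σ (D.θ (OddExt.im a)) = sg n • (D.θ (-G.σ (OddExt.im a)))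
      simp [D.σθ]
  · intro f; exact ⟨rfl, rfl⟩

/-- The extension by an exterior variable, presented as an adjunction. -/
noncomputable def oddAdj (G : GA R A) (p : ℤ) (z : A) (hp : Odd p) (hp1 : 1 ≤ p)
    (hz : z ∈ G.gr (p - 1)) : Adj G (G.odd p z hp hp1 hz) p z where
  al i := i ≤ 1
  al_zero := by simp
  al_one := by simp
  al_succ := by intros; omega
  cf i j := if i + j ≤ 1 then 1 else 0
  co i := match i with
    | 0 => { toFun := OddExt.re, map_add' := fun _ _ => rfl, map_smul' := fun _ _ => rfl }
    | 1 => { toFun := OddExt.im, map_add' := fun _ _ => rfl, map_smul' := fun _ _ => rfl }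
    | _ => 0
  ins i := match i with
    | 0 => { toFun := fun a => (⟨a, 0⟩ : OddExt G)
             map_add' := fun _ _ => OddExt.ext (by simp) (by simp)
             map_smul' := fun _ _ => OddExt.ext (by simp) (by simp) }
    | 1 => { toFun := fun a => (⟨0, a⟩ : OddExt G)
             map_add' := fun _ _ => OddExt.ext (by simp) (by simp)
             map_smul' := fun _ _ => OddExt.ext (by simp) (by simp) }
    | _ => 0
  co_ext f g h := OddExt.ext (h 0) (h 1)
  co_al i f h := by
    match i with
    | 0 => simp at h
    | 1 => simp at h
    | n + 2 => rfl
  co_ins i j a h := by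
    match i, j with
    | 0, 0 => rfl
    | 0, 1 => rfl
    | 1, 0 => rfl
    | 1, 1 => rfl
    | i + 2, j => omega
    | 0, j + 2 => rfl
    | 1, j + 2 => simp
  mem_gr n f := by
    constructor
    · intro h i
      match i with
      | 0 => exact G.gr_of_eq h.1 (by simp)
      | 1 => exact G.gr_of_eq h.2 (by simp)
      | i + 2 => simp
    · intro h
      exact ⟨G.gr_of_eq (h 0) (by simp), G.gr_of_eq (h 1) (by simp)⟩
  co_d i f := by
    match i with
    | 0 => rfl
    | 1 =>
      change G.d (OddExt.im f) = G.d (OddExt.im f) + G.σ 0 * z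
      simp
    | i + 2 => simp
  co_mul n f g := by
    match n with
    | 0 => simp [tw]; rfl
    | 1 =>
      rw [show Finset.HasAntidiagonal.antidiagonal 1 = {((0:ℕ), (1:ℕ)), (1, 0)} from rfl]
      simp [tw_even G (n := 0) (by simp), tw_odd G hp]; rfl
    | n + 2 =>
      symm
      simp only [LinearMap.zero_apply]
      apply Finset.sum_eq_zero
      intro ij hij
      rw [Finset.HasAntidiagonal.mem_antidiagonal] at hij
      rw [if_neg (by omega), zero_smul]
  ins_one := rfl
  p_pos := hp1
  z_mem := hz
  z_sq := by intro h; omega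
  der n D c hc hdc := by
    obtain ⟨D', h⟩ := odd_der hp hp1 hz n D c hc hdc
    refine ⟨D', fun i f => ?_⟩
    match i with
    | 0 => exact (h f).1
    | 1 =>
      refine (h f).2.trans ?_
      change D.θ (OddExt.im f) = D.θ (OddExt.im f) + G.tw n 0 * c
      simp
    | i + 2 => simp

end GA

namespace GA
variable {R : Type u} [CommRing R] {A : Type u} [Ring A] [Algebra R A]

/-- The carrier of the extension by a divided power variable `u`: the sequence `c` stands for
the (possibly infinite) sum of the `c i u⁽ⁱ⁾`. -/
@[ext] structure EvenExt (G : GA R A) where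
  c : ℕ → A

namespace EvenExt
variable {G : GA R A}

/-- Sequences. -/
def equiv (G : GA R A) : EvenExt G ≃ (ℕ → A) where
  toFun f := f.c
  invFun f := ⟨f⟩
  left_inv _ := rfl
  right_inv _ := rfl

instance : AddCommGroup (EvenExt G) := (equiv G).addCommGroup
instance : Module R (EvenExt G) := (equiv G).module R
instance : Mul (EvenExt G) := ⟨fun f g => ⟨fun n => ∑ ij ∈ Finset.HasAntidiagonal.antidiagonal n,
  n.choose ij.1 • (f.c ij.1 * g.c ij.2)⟩⟩
instance : One (EvenExt G) := ⟨⟨fun n => if n = 0 then 1 else 0⟩⟩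

@[simp] lemma c_add (f g : EvenExt G) (n : ℕ) : (f + g).c n = f.c n + g.c n := rfl
@[simp] lemma c_neg (f : EvenExt G) (n : ℕ) : (-f).c n = -f.c n := rfl
@[simp] lemma c_zero (n : ℕ) : (0 : EvenExt G).c n = 0 := rfl
lemma c_one (n : ℕ) : (1 : EvenExt G).c n = if n = 0 then 1 else 0 := rfl
@[simp] lemma c_smul (r : R) (f : EvenExt G) (n : ℕ) : (r • f).c n = r • f.c n := rfl
lemma c_mul (f g : EvenExt G) (n : ℕ) : (f * g).c n =
  ∑ ij ∈ Finset.HasAntidiagonal.antidiagonal n, n.choose ij.1 • (f.c ij.1 * g.c ij.2) := rfl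

protected lemma mul_assoc (f g h : EvenExt G) : f * g * h = f * (g * h) := by
  ext n
  simp only [c_mul, Finset.sum_mul, Finset.mul_sum, Finset.smul_sum, Finset.sum_sigma']
  refine Finset.sum_nbij' (fun x => ⟨(x.2.1, x.2.2 + x.1.2), (x.2.2, x.1.2)⟩)
    (fun x => ⟨(x.1.1 + x.2.1, x.2.2), (x.1.1, x.2.1)⟩) ?_ ?_ ?_ ?_ ?_ <;>
    rintro ⟨⟨a, k⟩, ⟨i, j⟩⟩ hx <;>
    simp only [Finset.mem_sigma, Finset.HasAntidiagonal.mem_antidiagonal] at hx ⊢ <;>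
    obtain ⟨h1, h2⟩ := hx
  · exact ⟨by omega, trivial⟩
  · exact ⟨by omega, trivial⟩
  · subst h2; rfl
  · subst h2; rfl
  · subst h2; subst h1
    rw [smul_mul_assoc, mul_smul_comm, smul_smul, smul_smul, mul_assoc]
    congr 1
    have := Nat.choose_mul (n := i + j + k) (k := i + j) (s := i) (by omega)
    rw [this]
    congr 1
    rw [show i + j + k - i = j + k by omega, show i + j - i = j by omega]

instance : Ring (EvenExt G) :=
  { (inferInstance : AddCommGroup (EvenExt G)), (inferInstance : Mul (EvenExt G)),
    (inferInstance : One (EvenExt G)) with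
    left_distrib := by intro a b c; ext; simp [c_mul, mul_add, Finset.sum_add_distrib]
    right_distrib := by intro a b c; ext; simp [c_mul, add_mul, Finset.sum_add_distrib]
    zero_mul := by intro a; ext; simp [c_mul]
    mul_zero := by intro a; ext; simp [c_mul]
    mul_assoc := EvenExt.mul_assoc
    one_mul := by
      intro a
      ext n
      rw [c_mul, Finset.sum_eq_single (0, n)]
      · simp [c_one]
      · rintro ⟨i, j⟩ h1 h2
        have : i ≠ 0 := by rintro rfl; simp_all
        simp [c_one, this]
      · simp
    mul_one := by
      intro a
      ext n
      rw [c_mul, Finset.sum_eq_single (n, 0)]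
      · simp [c_one]
      · rintro ⟨i, j⟩ h1 h2
        have : j ≠ 0 := by rintro rfl; simp_all
        simp [c_one, this]
      · simp }

instance : Algebra R (EvenExt G) := Algebra.ofModule
  (by intro r a b; ext; simp [c_mul, Finset.smul_sum, smul_comm])
  (by intro r a b; ext; simp [c_mul, Finset.smul_sum, smul_comm])

/-- The extension of a twisted derivation `δ` of `A` which sends the divided power
variable to `c`. -/
def extend (G : GA R A) (δ : A →ₗ[R] A) (τ : A →ₐ[R] A) (c : A) : EvenExt G →ₗ[R] EvenExt G where
  toFun f := ⟨fun i => δ (f.c i) + τ (f.c (i + 1)) * c⟩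
  map_add' := by intro a b; ext; simp [add_mul]; abel
  map_smul' := by intro a b; ext; simp

@[simp] lemma extend_c (δ : A →ₗ[R] A) (τ : A →ₐ[R] A) (c : A) (f : EvenExt G) (i : ℕ) :
    (extend G δ τ c f).c i = δ (f.c i) + τ (f.c (i + 1)) * c := rfl

/-- Coefficientwise application of an algebra endomorphism. -/
def map (G : GA R A) (τ : A →ₐ[R] A) : EvenExt G →ₐ[R] EvenExt G := AlgHom.ofLinearMap
    { toFun := fun f => ⟨fun i => τ (f.c i)⟩
      map_add' := by intro a b; ext; simp
      map_smul' := by intro a b; ext; simp }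
    (by ext n; simp only [LinearMap.coe_mk, AddHom.coe_mk, c_one]; split_ifs <;> simp)
    (by intro a b; ext; simp [c_mul])

@[simp] lemma map_c (τ : A →ₐ[R] A) (f : EvenExt G) (i : ℕ) : (map G τ f).c i = τ (f.c i) := rfl

lemma extend_leib {δ : A →ₗ[R] A} {τ : A →ₐ[R] A} {c : A}
    (hδ : ∀ a b, δ (a * b) = δ a * b + τ a * δ b) (hc : ∀ b, c * b = τ b * c) (f g : EvenExt G) :
    extend G δ τ c (f * g) = extend G δ τ c f * g + map G τ f * extend G δ τ c g := by
  ext n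
  rw [c_add, c_mul, c_mul, extend_c, c_mul, c_mul]
  rw [Finset.sum_antidiagonal_choose_succ_nsmul (fun i j => f.c i * g.c j)]
  have h2 : ∑ ij ∈ Finset.HasAntidiagonal.antidiagonal n,
      n.choose ij.2 • (f.c (ij.1 + 1) * g.c ij.2) =
      ∑ ij ∈ Finset.HasAntidiagonal.antidiagonal n,
      n.choose ij.1 • (f.c (ij.1 + 1) * g.c ij.2) := by
    refine Finset.sum_congr rfl fun ij hij => ?_
    rw [Finset.HasAntidiagonal.mem_antidiagonal] at hij
    rw [Nat.choose_symm_of_eq_add hij.symm]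
  rw [h2, map_add, add_mul]
  simp only [map_sum, Finset.sum_mul, ← Finset.sum_add_distrib]
  refine Finset.sum_congr rfl fun ij _ => ?_
  simp only [map_nsmul, smul_mul_assoc, ← smul_add, map_mul]
  congr 1
  simp only [extend_c, map_c, hδ, add_mul, mul_add, mul_assoc, hc]
  abel

end EvenExt

private lemma sub_mul_parity {n p : ℤ} (hp : Even p) (i : ℕ) :
    (Even n → Even (n - i * p)) ∧ (Odd n → Odd (n - i * p)) :=
  ⟨fun h => h.sub (hp.mul_left _), fun h => h.sub_even (hp.mul_left _)⟩

/-- Extension by a divided power variable of even degree `p` with differential `z`. -/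
def even (G : GA R A) (p : ℤ) (z : A) (hp : Even p) (hp1 : 1 ≤ p) (hz : z ∈ G.gr (p - 1)) :
    GA R (EvenExt G) where
  gr n :=
    { carrier := {f | ∀ i : ℕ, f.c i ∈ G.gr (n - i * p)}
      add_mem' := fun ha hb i => add_mem (ha i) (hb i)
      zero_mem' := fun _ => zero_mem _
      smul_mem' := fun r _ ha i => Submodule.smul_mem _ r (ha i) }
  σ := EvenExt.map G G.σ
  d := EvenExt.extend G G.d G.σ z
  one_mem := by
    intro i
    rw [EvenExt.c_one]
    split_ifs with h
    · subst h; simpa using G.one_mem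
    · exact zero_mem _
  mul_mem := by
    intro i j a b ha hb k
    rw [EvenExt.c_mul]
    refine sum_mem fun st hst => ?_
    rw [Finset.HasAntidiagonal.mem_antidiagonal] at hst
    refine nsmul_mem (G.gr_of_eq (G.mul_mem (ha _) (hb _)) ?_) _
    rw [← hst]; push_cast; ring
  gr_neg n hn := by
    rw [eq_bot_iff]
    intro a ha
    refine EvenExt.ext (funext fun i => G.eq_zero_of_neg ?_ (ha i))
    have : 0 ≤ (i : ℤ) * p := by positivity
    omega
  σ_even := by
    intro n a hn h
    ext i
    exact G.σ_even ((sub_mul_parity hp i).1 hn) (h i)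
  σ_odd := by
    intro n a hn h
    ext i
    exact G.σ_odd ((sub_mul_parity hp i).2 hn) (h i)
  σσ := by intro a; ext; simp [G.σσ]
  σd := by
    intro a
    have hz' : G.σ z = -z := G.σ_odd (hp.sub_odd odd_one) hz
    ext; simp [G.σd, G.σσ, hz']
    abel
  d_mem := by
    intro n a h i
    refine add_mem (G.gr_of_eq (G.d_mem (h i)) (by ring))
      (G.gr_of_eq (G.mul_mem (G.σ_mem (h _)) hz) (by push_cast; ring))
  leib := EvenExt.extend_leib G.leib (G.comm_odd (hp.sub_odd odd_one) hz)
  comm_even := by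
    intro n a hn h b
    ext m
    rw [EvenExt.c_mul, EvenExt.c_mul, ← Finset.Nat.sum_antidiagonal_swap]
    refine Finset.sum_congr rfl fun ij hij => ?_
    rw [Finset.HasAntidiagonal.mem_antidiagonal] at hij
    simp only [Prod.fst_swap, Prod.snd_swap]
    rw [Nat.choose_symm_of_eq_add hij.symm, G.comm_even ((sub_mul_parity hp _).1 hn) (h _)]
  comm_odd := by
    intro n a hn h b
    ext m
    rw [EvenExt.c_mul, EvenExt.c_mul, ← Finset.Nat.sum_antidiagonal_swap]
    refine Finset.sum_congr rfl fun ij hij => ?_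
    rw [Finset.HasAntidiagonal.mem_antidiagonal] at hij
    simp only [Prod.fst_swap, Prod.snd_swap]
    rw [Nat.choose_symm_of_eq_add hij.symm, G.comm_odd ((sub_mul_parity hp _).2 hn) (h _)]
    rfl
  sq_odd := by
    intro n a hn h
    ext m
    rw [EvenExt.c_mul]
    refine Finset.sum_involution (fun ij _ => ij.swap) ?_ ?_ ?_ ?_
    · intro ij hij
      rw [Finset.HasAntidiagonal.mem_antidiagonal] at hij
      simp only [Prod.fst_swap, Prod.snd_swap]
      rw [Nat.choose_symm_of_eq_add hij.symm, G.comm_odd ((sub_mul_parity hp _).2 hn) (h ij.1),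
        G.σ_odd ((sub_mul_parity hp _).2 hn) (h ij.2)]
      simp
    · rintro ⟨i, j⟩ hij h1 h2
      simp only [Prod.swap_prod_mk, Prod.mk.injEq] at h2
      apply h1
      simp only
      rw [h2.1, G.sq_odd ((sub_mul_parity hp _).2 hn) (h i), smul_zero]
    · intro ij hij
      simpa [add_comm] using hij
    · simp

lemma tw_even_eq {G : GA R A} {p : ℤ} {z : A} (hp : Even p) (hp1 : 1 ≤ p)
    (hz : z ∈ G.gr (p - 1)) (n : ℤ) :
    (G.even p z hp hp1 hz).tw n = EvenExt.map G (G.tw n) := by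
  ext f i
  rcases Int.even_or_odd n with h | h
  · rw [tw_even _ h, EvenExt.map_c, tw_even _ h]
  · rw [tw_odd _ h, EvenExt.map_c, tw_odd _ h]; rfl

/-- Extension of a derivation to a divided power variable. -/
noncomputable def evenDer {G : GA R A} {p : ℤ} {z : A} (hp : Even p) (hp1 : 1 ≤ p) (hz : z ∈ G.gr (p - 1))
    (n : ℤ) (D : Der G n) (c : A) (hc : c ∈ G.gr (p - n)) (hdc : G.d c = sg n • D.θ z) :
    Der (G.even p z hp hp1 hz) n where
  θ := EvenExt.extend G D.θ (G.tw n) c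
  mem := by
    intro n a h i
    refine add_mem (G.gr_of_eq (D.mem (h i)) (by ring))
      (G.gr_of_eq (G.mul_mem (G.tw_mem _ (h _)) hc) (by push_cast; ring))
  leib := by
    rw [tw_even_eq]
    refine EvenExt.extend_leib D.leib fun b => ?_
    rcases Int.even_or_odd n with h | h
    · rw [G.tw_even h, G.comm_even (hp.sub h) hc]
    · rw [G.tw_odd h, G.comm_odd (hp.sub_odd h) hc]
  comm := by
    intro a
    have hw := G.comm_odd (hp.sub_odd odd_one) hz
    rcases Int.even_or_odd n with h | h
    · rw [sg_even h, one_smul] at hdc ⊢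
      have hc' := G.σ_even (hp.sub h) hc
      have hc'' := G.comm_even (hp.sub h) hc
      ext i
      simp only [even, EvenExt.extend_c, tw_even _ h, map_add, G.leib, D.leib, hdc, D.comm, D.σθ,
        sg_even h, one_smul, map_mul, add_mul, hc', mul_assoc, hc'']
      abel
    · rw [sg_odd h, neg_one_smul] at hdc ⊢
      have hc' := G.σ_odd (hp.sub_odd h) hc
      have hc'' := G.comm_odd (hp.sub_odd h) hc
      have hz' := G.σ_odd (hp.sub_odd odd_one) hz
      ext i
      simp only [even, EvenExt.extend_c, tw_odd _ h, map_add, G.leib, D.leib, hdc, D.comm, D.σθ,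
        sg_odd h, neg_one_smul, map_mul, add_mul, hc', mul_assoc, EvenExt.c_neg,
        G.σσ, G.σd, mul_neg, neg_mul, hc'' z, hz']
      abel
  σθ := by
    intro a
    rcases Int.even_or_odd n with h | h
    · have hc' := G.σ_even (hp.sub h) hc
      ext i
      simp [even, tw_even _ h, sg_even h, D.σθ, hc']
    · have hc' := G.σ_odd (hp.sub_odd h) hc
      ext i
      simp [even, tw_odd _ h, sg_odd h, D.σθ, hc', G.σσ]
      try abel

/-- The extension by a divided power variable, presented as an adjunction. -/
noncomputable def evenAdj (G : GA R A) (p : ℤ) (z : A) (hp : Even p) (hp1 : 1 ≤ p)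
    (hz : z ∈ G.gr (p - 1)) : Adj G (G.even p z hp hp1 hz) p z where
  al i := True
  al_zero := trivial
  al_one := trivial
  al_succ _ _ := trivial
  cf i j := (i + j).choose i
  co i := { toFun := fun f => f.c i, map_add' := fun _ _ => rfl, map_smul' := fun _ _ => rfl }
  ins i :=
    { toFun := fun a => ⟨fun j => if j = i then a else 0⟩
      map_add' := fun _ _ => by ext j; simp only [EvenExt.c_add]; split_ifs <;> simp
      map_smul' := fun _ _ => by
        ext j; simp only [EvenExt.c_smul, RingHom.id_apply]; split_ifs <;> simp }
  co_ext f g h := EvenExt.ext (funext h)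
  co_al i f h := absurd trivial h
  co_ins i j a _ := rfl
  mem_gr n f := Iff.rfl
  co_d i f := rfl
  co_mul n f g := by
    refine (EvenExt.c_mul f g n).trans ?_
    refine Finset.sum_congr rfl fun ij hij => ?_
    rw [Finset.HasAntidiagonal.mem_antidiagonal] at hij
    rw [hij, G.tw_even (hp.mul_left _)]
    rfl
  ins_one := rfl
  p_pos := hp1
  z_mem := hz
  z_sq _ := G.sq_odd (hp.sub_odd odd_one) hz
  der n D c hc hdc := ⟨evenDer hp hp1 hz n D c hc hdc, fun i f => rfl⟩

end GA

namespace GA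
variable {R : Type u} [CommRing R] {A : Type u} [Ring A] [Algebra R A]
  {B : Type u} [Ring B] [Algebra R B]

/-- Homogeneous cycles. -/
def Cyc (G : GA R A) (n : ℤ) : Submodule R A := G.gr n ⊓ LinearMap.ker G.d

/-- Homogeneous boundaries. -/
def Bd (G : GA R A) (n : ℤ) : Submodule R A := (G.gr (n + 1)).map G.d

lemma mem_Cyc {G : GA R A} {n : ℤ} {a : A} : a ∈ G.Cyc n ↔ a ∈ G.gr n ∧ G.d a = 0 := Iff.rfl

namespace Adj
variable {G : GA R A} {G' : GA R B} {p : ℤ} {z : A} (a : Adj G G' p z)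
include a

lemma ins_mem {i : ℕ} (hi : a.al i) {n m : ℤ} {x : A} (hx : x ∈ G.gr n) (h : m = n + i * p) :
    a.ins i x ∈ G'.gr m := by
  rw [a.mem_gr]
  intro j
  rw [a.co_ins _ _ _ hi]
  split_ifs with hj
  · subst hj; exact G.gr_of_eq hx (by rw [h]; ring)
  · exact zero_mem _

lemma co_mem {n m : ℤ} {f : B} (hf : f ∈ G'.gr n) (i : ℕ) (h : m = n - i * p) :
    a.co i f ∈ G.gr m := h ▸ (a.mem_gr n f).1 hf i

lemma co_eq_zero {n : ℤ} {f : B} (hf : f ∈ G'.gr n) {i : ℕ} (h : n - i * p < 0) :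
    a.co i f = 0 := G.eq_zero_of_neg h ((a.mem_gr n f).1 hf i)

lemma eq_sum {n : ℤ} {f : B} (hf : f ∈ G'.gr n) {N : ℕ} (hN : n - N * p < 0) :
    f = ∑ i ∈ Finset.range N, a.ins i (a.co i f) := by
  apply a.co_ext
  intro j
  rw [map_sum]
  have hp := a.p_pos
  by_cases hj : j < N
  · rw [Finset.sum_eq_single_of_mem j (Finset.mem_range.2 hj)]
    · by_cases hal : a.al j
      · rw [a.co_ins _ _ _ hal, if_pos rfl]
      · rw [a.co_al _ _ hal]; simp
    · intro i _ hij
      by_cases hal : a.al i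
      · rw [a.co_ins _ _ _ hal, if_neg (Ne.symm hij)]
      · rw [a.co_al _ _ hal]; simp
  · rw [a.co_eq_zero hf, Finset.sum_eq_zero]
    · intro i hi
      rw [Finset.mem_range] at hi
      by_cases hal : a.al i
      · rw [a.co_ins _ _ _ hal, if_neg (by omega)]
      · rw [a.co_al _ _ hal]; simp
    · have : (N : ℤ) * p ≤ j * p := by
        apply mul_le_mul_of_nonneg_right _ (by omega)
        exact_mod_cast not_lt.1 hj
      omega

lemma eq_ins {n : ℤ} (hn : n < p) {f : B} (hf : f ∈ G'.gr n) : f = a.ins 0 (a.co 0 f) := by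
  simpa using a.eq_sum hf (N := 1) (by simpa using hn)

lemma d_ins_zero (x : A) : G'.d (a.ins 0 x) = a.ins 0 (G.d x) := by
  apply a.co_ext
  intro i
  rw [a.co_d, a.co_ins _ _ _ a.al_zero, a.co_ins _ _ _ a.al_zero, a.co_ins _ _ _ a.al_zero,
    if_neg (Nat.succ_ne_zero i)]
  split_ifs <;> simp

lemma d_ins_succ (i : ℕ) (hi : a.al (i + 1)) (x : A) :
    G'.d (a.ins (i + 1) x) = a.ins (i + 1) (G.d x) + a.ins i (G.σ x * z) := by
  apply a.co_ext
  intro j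
  have hi' := a.al_succ _ hi
  rw [a.co_d, map_add, a.co_ins _ _ _ hi, a.co_ins _ _ _ hi, a.co_ins _ _ _ hi', a.co_ins _ _ _ hi]
  congr 1
  · split_ifs <;> simp
  · by_cases h : j = i
    · simp [h]
    · simp [h]

lemma mem_smul_gr (I : Ideal R) (n : ℤ) (f : B) (hf : f ∈ G'.gr n) :
    f ∈ I • G'.gr n ↔ ∀ i : ℕ, a.co i f ∈ I • G.gr (n - i * p) := by
  constructor
  · intro h i
    have := Submodule.mem_map_of_mem (f := a.co i) h
    rw [Submodule.map_smul''] at this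
    refine Submodule.smul_mono le_rfl ?_ this
    rintro _ ⟨x, hx, rfl⟩
    exact a.co_mem hx i rfl
  · intro h
    have hp := a.p_pos
    have hN : n - (n.toNat + 1 : ℕ) * p < 0 := by
      have : ((n.toNat + 1 : ℕ) : ℤ) * 1 ≤ (n.toNat + 1 : ℕ) * p :=
        mul_le_mul_of_nonneg_left hp (by positivity)
      push_cast at this ⊢
      omega
    rw [a.eq_sum hf hN]
    refine sum_mem fun i _ => ?_
    by_cases hal : a.al i
    · have := Submodule.mem_map_of_mem (f := a.ins i) (h i)
      rw [Submodule.map_smul''] at this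
      refine Submodule.smul_mono le_rfl ?_ this
      rintro _ ⟨x, hx, rfl⟩
      exact a.ins_mem hal hx (by ring)
    · rw [a.co_al _ _ hal]; simp

lemma z_term (i : ℕ) (f : B) : a.co (i + 2) f * (G.σ z * z) = 0 := by
  by_cases h : a.al (i + 2)
  · have h2 : a.al 2 := by
      induction i with
      | zero => simpa using h
      | succ i ih => exact ih (a.al_succ _ h)
    rcases Int.even_or_odd (p - 1) with hp | hp
    · rw [G.σ_even hp a.z_mem, a.z_sq h2, mul_zero]
    · rw [G.σ_odd hp a.z_mem, neg_mul, a.z_sq h2]; simp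
  · rw [a.co_al _ _ h]; simp

lemma dd (hdd : ∀ x, G.d (G.d x) = 0) (hz : G.d z = 0) (f : B) : G'.d (G'.d f) = 0 := by
  apply a.co_ext
  intro i
  have := a.z_term i f
  simp only [a.co_d, map_add, map_mul, G.leib, hdd, G.σσ, hz, G.σd, map_zero, add_mul, mul_assoc,
    this]
  simp

end Adj

section Local
variable [IsLocalRing R]

local notation "𝔪" => IsLocalRing.maximalIdeal R

/-- Cycles, with cycles of degree zero replaced by the maximal ideal. -/
def Zt (G : GA R A) (n : ℤ) : Submodule R A := if n = 0 then 𝔪 • G.gr 0 else G.Cyc n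

lemma Zt_zero (G : GA R A) : G.Zt 0 = 𝔪 • G.gr 0 := if_pos rfl

lemma Zt_of_ne (G : GA R A) {n : ℤ} (hn : n ≠ 0) : G.Zt n = G.Cyc n := if_neg hn

lemma d_gr_zero (G : GA R A) {a : A} (ha : a ∈ G.gr 0) : G.d a = 0 :=
  G.eq_zero_of_neg (by omega) (G.d_mem ha)

lemma Zt_le_Cyc (G : GA R A) (n : ℤ) : G.Zt n ≤ G.Cyc n := by
  by_cases hn : n = 0
  · subst hn
    rw [Zt_zero]
    intro a ha
    have : a ∈ G.gr 0 := Submodule.smul_le_right ha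
    exact ⟨this, G.d_gr_zero this⟩
  · rw [G.Zt_of_ne hn]

/-- A derivation of degree `l` is nondegenerate if its values on elements of degree `l` whose
differential lies in `𝔪 Z` are nonunits. -/
def Der.Nondeg {G : GA R A} {l : ℤ} (D : Der G l) : Prop :=
  ∀ y ∈ G.gr l, G.d y ∈ 𝔪 • G.Zt (l - 1) → D.θ y ∈ 𝔪 • G.gr 0

/-- The invariants maintained by Tate's construction, where `t` is the largest degree of
a variable. -/
structure Good (G : GA R A) (t : ℤ) : Prop where
  t_pos : 1 ≤ t
  dd : ∀ a, G.d (G.d a) = 0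
  gr_zero : ∀ a ∈ G.gr 0, ∃ r : R, a = r • 1
  one_inj : ∀ r : R, r • (1 : A) = 0 → r = 0
  d_one : ∀ a ∈ G.gr 1, G.d a ∈ 𝔪 • G.gr 0
  acyc : ∀ i, i < t - 1 → G.Zt i ≤ G.Bd i
  det : ∀ n, 1 ≤ n → ∀ f ∈ G.gr n, f ∉ 𝔪 • G.gr n →
    ∃ l, 1 ≤ l ∧ l ≤ n ∧ l ≤ t ∧ ∃ D : Der G l, D.Nondeg ∧ D.θ f ∉ 𝔪 • G.gr (n - l)

/-- The conditions under which Tate's construction adjoins a variable of degree `p` and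
differential `z`. -/
structure Legal (G : GA R A) (t p : ℤ) (z : A) : Prop where
  le : t ≤ p
  mem : z ∈ G.Zt (p - 1)
  nmem : z ∉ G.Bd (p - 1) ⊔ 𝔪 • G.Zt (p - 1)
  acyc : ∀ i, i < p - 1 → G.Zt i ≤ G.Bd i

lemma good_base : Good (base R) 1 where
  t_pos := le_rfl
  dd := by simp [base]
  gr_zero := by intro a _; exact ⟨a, by simp⟩
  one_inj := by simp
  d_one := by simp [base]
  acyc := by
    intro i hi a ha
    have := ((base R).Zt_le_Cyc i ha).1
    rw [(base R).gr_neg i (by omega)] at this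
    rw [(Submodule.mem_bot R).1 this]; exact zero_mem _
  det := by
    intro n hn f hf h
    exfalso; apply h
    have : f = 0 := by simpa [base, show n ≠ 0 by omega] using hf
    rw [this]; exact zero_mem _

lemma Adj.co_zero_Zt {G : GA R A} {G' : GA R B} {p : ℤ} {z : A} (a : Adj G G' p z) {n : ℤ}
    (hn : n < p) {f : B} (hf : f ∈ G'.Zt n) : a.co 0 f ∈ G.Zt n := by
  by_cases h0 : n = 0
  · subst h0
    rw [Zt_zero] at hf ⊢
    simpa using (a.mem_smul_gr 𝔪 0 f (Submodule.smul_le_right hf)).1 hf 0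
  · rw [Zt_of_ne _ h0] at hf ⊢
    refine ⟨a.co_mem hf.1 0 (by simp), ?_⟩
    have h1 := a.co_d 0 f
    have h2 : G'.d f = 0 := hf.2
    rw [h2, a.co_eq_zero hf.1 (i := 0 + 1) (by simpa using hn)] at h1
    simpa using h1.symm

lemma Adj.acyc_lt {G : GA R A} {G' : GA R B} {p : ℤ} {z : A} (a : Adj G G' p z) {n : ℤ}
    (hn : n < p) (h : G.Zt n ≤ G.Bd n) : G'.Zt n ≤ G'.Bd n := by
  intro f hf
  obtain ⟨y, hy, hy'⟩ := h (a.co_zero_Zt hn hf)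
  refine ⟨a.ins 0 y, a.ins_mem a.al_zero hy (by simp), ?_⟩
  rw [a.d_ins_zero, hy', ← a.eq_ins hn (G'.Zt_le_Cyc n hf).1]

/-- Nondegenerate derivations extend to nondegenerate derivations along legal adjunctions. -/
lemma Adj.exists_der {G : GA R A} {G' : GA R B} {p t : ℤ} {z : A} (a : Adj G G' p z)
    (hG : Good G t) (hL : Legal G t p z) {l : ℤ} (hl : 1 ≤ l) (hlt : l ≤ p) (D : Der G l) (c : A)
    (hc : c ∈ G.gr (p - l)) (hdc : G.d c = sg l • D.θ z)
    (hD : l < p → D.Nondeg)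
    (hD' : l = p → ∀ y ∈ G.gr l, G.d y ∈ 𝔪 • G.Zt (l - 1) → D.θ y ∈ 𝔪 • G.gr 0) :
    ∃ D' : Der G' l, D'.Nondeg ∧
      ∀ i f, a.co i (D'.θ f) = D.θ (a.co i f) + G.tw l (a.co (i + 1) f) * c := by
  obtain ⟨D', hD1⟩ := a.der l D c hc hdc
  refine ⟨D', ?_, hD1⟩
  intro y hy hdy
  have hθ : D'.θ y ∈ G'.gr 0 := G'.gr_of_eq (D'.mem hy) (by ring)
  have hp := a.p_pos
  rw [a.mem_smul_gr _ _ _ hθ]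
  intro i
  rcases Nat.eq_zero_or_pos i with rfl | hi
  swap
  · rw [a.co_eq_zero hθ]
    · exact zero_mem _
    · have : (1 : ℤ) * 1 ≤ i * p := mul_le_mul (by exact_mod_cast hi) hp (by omega) (by omega)
      omega
  have hd0 : a.co 0 (G'.d y) ∈ 𝔪 • G.Zt (l - 1) := by
    have := Submodule.mem_map_of_mem (f := a.co 0) hdy
    rw [Submodule.map_smul''] at this
    refine Submodule.smul_mono le_rfl ?_ this
    rintro _ ⟨x, hx, rfl⟩
    exact a.co_zero_Zt (by omega) hx
  rw [a.co_d] at hd0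
  have hy0 : a.co 0 y ∈ G.gr l := a.co_mem hy 0 (by simp)
  rw [hD1]
  simp only [Nat.cast_zero, zero_mul, sub_zero, zero_add] at hd0 ⊢
  rcases hlt.lt_or_eq with hlt | rfl
  · have h1 : a.co 1 y = 0 := a.co_eq_zero hy (by simpa using hlt)
    rw [h1] at hd0 ⊢
    simp only [map_zero, zero_mul, add_zero] at hd0 ⊢
    exact hD hlt _ hy0 hd0
  · have h1 : a.co 1 y ∈ G.gr 0 := a.co_mem hy 1 (by simp)
    obtain ⟨r, hr⟩ := hG.gr_zero _ h1
    have hrm : r ∈ 𝔪 := by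
      by_contra hru
      have hru : IsUnit r := by
        rwa [IsLocalRing.mem_maximalIdeal, mem_nonunits_iff, not_not] at hru
      apply hL.nmem
      rw [hr] at hd0
      simp only [map_smul, map_one, smul_mul_assoc, one_mul] at hd0
      have hb : G.d (a.co 0 y) ∈ G.Bd (l - 1) := ⟨_, G.gr_of_eq hy0 (by ring), rfl⟩
      have : r • z ∈ G.Bd (l - 1) ⊔ 𝔪 • G.Zt (l - 1) := by
        have e : r • z = -G.d (a.co 0 y) + (G.d (a.co 0 y) + r • z) := by abel
        rw [e]
        exact Submodule.add_mem_sup (neg_mem hb) hd0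
      obtain ⟨v, hv⟩ := hru
      have := Submodule.smul_mem _ (↑v⁻¹ : R) this
      rwa [← hv, smul_smul, Units.inv_mul, one_smul] at this
    have hdy0 : G.d (a.co 0 y) ∈ 𝔪 • G.Zt (l - 1) := by
      have e : G.d (a.co 0 y) = (G.d (a.co 0 y) + G.σ (a.co 1 y) * z) - r • z := by
        rw [hr]; simp
      rw [e]
      exact sub_mem hd0 (Submodule.smul_mem_smul hrm hL.mem)
    refine add_mem (hD' rfl _ hy0 hdy0) ?_
    rw [hr]
    simp only [map_smul, map_one, smul_mul_assoc, one_mul]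
    exact Submodule.smul_mem_smul hrm (G.gr_of_eq hc (by ring))

lemma Adj.good {G : GA R A} {G' : GA R B} {p t : ℤ} {z : A} (a : Adj G G' p z) (hG : Good G t)
    (hL : Legal G t p z) : Good G' p where
  t_pos := a.p_pos
  dd := a.dd hG.dd (G.Zt_le_Cyc _ hL.mem).2
  gr_zero := by
    intro f hf
    have hp := a.p_pos
    obtain ⟨r, hr⟩ := hG.gr_zero _ (a.co_mem hf 0 (by simp))
    refine ⟨r, ?_⟩
    rw [a.eq_ins (by omega) hf, hr, map_smul, a.ins_one]
  one_inj := by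
    intro r hr
    apply hG.one_inj
    rw [← a.ins_one, ← map_smul] at hr
    have := congrArg (a.co 0) hr
    rwa [a.co_ins _ _ _ a.al_zero, if_pos rfl, map_zero] at this
  d_one := by
    intro f hf
    have hp := a.p_pos
    have hdf : G'.d f ∈ G'.gr 0 := G'.d_mem hf
    rw [a.mem_smul_gr _ _ _ hdf]
    intro i
    rcases Nat.eq_zero_or_pos i with rfl | hi
    swap
    · rw [a.co_eq_zero hdf]
      · exact zero_mem _
      · have : (1 : ℤ) * 1 ≤ i * p := mul_le_mul (by exact_mod_cast hi) hp (by omega) (by omega)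
        omega
    rw [a.co_d]
    have h0 := hG.d_one _ (a.co_mem hf 0 (by simp))
    simp only [Nat.cast_zero, zero_mul, sub_zero, zero_add]
    refine add_mem h0 ?_
    rcases hp.lt_or_eq with hp | rfl
    · rw [a.co_eq_zero hf (by simpa using hp)]; simp
    · have h1 : a.co 1 f ∈ G.gr 0 := a.co_mem hf 1 (by simp)
      obtain ⟨r, hr⟩ := hG.gr_zero _ h1
      rw [hr]
      simp only [map_smul, map_one, smul_mul_assoc, one_mul]
      have := hL.mem
      simp only [sub_self, Zt_zero] at this
      exact Submodule.smul_mem _ _ this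
  acyc i hi := a.acyc_lt (by omega) (hL.acyc i hi)
  det := by
    intro n hn f hf hfm
    have hp := a.p_pos
    by_cases h : ∃ i : ℕ, a.co (i + 1) f ∉ 𝔪 • G.gr (n - (i + 1 : ℕ) * p)
    · obtain ⟨i, hi⟩ := h
      have hpn : p ≤ n := by
        by_contra hpn
        apply hi
        rw [a.co_eq_zero hf]
        · exact zero_mem _
        · have : (1 : ℤ) * p ≤ (i + 1 : ℕ) * p :=
            mul_le_mul_of_nonneg_right (by push_cast; omega) (by omega)
          omega
      obtain ⟨D', h1, h2⟩ := a.exists_der hG hL (l := p) hp le_rfl (Der.zero G p) 1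
        (by simpa using G.one_mem)
        (by simp [Der.zero, G.d_gr_zero G.one_mem]) (by omega) (by simp [Der.zero])
      refine ⟨p, hp, hpn, le_rfl, D', h1, fun hmem => hi ?_⟩
      have h3 := (a.mem_smul_gr _ _ _ (D'.mem hf)).1 hmem i
      rw [h2] at h3
      simp only [Der.zero, LinearMap.zero_apply, zero_add, mul_one] at h3
      have h4 : a.co (i + 1) f ∈ G.gr (n - (i + 1 : ℕ) * p) := a.co_mem hf _ rfl
      have e : n - p - i * p = n - (i + 1 : ℕ) * p := by push_cast; ring
      rw [e] at h3
      rcases Int.even_or_odd p with hpe | hpo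
      · rwa [G.tw_even hpe] at h3
      · rw [G.tw_odd hpo] at h3
        rcases Int.even_or_odd (n - (i + 1 : ℕ) * p) with he | ho
        · rwa [G.σ_even he h4] at h3
        · rw [G.σ_odd ho h4] at h3
          simpa using neg_mem h3
    · push Not at h
      have h0 : a.co 0 f ∉ 𝔪 • G.gr n := by
        intro h0
        apply hfm
        rw [a.mem_smul_gr _ _ _ hf]
        rintro (_ | i)
        · simpa using h0
        · exact h i
      obtain ⟨l, hl1, hln, hlt, D, hD, hDf⟩ := hG.det n hn _ (a.co_mem hf 0 (by simp)) h0
      have hlp : l ≤ p := hlt.trans hL.le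
      have hz := G.Zt_le_Cyc _ hL.mem
      have hθz : D.θ z ∈ G.gr (p - 1 - l) := D.mem hz.1
      have hdz : G.d z = 0 := hz.2
      obtain ⟨c, hc, hdc⟩ : ∃ c ∈ G.gr (p - l), G.d c = sg l • D.θ z := by
        rcases lt_trichotomy l (p - 1) with h1 | h1 | h1
        · have hcy : sg l • D.θ z ∈ G.Zt (p - 1 - l) := by
            rw [Zt_of_ne _ (by omega)]
            refine ⟨zsmul_mem hθz _, ?_⟩
            change G.d _ = 0
            rw [map_zsmul, D.comm, hdz]; simp
          obtain ⟨c, hc, hc'⟩ := hL.acyc _ (by omega) hcy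
          exact ⟨c, G.gr_of_eq hc (by ring), hc'⟩
        · have hcy : sg l • D.θ z ∈ G.Zt 0 := by
            rw [Zt_zero]
            refine zsmul_mem (hD z (G.gr_of_eq hz.1 h1.symm) ?_) _
            rw [hdz]; exact zero_mem _
          obtain ⟨c, hc, hc'⟩ := hL.acyc 0 (by omega) hcy
          exact ⟨c, G.gr_of_eq hc (by rw [h1]; ring), hc'⟩
        · refine ⟨0, zero_mem _, ?_⟩
          rw [G.eq_zero_of_neg (by omega) hθz]; simp
      obtain ⟨D', h1, h2⟩ := a.exists_der hG hL hl1 hlp D c hc hdc (fun _ => hD) (fun _ => hD)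
      refine ⟨l, hl1, hln, hlp, D', h1, fun hmem => hDf ?_⟩
      have h3 := (a.mem_smul_gr _ _ _ (D'.mem hf)).1 hmem 0
      rw [h2] at h3
      simp only [Nat.cast_zero, zero_mul, sub_zero, zero_add] at h3
      have h4 := h 0
      simp only [zero_add] at h4
      have h5 : G.tw l (a.co 1 f) * c ∈ 𝔪 • G.gr (n - l) := by
        let φ : A →ₗ[R] A := (LinearMap.mulRight R c).comp (G.tw l).toLinearMap
        have := Submodule.mem_map_of_mem (f := φ) h4
        rw [Submodule.map_smul''] at this
        refine Submodule.smul_mono le_rfl ?_ this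
        rintro _ ⟨x, hx, rfl⟩
        exact G.gr_of_eq (G.mul_mem (G.tw_mem l hx) hc) (by push_cast; ring)
      simpa using sub_mem h3 h5

/-- Minimality of Tate's construction. -/
lemma Good.minimal {G : GA R A} {t : ℤ} (hG : Good G t) (n : ℕ) :
    ∀ g ∈ G.gr n, G.d g ∈ 𝔪 • G.gr (n - 1) := by
  induction n using Nat.strong_induction_on with
  | _ n ih =>
    intro g hg
    match n with
    | 0 => rw [G.d_gr_zero hg]; exact zero_mem _
    | 1 => simpa using hG.d_one g hg
    | n + 2 =>
      by_contra hcon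
      obtain ⟨l, hl1, hln, -, D, -, hDf⟩ := hG.det _ (by push_cast; omega) _ (G.d_mem hg) hcon
      apply hDf
      have h1 := ih ((n + 2 : ℕ) - l).toNat (by push_cast at hln ⊢; omega) (D.θ g)
        (G.gr_of_eq (D.mem hg) (by push_cast at hln ⊢; omega))
      have h2 := D.comm g
      have h3 : D.θ (G.d g) = sg l • G.d (D.θ g) := by
        rw [h2, smul_smul, sg_mul_sg, one_smul]
      rw [h3]
      have e : ((((n + 2 : ℕ) : ℤ) - l).toNat : ℤ) - 1 = ((n + 2 : ℕ) : ℤ) - 1 - l := by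
        push_cast at hln ⊢; omega
      rw [e] at h1
      exact zsmul_mem h1 _

end Local
end GA

namespace GA
variable {R : Type u} [CommRing R] {A : Type u} [Ring A] [Algebra R A]
  {B : Type u} [Ring B] [Algebra R B]

/-- Every homogeneous component is free of finite rank. -/
def FF (G : GA R A) : Prop := ∀ n, Module.Free R (G.gr n) ∧ Module.Finite R (G.gr n)

open Classical in
/-- The homogeneous components of an adjunction. -/
noncomputable def Adj.grEquiv {G : GA R A} {G' : GA R B} {p : ℤ} {z : A} (a : Adj G G' p z) (n : ℤ)
    (N : ℕ) (hN : n - N * p < 0) :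
    G'.gr n ≃ₗ[R] ((i : {i : Fin N // a.al i}) → G.gr (n - (i.1 : ℕ) * p)) where
  toFun f i := ⟨a.co i.1 f.1, a.co_mem f.2 _ rfl⟩
  map_add' f g := by ext i; simp
  map_smul' r f := by ext i; simp
  invFun g := ⟨∑ i, a.ins i.1 (g i).1, sum_mem fun i _ => a.ins_mem i.2 (g i).2 (by ring)⟩
  left_inv f := by
    ext1
    apply a.co_ext
    intro j
    simp only [map_sum]
    by_cases hal : a.al j
    · by_cases hj : j < N
      · rw [Finset.sum_eq_single_of_mem ⟨⟨j, hj⟩, hal⟩ (Finset.mem_univ _)]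
        · rw [a.co_ins _ _ _ hal, if_pos rfl]
        · intro i _ hi
          rw [a.co_ins _ _ _ i.2, if_neg]
          rintro rfl
          exact hi rfl
      · rw [a.co_eq_zero f.2, Finset.sum_eq_zero]
        · intro i _
          rw [a.co_ins _ _ _ i.2, if_neg]
          have := i.1.2
          omega
        · have hp := a.p_pos
          have : (N : ℤ) * p ≤ j * p := by
            apply mul_le_mul_of_nonneg_right _ (by omega)
            exact_mod_cast not_lt.1 hj
          omega
    · rw [a.co_al _ _ hal, Finset.sum_eq_zero]
      intro i _
      rw [a.co_ins _ _ _ i.2, if_neg]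
      rintro rfl
      exact hal i.2
  right_inv g := by
    ext j
    simp only [map_sum]
    rw [Finset.sum_eq_single_of_mem j (Finset.mem_univ _)]
    · rw [a.co_ins _ _ _ j.2, if_pos rfl]
    · intro i _ hi
      rw [a.co_ins _ _ _ i.2, if_neg]
      intro h
      exact hi (Subtype.ext (Fin.ext h.symm))

lemma Adj.exists_bound {G : GA R A} {G' : GA R B} {p : ℤ} {z : A} (a : Adj G G' p z) (n : ℤ) :
    n - (n.toNat + 1 : ℕ) * p < 0 := by
  have : ((n.toNat + 1 : ℕ) : ℤ) * 1 ≤ (n.toNat + 1 : ℕ) * p :=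
    mul_le_mul_of_nonneg_left a.p_pos (by positivity)
  push_cast at this ⊢
  omega

lemma FF.adj {G : GA R A} {G' : GA R B} {p : ℤ} {z : A} (h : FF G) (a : Adj G G' p z) : FF G' := by
  intro n
  have := fun n => (h n).1
  have := fun n => (h n).2
  let e := a.grEquiv n _ (a.exists_bound n)
  exact ⟨Module.Free.of_equiv e.symm, Module.Finite.equiv e.symm⟩

lemma FF.base : FF (base R) := by
  intro n
  by_cases h : n = 0
  · have : (GA.base R).gr n = ⊤ := if_pos h
    rw [this]
    exact ⟨Module.Free.of_equiv (Submodule.topEquiv).symm,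
      Module.Finite.equiv (Submodule.topEquiv).symm⟩
  · have : (GA.base R).gr n = ⊥ := if_neg h
    rw [this]
    exact ⟨inferInstance, inferInstance⟩

section Local
variable [IsLocalRing R]

local notation "𝔪" => IsLocalRing.maximalIdeal R

variable (R) in
/-- A stage of Tate's construction: `t` is the largest degree of a variable, `e` is the number of
variables of even degree. -/
structure Stage where
  A : Type u
  [ring : Ring A]
  [alg : Algebra R A]
  G : GA R A
  t : ℤ
  e : ℕ
  good : Good G t
  ff : FF G

attribute [instance] Stage.ring Stage.alg

/-- One step of Tate's construction. -/
structure Stage.StepBy (s s' : Stage R) (p : ℤ) (z : s.A) where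
  legal : Legal s.G s.t p z
  adj : Adj s.G s'.G p z
  t_eq : s'.t = p
  par : Odd p ∧ (∀ i, adj.al i → i < 2) ∧ s'.e = s.e ∨ Even p ∧ (∀ i, adj.al i) ∧ s'.e = s.e + 1

/-- The step relation of Tate's construction. -/
def Stage.Step (s s' : Stage R) : Prop := ∃ p z, Nonempty (s.StepBy s' p z)

/-- Reachability. -/
abbrev Stage.Reach : Stage R → Stage R → Prop := Relation.ReflTransGen Stage.Step

lemma Stage.exists_stepBy (s : Stage R) {p : ℤ} {z : s.A} (h : Legal s.G s.t p z) :
    ∃ s' : Stage R, Nonempty (s.StepBy s' p z) := by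
  have hp1 : 1 ≤ p := s.good.t_pos.trans h.le
  have hz := (s.G.Zt_le_Cyc _ h.mem).1
  rcases Int.even_or_odd p with hp | hp
  · let a := evenAdj s.G p z hp hp1 hz
    refine ⟨⟨EvenExt s.G, even s.G p z hp hp1 hz, p, s.e + 1, a.good s.good h, s.ff.adj a⟩,
      ⟨⟨h, a, rfl, Or.inr ⟨hp, fun i => trivial, rfl⟩⟩⟩⟩
  · let a := oddAdj s.G p z hp hp1 hz
    refine ⟨⟨OddExt s.G, odd s.G p z hp hp1 hz, p, s.e, a.good s.good h, s.ff.adj a⟩,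
      ⟨⟨h, a, rfl, Or.inl ⟨hp, fun i hi => Nat.lt_succ_of_le hi, rfl⟩⟩⟩⟩

lemma Stage.Step.e_le {s s' : Stage R} (h : s.Step s') : s.e ≤ s'.e := by
  obtain ⟨p, z, ⟨h⟩⟩ := h
  rcases h.par with h | h <;> omega

lemma Stage.Reach.e_le {s s' : Stage R} (h : s.Reach s') : s.e ≤ s'.e := by
  induction h with
  | refl => rfl
  | tail _ h ih => exact ih.trans h.e_le

/-- Exactness in degrees below `n`. -/
def AcycLT (G : GA R A) (n : ℤ) : Prop := ∀ i, i < n → G.Zt i ≤ G.Bd i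

lemma Stage.exists_legal [IsNoetherianRing R] (s : Stage R) {n : ℤ} (h : s.G.AcycLT n)
    (hn : ¬ s.G.Zt n ≤ s.G.Bd n) : ∃ z, Legal s.G s.t (n + 1) z := by
  have hfin := (s.ff n).2
  have hnoeth : IsNoetherian R (s.G.gr n) := inferInstance
  have hfg : (s.G.Zt n).FG := by
    have := (IsNoetherian.noetherian ((s.G.Zt n).comap (s.G.gr n).subtype)).map (s.G.gr n).subtype
    rwa [Submodule.map_comap_subtype, inf_eq_right.2] at this
    exact fun x hx => (s.G.Zt_le_Cyc n hx).1
  have : ¬ s.G.Zt n ≤ s.G.Bd n ⊔ 𝔪 • s.G.Zt n := by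
    intro hle
    apply hn
    exact Submodule.le_of_le_smul_of_le_jacobson_bot hfg
      (IsLocalRing.maximalIdeal_le_jacobson ⊥) hle
  obtain ⟨z, hz, hz'⟩ := SetLike.not_le_iff_exists.1 this
  refine ⟨z, ?_, by simpa using hz, by simpa using hz',
    fun i hi => h i (by simpa using hi)⟩
  by_contra hlt
  exact hn (s.good.acyc n (by omega))

lemma Stage.Step.acycLT {s s' : Stage R} (h : s.Step s') {n : ℤ} (hs : s.G.AcycLT n) :
    s'.G.AcycLT n := by
  obtain ⟨p, z, ⟨h⟩⟩ := h
  intro i hi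
  by_cases hp : i < p
  · exact h.adj.acyc_lt hp (hs i hi)
  · exfalso
    apply h.legal.nmem
    exact Submodule.mem_sup_left (hs _ (by omega) h.legal.mem)

lemma Stage.Reach.acycLT {s s' : Stage R} (h : s.Reach s') {n : ℤ} (hs : s.G.AcycLT n) :
    s'.G.AcycLT n := by
  induction h with
  | refl => exact hs
  | tail _ h ih => exact h.acycLT ih

lemma Stage.kill_degree [IsNoetherianRing R] {n : ℤ} {V : Type u} [AddCommGroup V] [Module R V]
    [IsNoetherian R V] (N : Submodule R V) : ∀ (s : Stage R) (ι : V →ₗ[R] s.A),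
      LinearMap.range ι = s.G.gr n → (s.G.Bd n).comap ι = N → s.G.AcycLT n →
      ∃ s', s.Reach s' ∧ s'.G.AcycLT (n + 1) := by
  induction N using (wellFounded_gt (α := Submodule R V)).induction with
  | _ N ih =>
    intro s ι hι hN hs
    by_cases hn : s.G.Zt n ≤ s.G.Bd n
    · refine ⟨s, .refl, fun i hi => ?_⟩
      rcases (Int.lt_add_one_iff.1 hi).lt_or_eq with h | rfl
      · exact hs i h
      · exact hn
    · obtain ⟨z, hz⟩ := s.exists_legal hs hn
      obtain ⟨s', ⟨h⟩⟩ := s.exists_stepBy hz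
      have hstep : s.Step s' := ⟨_, _, ⟨h⟩⟩
      have a := h.adj
      obtain ⟨s'', h1, h2⟩ := ih ((s'.G.Bd n).comap ((a.ins 0).comp ι)) (by
        rw [SetLike.lt_iff_le_and_exists]
        constructor
        · rw [← hN]
          rintro v ⟨b, hb, hb'⟩
          exact ⟨a.ins 0 b, a.ins_mem a.al_zero hb (by simp), by
            rw [a.d_ins_zero, hb']; rfl⟩
        · have hzm : z ∈ s.G.gr n := s.G.gr_of_eq (s.G.Zt_le_Cyc _ hz.mem).1 (by ring)
          rw [← hι] at hzm
          obtain ⟨v, hv⟩ := hzm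
          refine ⟨v, ⟨a.ins 1 1, a.ins_mem a.al_one s.G.one_mem (by simp), ?_⟩, ?_⟩
          · rw [a.d_ins_succ 0 a.al_one, s.G.d_gr_zero s.G.one_mem]
            simp [hv]
          · rw [← hN]
            intro hv'
            apply hz.nmem
            refine Submodule.mem_sup_left ?_
            rw [← hv]
            simpa using hv') s' ((a.ins 0).comp ι) (by
        rw [LinearMap.range_comp, hι]
        apply le_antisymm
        · rintro _ ⟨x, hx, rfl⟩
          exact a.ins_mem a.al_zero hx (by simp)
        · intro x hx
          exact ⟨a.co 0 x, a.co_mem hx 0 (by simp), (a.eq_ins (by omega) hx).symm⟩) rfl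
        (hstep.acycLT hs)
      exact ⟨s'', .head hstep h1, h2⟩

lemma Stage.kill [IsNoetherianRing R] (s : Stage R) (n : ℕ) :
    ∃ s', s.Reach s' ∧ s'.G.AcycLT n := by
  induction n with
  | zero =>
    refine ⟨s, .refl, fun i hi x hx => ?_⟩
    rw [s.G.eq_zero_of_neg (by simpa using hi) (s.G.Zt_le_Cyc _ hx).1]
    exact zero_mem _
  | succ n ih =>
    obtain ⟨s', h1, h2⟩ := ih
    have := (s'.ff n).2
    obtain ⟨s'', h3, h4⟩ := kill_degree _ s' (s'.G.gr n).subtype (by simp) rfl h2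
    exact ⟨s'', h1.trans h3, by simpa using h4⟩

end Local
end GA

namespace GA
variable {R : Type u} [CommRing R] {A : Type u} [Ring A] [Algebra R A]
  {B : Type u} [Ring B] [Algebra R B]

section Local
variable [IsLocalRing R]

local notation "𝔪" => IsLocalRing.maximalIdeal R

/-- There is an acyclic homogeneous right ideal containing `𝔪 ^ j`. -/
def NilFam (G : GA R A) : Prop := ∃ (N : ℤ → Submodule R A) (j : ℕ), (∀ n, N n ≤ G.gr n) ∧
  (∀ m n a b, a ∈ N m → b ∈ G.gr n → a * b ∈ N (m + n)) ∧
  (∀ n, ∀ z ∈ N n, G.d z = 0 → ∃ y ∈ N (n + 1), G.d y = z) ∧ ∀ n, 𝔪 ^ j • G.gr n ≤ N n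

lemma NilFam.adj {G : GA R A} {G' : GA R B} {p : ℤ} {z : A} (h : NilFam G) (a : Adj G G' p z)
    (hdd : ∀ x, G.d (G.d x) = 0) (hdz : G.d z = 0) : NilFam G' := by
  obtain ⟨N, j, hle, hmul, hac, hpow⟩ := h
  have Nof : ∀ {m n : ℤ} {x : A}, x ∈ N n → n = m → x ∈ N m := fun h e => e ▸ h
  have hσ : ∀ {n : ℤ} {x : A}, x ∈ N n → G.σ x ∈ N n := by
    intro n x hx
    rcases Int.even_or_odd n with h | h
    · rwa [G.σ_even h (hle _ hx)]
    · rw [G.σ_odd h (hle _ hx)]; exact neg_mem hx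
  let N' : ℤ → Submodule R B := fun n => ⨅ i : ℕ, (N (n - i * p)).comap (a.co i)
  have memN' : ∀ n f, f ∈ N' n ↔ ∀ i : ℕ, a.co i f ∈ N (n - i * p) := by
    intro n f; simp [N', Submodule.mem_iInf]
  have insN' : ∀ {i : ℕ} {n m : ℤ} {x : A}, a.al i → x ∈ N n → m = n + i * p →
      a.ins i x ∈ N' m := by
    intro i n m x hi hx e
    rw [memN']
    intro l
    rw [a.co_ins _ _ _ hi]
    split_ifs with h
    · subst h; exact Nof hx (by rw [e]; ring)
    · exact zero_mem _
  refine ⟨N', j, ?_, ?_, ?_, ?_⟩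
  · intro n f hf
    rw [a.mem_gr]
    exact fun i => hle _ ((memN' n f).1 hf i)
  · intro m n f g hf hg
    rw [memN'] at hf ⊢
    intro i
    rw [a.co_mul]
    refine sum_mem fun ij hij => nsmul_mem ?_ _
    refine Nof (hmul _ _ _ _ (hf ij.1) (G.tw_mem _ (a.co_mem hg ij.2 rfl))) ?_
    have hij := Finset.HasAntidiagonal.mem_antidiagonal.1 hij
    rw [← hij]; push_cast; ring
  · intro n
    have key : ∀ M : ℕ, ∀ f ∈ N' n, G'.d f = 0 → (∀ i, M ≤ i → a.co i f = 0) →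
        ∃ y ∈ N' (n + 1), G'.d y = f := by
      intro M
      induction M with
      | zero =>
        intro f _ _ h
        have : f = 0 := a.co_ext _ _ fun i => by rw [h i (Nat.zero_le _), map_zero]
        exact ⟨0, zero_mem _, by rw [this, map_zero]⟩
      | succ M ih =>
        intro f hf hdf hM
        by_cases hal : a.al M
        swap
        · refine ih f hf hdf fun i hi => ?_
          rcases hi.lt_or_eq with hi | rfl
          · exact hM i hi
          · exact a.co_al _ _ hal
        have hdM : G.d (a.co M f) = 0 := by
          have := a.co_d M f
          rw [hdf, hM (M + 1) le_rfl] at this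
          simpa using this.symm
        obtain ⟨y, hy, hy'⟩ := hac _ _ ((memN' n f).1 hf M) hdM
        have hyN : a.ins M y ∈ N' (n + 1) := insN' hal hy (by ring)
        have hdy : G'.d (a.ins M y) ∈ N' n ∧
            ∀ i, M ≤ i → a.co i (G'.d (a.ins M y)) = if i = M then a.co M f else 0 := by
          have hfM := (memN' n f).1 hf M
          cases M with
          | zero =>
            rw [a.d_ins_zero, hy']
            refine ⟨insN' hal hfM (by ring), fun i _ => a.co_ins _ _ _ hal⟩
          | succ M =>
            have h1 : a.ins M (G.σ y * z) ∈ N' n :=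
              insN' (a.al_succ _ hal) (hmul _ _ _ _ (hσ hy) a.z_mem) (by push_cast; ring)
            have h2 : a.ins (M + 1) (a.co (M + 1) f) ∈ N' n := insN' hal hfM (by ring)
            rw [a.d_ins_succ _ hal, hy']
            refine ⟨add_mem h2 h1, fun i hi => ?_⟩
            rw [map_add, a.co_ins _ _ _ hal, a.co_ins _ _ _ (a.al_succ _ hal),
              if_neg (by omega : i ≠ M), add_zero]
        obtain ⟨w, hw, hw'⟩ := ih (f - G'.d (a.ins M y)) (sub_mem hf hdy.1)
          (by rw [map_sub, hdf, a.dd hdd hdz, sub_zero]) (by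
            intro i hi
            rw [map_sub, hdy.2 i hi]
            split_ifs with h
            · rw [h, sub_self]
            · rw [hM i (by omega), sub_zero])
        exact ⟨w + a.ins M y, add_mem hw hyN, by rw [map_add, hw']; abel⟩
    intro f hf hdf
    refine key (n.toNat + 1) f hf hdf fun i hi => ?_
    refine a.co_eq_zero (n := n) ?_ ?_
    · rw [a.mem_gr]
      exact fun i => hle _ ((memN' n f).1 hf i)
    · have h1 := a.exists_bound n
      have h2 : ((n.toNat + 1 : ℕ) : ℤ) * p ≤ i * p := by
        apply mul_le_mul_of_nonneg_right _ (by have := a.p_pos; omega)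
        exact_mod_cast hi
      omega
  · intro n f hf
    rw [memN']
    intro i
    exact hpow _ ((a.mem_smul_gr _ n f (Submodule.smul_le_right hf)).1 hf i)

omit [IsLocalRing R] in
lemma artin_rees [IsNoetherianRing R] (I : Ideal R) (U Z : Submodule R A) [Module.Finite R U] :
    ∃ c : ℕ, ∀ m, c ≤ m → I ^ m • U ⊓ Z ≤ I ^ (m - c) • (I ^ c • U ⊓ Z) := by
  obtain ⟨c, hc⟩ := Ideal.exists_pow_inf_eq_pow_smul I (Z.comap U.subtype)
  have key : ∀ l : ℕ, (I ^ l • (⊤ : Submodule R U) ⊓ Z.comap U.subtype).map U.subtype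
      = I ^ l • U ⊓ Z := by
    intro l
    rw [Submodule.map_inf _ U.subtype_injective, Submodule.map_smul'', Submodule.map_subtype_top,
      Submodule.map_comap_subtype, ← inf_assoc, inf_eq_left.2 Submodule.smul_le_right]
  refine ⟨c, fun m hm => ?_⟩
  rw [← key, hc m hm, Submodule.map_smul'', key]

lemma NilFam.of_bounded [IsNoetherianRing R] {G : GA R A} (hff : FF G) (b : ℕ)
    (hb : ∀ n : ℤ, b < n → G.gr n = ⊥) (h0 : G.Zt 0 ≤ G.Bd 0) : NilFam G := by
  have AR : ∀ n : ℤ, ∃ c : ℕ, ∀ m, c < m → ∀ z ∈ 𝔪 ^ m • G.gr n, G.d z = 0 →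
      ∃ y ∈ 𝔪 ^ (m - 1) • G.gr (n + 1), G.d y = z := by
    intro n
    have := (hff n).2
    obtain ⟨c, hc⟩ := artin_rees 𝔪 (G.gr n) (LinearMap.ker G.d)
    refine ⟨c, fun m hm z hz hdz => ?_⟩
    have h1 := hc m hm.le ⟨hz, hdz⟩
    obtain ⟨l, rfl⟩ : ∃ l, m = l + c + 1 := ⟨m - c - 1, by omega⟩
    rw [show l + c + 1 - c = l + 1 by omega, pow_succ', mul_smul] at h1
    have h2 : 𝔪 ^ l • (𝔪 ^ c • G.gr n ⊓ LinearMap.ker G.d) ≤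
        𝔪 ^ (l + c) • G.gr n ⊓ LinearMap.ker G.d := by
      refine le_inf ?_ (Submodule.smul_le_right.trans inf_le_right)
      rw [pow_add, mul_smul]
      exact Submodule.smul_mono le_rfl inf_le_left
    have h3 := Submodule.smul_mono (le_refl 𝔪) h2 h1
    have h4 : 𝔪 • (𝔪 ^ (l + c) • G.gr n ⊓ LinearMap.ker G.d) ≤
        (𝔪 ^ (l + c) • G.gr (n + 1)).map G.d := by
      rw [Submodule.smul_le]
      rintro r hr w ⟨hw, hdw⟩
      obtain ⟨y, hy, hy'⟩ : r • (1 : A) ∈ G.Bd 0 :=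
        h0 (by rw [Zt_zero]; exact Submodule.smul_mem_smul hr G.one_mem)
      refine ⟨y * w, ?_, ?_⟩
      · have := Submodule.mem_map_of_mem (f := LinearMap.mulLeft R y) hw
        rw [Submodule.map_smul''] at this
        refine Submodule.smul_mono le_rfl ?_ this
        rintro _ ⟨x, hx, rfl⟩
        exact G.gr_of_eq (G.mul_mem hy hx) (by ring)
      · rw [G.leib, hy', show G.d w = 0 from hdw]; simp
    exact h4 h3
  choose c hc using AR
  obtain ⟨C, hC⟩ : ∃ C : ℕ, ∀ i : ℕ, i ≤ b → c i ≤ C :=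
    ⟨∑ i ∈ Finset.range (b + 1), c i, fun i hi =>
      Finset.single_le_sum (f := fun i : ℕ => c i) (fun _ _ => Nat.zero_le _)
        (Finset.mem_range.2 (by omega))⟩
  refine ⟨fun n => 𝔪 ^ (C + b + 1 - n.toNat) • G.gr n, C + b + 1, fun n =>
    Submodule.smul_le_right, ?_, ?_, ?_⟩
  · intro m n x y hx hy
    by_cases hn : n < 0
    · rw [G.eq_zero_of_neg hn hy]; simp
    have := Submodule.mem_map_of_mem (f := LinearMap.mulRight R y) hx
    rw [Submodule.map_smul''] at this
    refine Submodule.smul_mono (Ideal.pow_le_pow_right (by omega)) ?_ this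
    rintro _ ⟨x, hx, rfl⟩
    exact G.mul_mem hx hy
  · intro n z hz hdz
    have hzn : z ∈ G.gr n := Submodule.smul_le_right hz
    by_cases hn : n < 0
    · exact ⟨0, zero_mem _, by rw [G.eq_zero_of_neg hn hzn, map_zero]⟩
    by_cases hn' : b < n
    · rw [hb n hn', Submodule.mem_bot] at hzn
      exact ⟨0, zero_mem _, by rw [hzn, map_zero]⟩
    obtain ⟨n, rfl⟩ := Int.eq_ofNat_of_zero_le (not_lt.1 hn)
    have h1 := hC n (by omega)
    obtain ⟨y, hy, hy'⟩ := hc n _ (by simp only [Int.toNat_natCast]; omega) z hz hdz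
    refine ⟨y, ?_, hy'⟩
    convert hy using 2
    congr 1
  · intro n
    exact Submodule.smul_mono (Ideal.pow_le_pow_right (by omega)) le_rfl

end Local
end GA

namespace GA
variable {R : Type u} [CommRing R] {A : Type u} [Ring A] [Algebra R A]
  {B : Type u} [Ring B] [Algebra R B]

section Local
variable [IsLocalRing R]

local notation "𝔪" => IsLocalRing.maximalIdeal R

lemma Stage.minimal (s : Stage R) (n : ℤ) {g : s.A} (hg : g ∈ s.G.gr n) :
    s.G.d g ∈ 𝔪 • s.G.gr (n - 1) := by
  by_cases hn : n < 0
  · rw [s.G.eq_zero_of_neg hn hg, map_zero]; exact zero_mem _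
  · obtain ⟨n, rfl⟩ := Int.eq_ofNat_of_zero_le (not_lt.1 hn)
    exact s.good.minimal n g hg

lemma Stage.StepBy.z_mem_smul {s s' : Stage R} {p : ℤ} {z : s.A} (h : s.StepBy s' p z) :
    z ∈ 𝔪 • s.G.gr (p - 1) := by
  have a := h.adj
  have h1 : a.ins 1 1 ∈ s'.G.gr p := a.ins_mem a.al_one s.G.one_mem (by simp)
  have h2 := s'.minimal p h1
  have h3 := (a.mem_smul_gr _ _ _ (s'.G.d_mem h1)).1 h2 0
  rw [a.d_ins_succ 0 a.al_one, s.G.d_gr_zero s.G.one_mem, map_add,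
    a.co_ins _ _ _ a.al_zero] at h3
  simpa using h3

lemma pow_mem_smul (G : GA R A) {m : ℤ} {z : A} (hz : z ∈ 𝔪 • G.gr m) (n : ℤ) (b : A)
    (hb : b ∈ G.gr n) (j : ℕ) : b * z ^ j ∈ 𝔪 ^ j • G.gr (n + j * m) := by
  induction j with
  | zero => simpa using hb
  | succ j ih =>
    rw [pow_succ z, ← mul_assoc]
    have key : ∀ x ∈ 𝔪 ^ j • G.gr (n + j * m), ∀ y ∈ 𝔪 • G.gr m,
        x * y ∈ 𝔪 ^ (j + 1) • G.gr (n + (j + 1 : ℕ) * m) := by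
      intro x hx y hy
      rw [pow_succ, mul_smul]
      induction hx using Submodule.smul_induction_on' with
      | smul r hr x hx =>
        rw [smul_mul_assoc]
        refine Submodule.smul_mem_smul hr ?_
        have := Submodule.mem_map_of_mem (f := LinearMap.mulLeft R x) hy
        rw [Submodule.map_smul''] at this
        refine Submodule.smul_mono le_rfl ?_ this
        rintro _ ⟨w, hw, rfl⟩
        exact G.gr_of_eq (G.mul_mem hx hw) (by push_cast; ring)
      | add x _ y' _ h1 h2 => rw [add_mul]; exact add_mem h1 h2
    exact key _ ih _ hz

/-- Multiplication by `z` is injective in homology where the homology of the extension vanishes. -/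
lemma Adj.boundary_of_mul {G : GA R A} {G' : GA R B} {p : ℤ} {z : A} (a : Adj G G' p z)
    (hodd : ∀ i, a.al i → i < 2) {n : ℤ} (h' : G'.Cyc (n + p) ≤ G'.Bd (n + p))
    {b : A} (hb : b ∈ G.Cyc n) (hbz : b * z ∈ G.Bd (n + (p - 1))) : b ∈ G.Bd n := by
  obtain ⟨c, hc, hc'⟩ := hbz
  have hdb : G.d b = 0 := hb.2
  obtain ⟨c', hc1, hc2⟩ : ∃ c' ∈ G.gr (n + p), G.d c' = G.σ b * z := by
    rcases Int.even_or_odd n with hn | hn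
    · exact ⟨c, G.gr_of_eq hc (by ring), by rw [G.σ_even hn hb.1, hc']⟩
    · exact ⟨-c, neg_mem (G.gr_of_eq hc (by ring)), by
        rw [G.σ_odd hn hb.1, map_neg, hc', neg_mul]⟩
  obtain ⟨g, hg, hg'⟩ : a.ins 1 b - a.ins 0 c' ∈ G'.Bd (n + p) := by
    apply h'
    refine ⟨sub_mem (a.ins_mem a.al_one hb.1 (by simp)) (a.ins_mem a.al_zero hc1 (by simp)), ?_⟩
    change G'.d _ = 0
    rw [map_sub, a.d_ins_succ 0 a.al_one, a.d_ins_zero, hc2, hdb]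
    simp
  have h1 := congrArg (a.co 1) hg'
  rw [a.co_d, a.co_al (1 + 1) g (fun h => by have := hodd _ h; omega), map_sub,
    a.co_ins _ _ _ a.al_one, a.co_ins _ _ _ a.al_zero] at h1
  exact ⟨a.co 1 g, a.co_mem hg 1 (by push_cast; ring), by simpa using h1⟩

lemma Adj.boundary_of_pow_mul {G : GA R A} {G' : GA R B} {p : ℤ} {z : A} (a : Adj G G' p z)
    (hodd : ∀ i, a.al i → i < 2) (hdz : G.d z = 0) {n : ℤ}
    (h' : ∀ i : ℕ, G'.Cyc (n + i * (p - 1) + p) ≤ G'.Bd (n + i * (p - 1) + p))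
    {b : A} (hb : b ∈ G.Cyc n) (j : ℕ) (hbz : b * z ^ j ∈ G.Bd (n + j * (p - 1))) :
    b ∈ G.Bd n := by
  have hcyc : ∀ j : ℕ, b * z ^ j ∈ G.Cyc (n + j * (p - 1)) := by
    intro j
    induction j with
    | zero => simpa using hb
    | succ j ih =>
      rw [pow_succ, ← mul_assoc]
      refine ⟨G.gr_of_eq (G.mul_mem ih.1 a.z_mem) (by push_cast; ring), ?_⟩
      change G.d _ = 0
      rw [G.leib, show G.d _ = 0 from ih.2, hdz]; simp
  induction j with
  | zero => simpa using hbz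
  | succ j ih =>
    apply ih
    refine a.boundary_of_mul hodd (h' j) (hcyc j) ?_
    rw [pow_succ, ← mul_assoc] at hbz
    have e : n + ((j + 1 : ℕ) : ℤ) * (p - 1) = n + j * (p - 1) + (p - 1) := by push_cast; ring
    rwa [e] at hbz

lemma NilFam.pow_mem_Bd {G : GA R A} (hN : NilFam G) {m : ℤ} {z : A} (hz : z ∈ 𝔪 • G.gr m)
    (hdz : G.d z = 0) : ∃ j : ℕ, ∀ n, ∀ b ∈ G.Cyc n, b * z ^ j ∈ G.Bd (n + j * m) := by
  obtain ⟨N, j, hle, -, hac, hpow⟩ := hN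
  refine ⟨j, fun n b hb => ?_⟩
  have hd : ∀ j : ℕ, G.d (b * z ^ j) = 0 := by
    intro j
    induction j with
    | zero => rw [pow_zero, mul_one]; exact hb.2
    | succ j ih => rw [pow_succ, ← mul_assoc, G.leib, ih, hdz]; simp
  obtain ⟨y, hy, hy'⟩ := hac _ _ (hpow _ (G.pow_mem_smul hz n b hb.1 j)) (hd j)
  exact ⟨y, hle _ hy, hy'⟩

/-- Vanishing of homology in high degrees descends along a step. -/
lemma Stage.StepBy.tail {s s' : Stage R} {p : ℤ} {z : s.A} (h : s.StepBy s' p z)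
    (hN : NilFam s.G) {T : ℤ} (hT : ∀ i, T ≤ i → s'.G.Cyc i ≤ s'.G.Bd i) :
    ∃ T', ∀ i, T' ≤ i → s.G.Cyc i ≤ s.G.Bd i := by
  have a := h.adj
  have hp1 := a.p_pos
  have hzc := s.G.Zt_le_Cyc _ h.legal.mem
  have hdz : s.G.d z = 0 := hzc.2
  rcases h.par with ⟨hp, hodd, -⟩ | ⟨hp, hal, -⟩
  · refine ⟨T, fun n hn b hb => ?_⟩
    obtain ⟨j, hj⟩ := hN.pow_mem_Bd h.z_mem_smul hdz
    refine h.adj.boundary_of_pow_mul hodd hdz (fun i => hT _ ?_) hb j (hj n b hb)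
    have : 0 ≤ (i : ℤ) * (p - 1) := mul_nonneg (by positivity) (by omega)
    omega
  · have a := h.adj
    refine ⟨T + p, fun n hn b hb => ?_⟩
    have hdb : s.G.d b = 0 := hb.2
    obtain ⟨f, hf, hf'⟩ : h.adj.ins 0 b ∈ s'.G.Bd n := by
      refine hT n (by omega) ⟨h.adj.ins_mem h.adj.al_zero hb.1 (by simp), ?_⟩
      change s'.G.d _ = 0
      rw [h.adj.d_ins_zero, hdb, map_zero]
    obtain ⟨D, hD⟩ := h.adj.der p (Der.zero s.G p) 1 (by simpa using s.G.one_mem)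
      (by simp [Der.zero, s.G.d_gr_zero s.G.one_mem])
    have hD' : ∀ i f, h.adj.co i (D.θ f) = h.adj.co (i + 1) f := by
      intro i f
      rw [hD, s.G.tw_even hp]; simp [Der.zero]
    obtain ⟨g, hg, hg'⟩ : D.θ f ∈ s'.G.Bd (n + 1 - p) := by
      refine hT _ (by omega) ⟨D.mem hf, ?_⟩
      change s'.G.d _ = 0
      rw [D.comm, hf']
      have : D.θ (h.adj.ins 0 b) = 0 := by
        apply h.adj.co_ext
        intro i
        rw [hD', h.adj.co_ins _ _ _ h.adj.al_zero]; simp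
      rw [this, smul_zero]
    have e1 := congrArg (h.adj.co 0) hf'
    have e2 := congrArg (h.adj.co 0) hg'
    rw [h.adj.co_d, h.adj.co_ins _ _ _ h.adj.al_zero, if_pos rfl] at e1
    rw [h.adj.co_d, hD'] at e2
    have hg0 : h.adj.co 0 g ∈ s.G.gr (n + 1 - p + 1) := h.adj.co_mem hg 0 (by simp)
    refine ⟨h.adj.co 0 f - s.G.σ (h.adj.co 0 g) * z, sub_mem (h.adj.co_mem hf 0 (by simp))
      (s.G.gr_of_eq (s.G.mul_mem (s.G.σ_mem hg0) hzc.1) (by ring)), ?_⟩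
    have hzz : s.G.σ z * z = 0 := by
      rw [s.G.σ_odd (hp.sub_odd odd_one) hzc.1, neg_mul, h.adj.z_sq (hal 2), neg_zero]
    rw [← e1, ← e2, map_sub, s.G.leib, hdz, map_add, map_mul, s.G.σσ, s.G.σd, add_mul, mul_assoc,
      hzz]
    simp [sub_eq_add_neg]

/-- All stages reachable from `s` use odd steps only. -/
def Stage.Stable (s : Stage R) : Prop := ∀ s', s.Reach s' → s'.e = s.e

lemma Stage.Stable.reach {s s' : Stage R} (h : s.Stable) (hr : s.Reach s') : s'.Stable :=
  fun s'' h'' => (h s'' (hr.trans h'')).trans (h s' hr).symm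

lemma Stage.StepBy.two_le {s s' : Stage R} {p : ℤ} {z : s.A} (h : s.StepBy s' p z)
    (h0 : s.G.AcycLT 1) : 2 ≤ p := by
  have := h.adj.p_pos
  by_contra hp
  have : p = 1 := by omega
  apply h.legal.nmem
  refine Submodule.mem_sup_left (h0 _ (by omega) h.legal.mem)

lemma Stage.Stable.stepBy {s s' : Stage R} {p : ℤ} {z : s.A} (hs : s.Stable)
    (h : s.StepBy s' p z) : Odd p ∧ ∀ i, h.adj.al i → i < 2 := by
  have := hs s' (.single ⟨_, _, ⟨h⟩⟩)
  rcases h.par with ⟨h1, h2, -⟩ | ⟨-, -, h3⟩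
  · exact ⟨h1, h2⟩
  · omega

lemma Stage.Stable.odd_step {s s' : Stage R} (hs : s.Stable) (h0 : s.G.AcycLT 1)
    (h : s.Step s') {q : ℤ} (hq : ∃ q', q' ≤ q ∧ Odd q' ∧ ¬ s.G.Cyc q' ≤ s.G.Bd q') :
    ∃ q', q' ≤ q ∧ Odd q' ∧ ¬ s'.G.Cyc q' ≤ s'.G.Bd q' := by
  obtain ⟨p, z, ⟨h⟩⟩ := h
  obtain ⟨hp, hodd⟩ := hs.stepBy h
  have hp2 := h.two_le h0
  have hneg : ∀ q' : ℤ, q' < 0 → s.G.Cyc q' ≤ s.G.Bd q' := by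
    intro q' hq' x hx
    rw [s.G.eq_zero_of_neg hq' hx.1]; exact zero_mem _
  obtain ⟨q', hq', hmin⟩ : ∃ q', (q' ≤ q ∧ Odd q' ∧ ¬ s.G.Cyc q' ≤ s.G.Bd q') ∧
      ∀ r, (r ≤ q ∧ Odd r ∧ ¬ s.G.Cyc r ≤ s.G.Bd r) → q' ≤ r :=
    Int.exists_least_of_bdd ⟨0, fun r hr => by
      by_contra h; exact hr.2.2 (hneg r (by omega))⟩ hq
  refine ⟨q', hq'.1, hq'.2.1, fun hle => hq'.2.2 fun b hb => ?_⟩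
  have hdb : s.G.d b = 0 := hb.2
  obtain ⟨f, hf, hf'⟩ : h.adj.ins 0 b ∈ s'.G.Bd q' := by
    refine hle ⟨h.adj.ins_mem h.adj.al_zero hb.1 (by simp), ?_⟩
    change s'.G.d _ = 0
    rw [h.adj.d_ins_zero, hdb, map_zero]
  have e0 := congrArg (h.adj.co 0) hf'
  have e1 := congrArg (h.adj.co 1) hf'
  rw [h.adj.co_d, h.adj.co_ins _ _ _ h.adj.al_zero, if_pos rfl] at e0
  rw [h.adj.co_d, h.adj.co_ins _ _ _ h.adj.al_zero, if_neg one_ne_zero,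
    h.adj.co_al (1 + 1) f (fun h' => by have := hodd _ h'; omega), map_zero, zero_mul,
    add_zero] at e1
  have hf1 : h.adj.co 1 f ∈ s.G.Cyc (q' + 1 - p) := ⟨h.adj.co_mem hf 1 (by simp), e1⟩
  have hr : s.G.Cyc (q' + 1 - p) ≤ s.G.Bd (q' + 1 - p) := by
    by_contra hcon
    have := hmin _ ⟨by have := hq'.1; omega, (hq'.2.1.add_odd odd_one).sub_odd hp, hcon⟩
    omega
  obtain ⟨g, hg, hg'⟩ := hr hf1
  have hdz : s.G.d z = 0 := (s.G.Zt_le_Cyc _ h.legal.mem).2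
  refine ⟨h.adj.co 0 f - s.G.σ g * z, sub_mem (h.adj.co_mem hf 0 (by simp))
    (s.G.gr_of_eq (s.G.mul_mem (s.G.σ_mem hg) h.adj.z_mem) (by ring)), ?_⟩
  rw [← e0, ← hg', map_sub, s.G.leib, hdz, s.G.σd]
  simp [sub_eq_add_neg]

lemma Stage.Stable.odd_vanish [IsNoetherianRing R] {s : Stage R} (hs : s.Stable)
    (h0 : s.G.AcycLT 1) {q : ℤ} (hq : Odd q) : s.G.Cyc q ≤ s.G.Bd q := by
  by_contra hcon
  have key : ∀ s', s.Reach s' → ∃ q', q' ≤ q ∧ Odd q' ∧ ¬ s'.G.Cyc q' ≤ s'.G.Bd q' := by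
    intro s' h
    induction h with
    | refl => exact ⟨q, le_rfl, hq, hcon⟩
    | tail h1 h2 ih => exact (hs.reach h1).odd_step (Stage.Reach.acycLT h1 h0) h2 ih
  obtain ⟨s', h1, h2⟩ := s.kill (q.toNat + 1)
  obtain ⟨q', h3, h4, h5⟩ := key s' h1
  apply h5
  rw [← s'.G.Zt_of_ne (by rintro rfl; simp at h4)]
  exact h2 q' (by push_cast; omega)

lemma Stage.one_notMem_Bd (s : Stage R) : (1 : s.A) ∉ s.G.Bd 0 := by
  rintro ⟨y, hy, hy'⟩
  have h1 := s.good.d_one y (by simpa using hy)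
  rw [hy'] at h1
  have key : ∀ x ∈ 𝔪 • s.G.gr 0, ∃ r ∈ 𝔪, x = r • (1 : s.A) := by
    intro x hx
    induction hx using Submodule.smul_induction_on' with
    | smul r hr x hx =>
      obtain ⟨r', rfl⟩ := s.good.gr_zero x hx
      exact ⟨r * r', Ideal.mul_mem_right _ _ hr, by rw [mul_smul]⟩
    | add x _ y _ h1 h2 =>
      obtain ⟨r, hr, rfl⟩ := h1
      obtain ⟨r', hr', rfl⟩ := h2
      exact ⟨r + r', add_mem hr hr', by rw [add_smul]⟩
  obtain ⟨r, hr, hr'⟩ := key 1 h1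
  have := s.good.one_inj (1 - r) (by rw [sub_smul, ← hr', one_smul, sub_self])
  rw [← sub_eq_zero.1 this] at hr
  exact (Ideal.ne_top_iff_one _).1 (IsLocalRing.maximalIdeal.isMaximal R).ne_top hr

lemma Stage.Stable.no_step [IsNoetherianRing R] {s s' : Stage R} (hs : s.Stable)
    (h0 : s.G.AcycLT 1) (hN : NilFam s.G) : ¬ s.Step s' := by
  rintro hst
  have hs' := hs.reach (.single hst)
  obtain ⟨p, z, ⟨h⟩⟩ := hst
  have h0' := (Stage.Step.acycLT ⟨_, _, ⟨h⟩⟩ h0 : s'.G.AcycLT 1)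
  obtain ⟨hp, hodd⟩ := hs.stepBy h
  have hdz : s.G.d z = 0 := (s.G.Zt_le_Cyc _ h.legal.mem).2
  have hpe : Even (p - 1) := hp.sub_odd odd_one
  obtain ⟨j, hj⟩ := hN.pow_mem_Bd h.z_mem_smul hdz
  have h1 : (1 : s.A) ∈ s.G.Cyc 0 := ⟨s.G.one_mem, s.G.d_gr_zero s.G.one_mem⟩
  refine s.one_notMem_Bd (h.adj.boundary_of_pow_mul hodd hdz (fun i => ?_) h1 j (hj 0 1 h1))
  apply hs'.odd_vanish h0'
  rw [zero_add]
  exact (hpe.mul_left _).add_odd hp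

lemma Stage.Stable.acyc [IsNoetherianRing R] {s : Stage R} (hs : s.Stable)
    (h0 : s.G.AcycLT 1) (hN : NilFam s.G) (n : ℕ) : s.G.AcycLT n := by
  induction n with
  | zero => exact fun i hi => h0 i (by push_cast at hi; omega)
  | succ n ih =>
    intro i hi
    by_cases h : i < n
    · exact ih i h
    · obtain rfl : i = n := by push_cast at hi; omega
      by_contra hcon
      obtain ⟨z, hz⟩ := s.exists_legal ih hcon
      obtain ⟨s', ⟨h⟩⟩ := s.exists_stepBy hz
      exact hs.no_step h0 hN ⟨_, _, ⟨h⟩⟩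

lemma Stage.Reach.nilFam {s s' : Stage R} (h : s.Reach s') (hN : NilFam s.G) : NilFam s'.G := by
  induction h with
  | refl => exact hN
  | tail _ h ih =>
    obtain ⟨p, z, ⟨h⟩⟩ := h
    exact ih.adj h.adj (Stage.good _).dd (Zt_le_Cyc _ _ h.legal.mem).2

/-- If the number of variables of even degree is bounded, the homology of any stage vanishes in
high degrees. -/
theorem Stage.exists_tail [IsNoetherianRing R] (s : Stage R) (h0 : s.G.AcycLT 1)
    (hN : NilFam s.G) (E : ℕ) (hE : ∀ s', s.Reach s' → s'.e ≤ E) :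
    ∃ T, ∀ i, T ≤ i → s.G.Cyc i ≤ s.G.Bd i := by
  obtain ⟨s', hr, hs'⟩ : ∃ s', s.Reach s' ∧ s'.Stable := by
    by_contra! hcon
    have key : ∀ n : ℕ, ∃ s', s.Reach s' ∧ n ≤ s'.e := by
      intro n
      induction n with
      | zero => exact ⟨s, .refl, Nat.zero_le _⟩
      | succ n ih =>
        obtain ⟨s', h1, h2⟩ := ih
        have := hcon s' h1
        unfold Stage.Stable at this
        push Not at this
        obtain ⟨s'', h3, h4⟩ := this
        have := h3.e_le
        exact ⟨s'', h1.trans h3, by omega⟩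
    obtain ⟨s', h1, h2⟩ := key (E + 1)
    have := hE s' h1
    omega
  have hT' : ∃ T, ∀ i, T ≤ i → s'.G.Cyc i ≤ s'.G.Bd i := by
    refine ⟨1, fun i hi => ?_⟩
    rw [← s'.G.Zt_of_ne (by omega)]
    exact hs'.acyc (hr.acycLT h0) (hr.nilFam hN) (i.toNat + 1) i (by push_cast; omega)
  clear hs'
  induction hr with
  | refl => exact hT'
  | tail h1 h2 ih =>
    apply ih
    obtain ⟨p, z, ⟨h⟩⟩ := h2
    obtain ⟨T, hT⟩ := hT'
    exact h.tail (Stage.Reach.nilFam h1 hN) hT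

end Local
end GA

namespace GA
variable {R : Type u} [CommRing R] {A : Type u} [Ring A] [Algebra R A]
  {B : Type u} [Ring B] [Algebra R B]

section Rank
variable [Nontrivial R]

/-- The rank of a homogeneous component. -/
noncomputable def rk (G : GA R A) (n : ℤ) : ℕ := Module.finrank R (G.gr n)

lemma Adj.rk_le {G : GA R A} {G' : GA R B} {p : ℤ} {z : A} (a : Adj G G' p z) (h : FF G) (n : ℤ) :
    G.rk n ≤ G'.rk n := by
  have := (h n).2
  have := (h.adj a n).2
  have := (h.adj a n).1
  refine LinearMap.finrank_le_finrank_of_injective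
    (f := (a.ins 0).restrict (p := G.gr n) (q := G'.gr n)
      fun x hx => a.ins_mem a.al_zero hx (by simp)) ?_
  intro x y hxy
  have := congrArg (fun f => a.co 0 f.1) hxy
  simp only [LinearMap.restrict_apply, a.co_ins _ _ _ a.al_zero, if_pos] at this
  exact Subtype.ext this

lemma Adj.rk_eq_sum {G : GA R A} {G' : GA R B} {p : ℤ} {z : A} (a : Adj G G' p z) (h : FF G)
    (hal : ∀ i, a.al i) {n : ℤ} {N : ℕ} (hN : n - N * p < 0) :
    G'.rk n = ∑ i ∈ Finset.range N, G.rk (n - i * p) := by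
  classical
  have := fun n => (h n).1
  have := fun n => (h n).2
  unfold rk
  rw [(a.grEquiv n N hN).finrank_eq, Module.finrank_pi_fintype, Finset.sum_range]
  exact Fintype.sum_equiv (Equiv.subtypeUnivEquiv fun i => hal _) _ _ fun i => rfl

lemma Adj.rk_add {G : GA R A} {G' : GA R B} {p : ℤ} {z : A} (a : Adj G G' p z) (h : FF G)
    (hal : ∀ i, a.al i) (n : ℤ) : G'.rk n = G.rk n + G'.rk (n - p) := by
  have hN := a.exists_bound n
  rw [a.rk_eq_sum h hal (N := n.toNat + 1 + 1)
    (by have := a.p_pos; push_cast at hN ⊢; linarith), Finset.sum_range_succ',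
    a.rk_eq_sum h hal (n := n - p) (N := n.toNat + 1)
      (by have := a.p_pos; push_cast at hN ⊢; linarith), add_comm]
  congr 1
  · simp
  · refine Finset.sum_congr rfl fun i _ => ?_
    congr 1
    push_cast; ring

/-- The sum of the ranks in degrees at most `m`. -/
noncomputable def hk (G : GA R A) (m : ℕ) : ℕ := ∑ i ∈ Finset.range (m + 1), G.rk i

omit [Nontrivial R] in
lemma hk_mono (G : GA R A) : Monotone G.hk := fun _ _ h =>
  Finset.sum_le_sum_of_subset (Finset.range_subset_range.2 (by omega))

lemma Adj.hk_le {G : GA R A} {G' : GA R B} {p : ℤ} {z : A} (a : Adj G G' p z) (h : FF G) (n : ℕ) :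
    G.hk n ≤ G'.hk n := Finset.sum_le_sum fun i _ => a.rk_le h i

lemma Adj.hk_add {G : GA R A} {G' : GA R B} {p : ℕ} {z : A} (a : Adj G G' p z) (h : FF G)
    (hal : ∀ i, a.al i) (n : ℕ) : G.hk (n + p) + G'.hk n ≤ G'.hk (n + p) := by
  have e : G'.hk (n + p) = G.hk (n + p) +
      ∑ i ∈ Finset.range (n + p + 1), G'.rk (i - p) := by
    unfold hk
    rw [← Finset.sum_add_distrib]
    exact Finset.sum_congr rfl fun i _ => a.rk_add h hal i
  rw [e, show n + p + 1 = p + (n + 1) by ring, Finset.sum_range_add]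
  refine Nat.add_le_add_left (le_trans (le_of_eq ?_) (Nat.le_add_left _ _)) _
  refine Finset.sum_congr rfl fun i _ => ?_
  congr 1
  push_cast; ring

end Rank

section Local
variable [IsLocalRing R]

variable (R) in
/-- The initial stage. -/
noncomputable def Stage.init : Stage R := ⟨R, base R, 1, 0, good_base, FF.base⟩

lemma Stage.Reach.choose_le {s : Stage R} (h : (Stage.init R).Reach s) :
    ∃ L : ℕ, 1 ≤ L ∧ ∀ n : ℕ, (n + s.e).choose s.e ≤ s.G.hk (n * L) := by
  induction h with
  | refl =>
    refine ⟨1, le_rfl, fun n => ?_⟩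
    change (n + 0).choose 0 ≤ _
    rw [Nat.choose_zero_right]
    refine le_trans ?_ (hk_mono _ (Nat.zero_le _))
    have e1 : (base R).gr 0 = ⊤ := by simp [base]
    have e2 : (base R).rk 0 = 1 := by
      unfold rk
      rw [e1, finrank_top, Module.finrank_self]
    change 1 ≤ (base R).hk 0
    simp [hk, e2]
  | @tail s s' hs h ih =>
    obtain ⟨L, hL, ih⟩ := ih
    obtain ⟨p, z, ⟨h⟩⟩ := h
    rcases h.par with ⟨-, -, he⟩ | ⟨-, hal, he⟩
    · exact ⟨L, hL, fun n => by rw [he]; exact (ih n).trans (h.adj.hk_le s.ff _)⟩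
    · obtain ⟨p, rfl⟩ := Int.eq_ofNat_of_zero_le (show 0 ≤ p by have := h.adj.p_pos; omega)
      have hp : 1 ≤ p := by exact_mod_cast h.adj.p_pos
      have hLp : L ≤ L * p := Nat.le_mul_of_pos_right _ hp
      have hpL : p ≤ L * p := Nat.le_mul_of_pos_left _ hL
      refine ⟨L * p, by nlinarith, fun n => ?_⟩
      rw [he]
      induction n with
      | zero =>
        refine le_trans ?_ ((h.adj.hk_le s.ff _))
        simpa using ih 0
      | succ n ihn =>
        obtain ⟨q, hq⟩ : ∃ q, (n + 1) * (L * p) = q + p := ⟨(n + 1) * (L * p) - p, by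
          have : p ≤ (n + 1) * (L * p) := by nlinarith
          omega⟩
        have hqn : n * (L * p) ≤ q := by nlinarith
        have h1 := h.adj.hk_add s.ff hal q
        rw [← hq] at h1
        have h2 := ih (n + 1)
        have h3 : s.G.hk ((n + 1) * L) ≤ s.G.hk ((n + 1) * (L * p)) :=
          hk_mono _ (Nat.mul_le_mul_left _ hLp)
        have h4 := hk_mono s'.G hqn
        have h5 : (n + 1 + (s.e + 1)).choose (s.e + 1) =
            (n + 1 + s.e).choose s.e + (n + (s.e + 1)).choose (s.e + 1) := by
          rw [show n + 1 + (s.e + 1) = (n + 1 + s.e) + 1 by ring, Nat.choose_succ_succ',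
            show n + 1 + s.e = n + (s.e + 1) by ring]
        omega

lemma Stage.Reach.e_bound {s : Stage R} (h : (Stage.init R).Reach s) {C d : ℕ}
    (hC : ∀ n : ℕ, s.G.rk n ≤ C * (n + 1) ^ d) : s.e ≤ d + 1 := by
  by_contra hcon
  obtain ⟨L, hL, hn⟩ := h.choose_le
  have h1 : ∀ m : ℕ, s.G.hk m ≤ C * (m + 1) ^ (d + 1) := by
    intro m
    calc s.G.hk m ≤ ∑ i ∈ Finset.range (m + 1), C * (m + 1) ^ d := by
          refine Finset.sum_le_sum fun i hi => (hC i).trans ?_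
          rw [Finset.mem_range] at hi
          gcongr
          omega
      _ = C * (m + 1) ^ (d + 1) := by simp; ring
  have h2 : ∀ n : ℕ, (n + (d + 2)).choose (d + 2) ≤ (n + s.e).choose s.e := by
    intro n
    have e1 := Nat.choose_symm_add (a := n) (b := d + 2)
    have e2 := Nat.choose_symm_add (a := n) (b := s.e)
    rw [← e1, ← e2]
    exact Nat.choose_le_choose _ (by omega)
  have h3 : ∀ n : ℕ, (n + 1) ^ (d + 2) ≤ (d + 2).factorial * (n + (d + 2)).choose (d + 2) := by
    intro n
    have := Nat.pow_succ_le_ascFactorial (n + 1) (d + 2)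
    rwa [Nat.ascFactorial_eq_factorial_mul_choose] at this
  set K := (d + 2).factorial * (C * L ^ (d + 1)) with hK
  have h4 : (K + 1) ^ (d + 2) ≤ K * (K + 1) ^ (d + 1) := by
    calc (K + 1) ^ (d + 2) ≤ (d + 2).factorial * (K + (d + 2)).choose (d + 2) := h3 K
      _ ≤ (d + 2).factorial * (C * (K * L + 1) ^ (d + 1)) :=
          Nat.mul_le_mul_left _ ((h2 K).trans ((hn K).trans (h1 _)))
      _ ≤ (d + 2).factorial * (C * ((K + 1) * L) ^ (d + 1)) := by
          gcongr
          nlinarith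
      _ = K * (K + 1) ^ (d + 1) := by rw [hK, mul_pow]; ring
  have h5 : K * (K + 1) ^ (d + 1) < (K + 1) ^ (d + 2) := by
    rw [pow_succ' _ (d + 1)]
    exact Nat.mul_lt_mul_of_pos_right (Nat.lt_succ_self _) (by positivity)
  omega

end Local
end GA

namespace GA
open CategoryTheory.Abelian
variable {R : Type u} [CommRing R]

section ExtLength
variable (k : Type u) [AddCommGroup k] [Module R k]

variable (R) in
/-- The length of `Ext^n(M, k)`. -/
noncomputable def eLen (M : Type u) [AddCommGroup M] [Module R M] (n : ℕ) : ℕ∞ :=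
  Module.length R (Ext (ModuleCat.of R M) (ModuleCat.of R k) n)

lemma length_le_add {X Y Z : Type*} [AddCommGroup X] [AddCommGroup Y] [AddCommGroup Z]
    [Module R X] [Module R Y] [Module R Z] (f : X →ₗ[R] Y) (g : Y →ₗ[R] Z)
    (h : ∀ y, g y = 0 → ∃ x, f x = y) :
    Module.length R Y ≤ Module.length R X + Module.length R Z := by
  rw [Module.length_eq_add_of_exact (LinearMap.ker g).subtype g.rangeRestrict
    (Submodule.injective_subtype _) g.surjective_rangeRestrict
    (by rw [LinearMap.exact_iff]; simp)]
  refine add_le_add ?_ (Module.length_le_of_injective _ (Submodule.injective_subtype _))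
  refine le_trans (Module.length_le_of_injective (Submodule.inclusion (p := LinearMap.ker g)
    (p' := LinearMap.range f) ?_) (Submodule.inclusion_injective _))
    (Module.length_le_of_surjective _ f.surjective_rangeRestrict)
  intro y hy
  exact h y hy

variable {X Y Z : Type u} [AddCommGroup X] [AddCommGroup Y] [AddCommGroup Z]
    [Module R X] [Module R Y] [Module R Z] {f : X →ₗ[R] Y} {g : Y →ₗ[R] Z}

lemma eLen_congr (e : X ≃ₗ[R] Y) (n : ℕ) : eLen R k X n = eLen R k Y n := by
  have key : ∀ {X Y : Type u} [AddCommGroup X] [AddCommGroup Y] [Module R X] [Module R Y]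
      (e : X ≃ₗ[R] Y), eLen R k Y n ≤ eLen R k X n := by
    intro X Y _ _ _ _ e
    refine Module.length_le_of_injective (Ext.precompOfLinear (Ext.mk₀ (ModuleCat.ofHom
      e.toLinearMap)) R _ (zero_add n)) ?_
    refine LeftInverse.injective (g := Ext.precompOfLinear (Ext.mk₀ (ModuleCat.ofHom
      e.symm.toLinearMap)) R _ (zero_add n)) ?_
    intro x
    simp only [Ext.bilinearCompOfLinear_apply_apply, Ext.mk₀_comp_mk₀_assoc]
    rw [← ModuleCat.ofHom_comp]
    simp
  exact le_antisymm (key e.symm) (key e)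

lemma shortExact_of (hf : Injective f) (hg : Surjective g) (hfg : Exact f g) :
    (ShortComplex.mk (ModuleCat.ofHom f) (ModuleCat.ofHom g)
      (by ext x; exact hfg.apply_apply_eq_zero x)).ShortExact := by
  exact { exact := (ShortComplex.ShortExact.moduleCat_exact_iff_function_exact _).2 hfg
          mono_f := (ModuleCat.mono_iff_injective _).2 hf
          epi_g := (ModuleCat.epi_iff_surjective _).2 hg }

lemma eLen_succ_right (hf : Injective f) (hg : Surjective g) (hfg : Exact f g) (n : ℕ) :
    eLen R k Z (n + 1) ≤ eLen R k X n + eLen R k Y (n + 1) := by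
  have hS := shortExact_of hf hg hfg
  refine length_le_add (Ext.precompOfLinear hS.extClass R _ (add_comm 1 n))
    (Ext.precompOfLinear (Ext.mk₀ (ModuleCat.ofHom g)) R _ (zero_add _)) ?_
  intro y hy
  exact Ext.contravariant_sequence_exact₃ hS _ y hy (add_comm 1 n)

lemma eLen_left (hf : Injective f) (hg : Surjective g) (hfg : Exact f g) (n : ℕ) :
    eLen R k X n ≤ eLen R k Y n + eLen R k Z (n + 1) := by
  have hS := shortExact_of hf hg hfg
  refine length_le_add (Ext.precompOfLinear (Ext.mk₀ (ModuleCat.ofHom f)) R _ (zero_add _))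
    (Ext.precompOfLinear hS.extClass R _ (add_comm 1 n)) ?_
  intro y hy
  exact Ext.contravariant_sequence_exact₁ hS _ y (add_comm 1 n) hy

lemma eLen_zero_eq (M : Type u) [AddCommGroup M] [Module R M] :
    eLen R k M 0 = Module.length R (M →ₗ[R] k) :=
  (Ext.linearEquiv₀.trans ModuleCat.homLinearEquiv).length_eq

lemma eLen_free_succ (M : Type u) [AddCommGroup M] [Module R M] [Module.Free R M] (n : ℕ) :
    eLen R k M (n + 1) = 0 := by
  have : Projective (ModuleCat.of R M) := inferInstance
  have := Ext.subsingleton_of_projective (ModuleCat.of R M) (ModuleCat.of R k) n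
  exact Module.length_eq_zero

lemma eLen_succ_of_free [Module.Free R Y] (hf : Injective f) (hg : Surjective g)
    (hfg : Exact f g) (n : ℕ) : eLen R k Z (n + 1) ≤ eLen R k X n := by
  simpa [eLen_free_succ] using eLen_succ_right k hf hg hfg n

lemma eLen_le_of_free [Module.Free R Y] (hf : Injective f) (hg : Surjective g)
    (hfg : Exact f g) (h0 : ∀ φ : Y →ₗ[R] k, φ ∘ₗ f = 0) (n : ℕ) :
    eLen R k X n ≤ eLen R k Z (n + 1) := by
  cases n with
  | succ n => simpa [eLen_free_succ] using eLen_left k hf hg hfg (n + 1)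
  | zero =>
    have hS := shortExact_of hf hg hfg
    refine Module.length_le_of_injective (Ext.precompOfLinear hS.extClass R _ (add_comm 1 0)) ?_
    rw [← LinearMap.ker_eq_bot, LinearMap.ker_eq_bot']
    intro x hx
    obtain ⟨y, rfl⟩ := Ext.contravariant_sequence_exact₁ hS _ x (add_comm 1 0) hx
    obtain ⟨φ, rfl⟩ := Ext.linearEquiv₀ (R := R) |>.symm.surjective y
    simp only [Ext.linearEquiv₀_symm_apply, Ext.mk₀_comp_mk₀]
    have : ModuleCat.ofHom f ≫ φ = 0 := by
      ext x
      exact LinearMap.congr_fun (h0 φ.hom) x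
    rw [this, Ext.mk₀_zero]

lemma eLen_zero_le (hg : Surjective g) : eLen R k Z 0 ≤ eLen R k Y 0 := by
  rw [eLen_zero_eq, eLen_zero_eq]
  refine Module.length_le_of_injective (LinearMap.lcomp R k g) ?_
  intro a b hab
  ext z
  obtain ⟨y, rfl⟩ := hg z
  exact LinearMap.congr_fun hab y

lemma eLen_zero_ge (hg : Surjective g) (hfg : Exact f g) (h0 : ∀ φ : Y →ₗ[R] k, φ ∘ₗ f = 0) :
    eLen R k Y 0 ≤ eLen R k Z 0 := by
  rw [eLen_zero_eq, eLen_zero_eq]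
  refine Module.length_le_of_surjective (LinearMap.lcomp R k g) ?_
  intro φ
  refine ⟨(LinearMap.range f).liftQ φ ?_ ∘ₗ (hfg.linearEquivOfSurjective hg).symm.toLinearMap, ?_⟩
  · rintro _ ⟨x, rfl⟩
    exact LinearMap.congr_fun (h0 φ) x
  · ext y
    have : (hfg.linearEquivOfSurjective hg).symm (g y) = Submodule.Quotient.mk y := by
      rw [LinearEquiv.symm_apply_eq]; rfl
    simp [this]

lemma eLen_free_zero [IsSimpleModule R k] [Nontrivial R] (M : Type u) [AddCommGroup M] [Module R M]
    [Module.Free R M] [Module.Finite R M] : eLen R k M 0 = Module.finrank R M := by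
  rw [eLen_zero_eq]
  have b := Module.finBasis R M
  rw [(b.constr R (M' := k)).symm.length_eq, Module.length_pi_of_fintype]
  simp [Module.length_eq_one]

lemma eLen_range_le_rank [IsSimpleModule R k] [Nontrivial R] {M : Type u} [AddCommGroup M]
    [Module R M] (F : FreeResolution R M) (n j : ℕ) :
    eLen R k (LinearMap.range (F.d j)) n ≤ F.rank (j + 1 + n) := by
  induction n generalizing j with
  | zero =>
    refine (eLen_zero_le k (F.d j).surjective_rangeRestrict).trans ?_
    rw [eLen_free_zero]
    simp
  | succ n ih =>
    refine (eLen_succ_of_free k (f := (LinearMap.range (F.d (j + 1))).subtype)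
      (g := (F.d j).rangeRestrict) (Submodule.injective_subtype _)
      (F.d j).surjective_rangeRestrict ?_ n).trans ((ih (j + 1)).trans ?_)
    · rw [LinearMap.exact_iff]
      simpa using LinearMap.exact_iff.1 (F.exact j)
    · rw [show j + 1 + 1 + n = j + 1 + (n + 1) by ring]

lemma eLen_le_range {M : Type u} [AddCommGroup M]
    [Module R M] (F : FreeResolution R M) (n : ℕ) :
    eLen R k M (n + 1) ≤ eLen R k (LinearMap.range (F.d 0)) n :=
  eLen_succ_of_free k (f := (LinearMap.range (F.d 0)).subtype)
      (g := F.aug) (Submodule.injective_subtype _) F.aug_surjective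
      (by rw [LinearMap.exact_iff]; simpa using LinearMap.exact_iff.1 F.exact_aug) n

lemma eLen_le_rank [IsSimpleModule R k] [Nontrivial R] {M : Type u} [AddCommGroup M]
    [Module R M] (F : FreeResolution R M) (n : ℕ) : eLen R k M n ≤ F.rank n := by
  cases n with
  | zero =>
    refine (eLen_zero_le k F.aug_surjective).trans ?_
    rw [eLen_free_zero]
    simp
  | succ n =>
    refine (eLen_le_range k F n).trans ((eLen_range_le_rank k F n 0).trans ?_)
    rw [show 0 + 1 + n = n + 1 by ring]

lemma eLen_shift {M : Type u} [AddCommGroup M]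
    [Module R M] (F : FreeResolution R M) (j n : ℕ) :
    eLen R k M (n + 1 + j) ≤ eLen R k (LinearMap.range (F.d j)) n := by
  induction j generalizing n with
  | zero => exact eLen_le_range k F n
  | succ j ih =>
    rw [show n + 1 + (j + 1) = n + 1 + 1 + j by ring]
    refine (ih (n + 1)).trans (eLen_succ_of_free k (f := (LinearMap.range (F.d (j + 1))).subtype)
      (g := (F.d j).rangeRestrict) (Submodule.injective_subtype _)
      (F.d j).surjective_rangeRestrict ?_ n)
    rw [LinearMap.exact_iff]
    simpa using LinearMap.exact_iff.1 (F.exact j)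

lemma eLen_syzygy {M S : Type u} [AddCommGroup M] [Module R M] [AddCommGroup S] [Module R S]
    {j : ℕ} (h : IsNthSyzygy R M j S) (n : ℕ) : eLen R k M (n + j) ≤ eLen R k S n := by
  cases j with
  | zero =>
    obtain ⟨e⟩ := h
    rw [eLen_congr k e]; rfl
  | succ j =>
    obtain ⟨F, ⟨e⟩⟩ := h
    rw [eLen_congr k e, show n + (j + 1) = n + 1 + j by ring]
    exact eLen_shift k F j n

end ExtLength

section Local
variable [IsLocalRing R]
local notation "𝔪" => IsLocalRing.maximalIdeal R
local notation "κ" => IsLocalRing.ResidueField R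

instance : IsSimpleModule R κ :=
  isSimpleModule_iff_isCoatom.2 (IsLocalRing.maximalIdeal.isMaximal R).out

lemma residue_comp_eq_zero {X Y : Type u} [AddCommGroup X] [AddCommGroup Y] [Module R X]
    [Module R Y] {f : X →ₗ[R] Y} (h : LinearMap.range f ≤ 𝔪 • (⊤ : Submodule R Y))
    (φ : Y →ₗ[R] κ) : φ ∘ₗ f = 0 := by
  have : 𝔪 • (⊤ : Submodule R Y) ≤ LinearMap.ker φ := by
    rw [Submodule.smul_le]
    intro r hr y _
    rw [LinearMap.mem_ker, map_smul, Algebra.smul_def, IsLocalRing.ResidueField.algebraMap_eq,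
      (IsLocalRing.residue_eq_zero_iff r).2 hr, zero_mul]
  ext x
  exact this (h ⟨x, rfl⟩)

lemma exists_minimal_cover (M : Type u) [AddCommGroup M] [Module R M] [Module.Finite R M] :
    ∃ (r : ℕ) (π : (Fin r → R) →ₗ[R] M), Surjective π ∧
      LinearMap.ker π ≤ 𝔪 • (⊤ : Submodule R (Fin r → R)) := by
  classical
  have hex : ∃ (r : ℕ), ∃ (π : (Fin r → R) →ₗ[R] M), Surjective π := Module.Finite.exists_fin' R M
  obtain ⟨π, hπ⟩ := Nat.find_spec hex
  refine ⟨_, π, hπ, ?_⟩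
  intro v hv
  by_contra hcon
  have hi : ∃ i, v i ∉ 𝔪 := by
    by_contra! hall
    apply hcon
    rw [pi_eq_sum_univ' v]
    exact sum_mem fun i _ => Submodule.smul_mem_smul (hall i) trivial
  obtain ⟨i, hi⟩ := hi
  obtain ⟨r, hr⟩ : ∃ r, Nat.find hex = r + 1 := by
    have := i.pos
    exact ⟨Nat.find hex - 1, by omega⟩
  refine Nat.find_min hex (m := r) (by omega) ?_
  clear hcon
  revert π v i
  rw [hr]
  intro π hπ v hv i hi
  have hu : IsUnit (v i) := by simpa using hi
  refine ⟨π ∘ₗ LinearMap.pi (fun j => if h : ∃ l, i.succAbove l = j then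
    LinearMap.proj h.choose else 0), ?_⟩
  intro m
  obtain ⟨w, rfl⟩ := hπ m
  obtain ⟨u, hu⟩ := hu
  refine ⟨fun l => (w - (w i * (u⁻¹ : Rˣ)) • v) (i.succAbove l), ?_⟩
  have : π w = π (w - (w i * (u⁻¹ : Rˣ)) • v) := by
    rw [map_sub, map_smul, LinearMap.mem_ker.1 hv, smul_zero, sub_zero]
  rw [this, LinearMap.comp_apply]
  congr 1
  ext j
  rw [LinearMap.pi_apply]
  split_ifs with h
  · rw [LinearMap.proj_apply, h.choose_spec]
  · obtain rfl : j = i := by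
      by_contra hne
      exact h (Fin.exists_succAbove_eq hne)
    simp [mul_assoc, ← hu]

end Local
end GA

namespace GA
variable {R : Type u} [CommRing R] [IsLocalRing R]
local notation "𝔪" => IsLocalRing.maximalIdeal R
local notation "κ" => IsLocalRing.ResidueField R

section Minimal

/-- The rank of a minimal free cover. -/
noncomputable def covRank (M : Type u) [AddCommGroup M] [Module R M] [Module.Finite R M] : ℕ :=
  (exists_minimal_cover (R := R) M).choose

/-- A minimal free cover. -/
noncomputable def cov (M : Type u) [AddCommGroup M] [Module R M] [Module.Finite R M] :
    (Fin (covRank (R := R) M) → R) →ₗ[R] M :=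
  (exists_minimal_cover (R := R) M).choose_spec.choose

lemma cov_surjective (M : Type u) [AddCommGroup M] [Module R M] [Module.Finite R M] :
    Surjective (cov (R := R) M) :=
  (exists_minimal_cover (R := R) M).choose_spec.choose_spec.1

lemma ker_cov_le (M : Type u) [AddCommGroup M] [Module R M] [Module.Finite R M] :
    LinearMap.ker (cov (R := R) M) ≤ 𝔪 • (⊤ : Submodule R _) :=
  (exists_minimal_cover (R := R) M).choose_spec.choose_spec.2

omit [IsLocalRing R] in
lemma exact_subtype_comp {X Y Z : Type u} [AddCommGroup X] [AddCommGroup Y] [AddCommGroup Z]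
    [Module R X] [Module R Y] [Module R Z] (g : Y →ₗ[R] Z) {f : X →ₗ[R] LinearMap.ker g}
    (hf : Surjective f) : Exact ((LinearMap.ker g).subtype ∘ₗ f) g := by
  rw [LinearMap.exact_iff, LinearMap.range_comp, LinearMap.range_eq_top.2 hf, Submodule.map_top,
    Submodule.range_subtype]

omit [IsLocalRing R] in
lemma exact_subtype_comp' {X Y Z : Type u} [AddCommGroup X] [AddCommGroup Y] [AddCommGroup Z]
    [Module R X] [Module R Y] [Module R Z] {K : Submodule R Z} (g : Y →ₗ[R] K)
    {f : X →ₗ[R] LinearMap.ker g}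
    (hf : Surjective f) : Exact ((LinearMap.ker g).subtype ∘ₗ f) (K.subtype ∘ₗ g) :=
  (exact_subtype_comp g hf).comp_injective _ (Submodule.injective_subtype _) (map_zero _)

variable [IsNoetherianRing R]

/-- One step in the construction of a minimal resolution. -/
noncomputable def syzStep (x : Σ r : ℕ, Submodule R (Fin r → R)) :
    Σ r : ℕ, Submodule R (Fin r → R) :=
  ⟨covRank (R := R) x.2, LinearMap.ker (cov (R := R) x.2)⟩

/-- The differential of a minimal resolution. -/
noncomputable def syzMap (x : Σ r : ℕ, Submodule R (Fin r → R)) :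
    (Fin (syzStep x).1 → R) →ₗ[R] (Fin x.1 → R) :=
  x.2.subtype ∘ₗ cov (R := R) x.2

lemma syzMap_exact (x : Σ r : ℕ, Submodule R (Fin r → R)) :
    Exact (syzMap (syzStep x)) (syzMap x) :=
  exact_subtype_comp' (cov (R := R) x.2)
    (f := cov (R := R) (LinearMap.ker (cov (R := R) x.2))) (cov_surjective _)

/-- The start of a minimal resolution. -/
noncomputable def syzInit (M : Type u) [AddCommGroup M] [Module R M] [Module.Finite R M] :
    Σ r : ℕ, Submodule R (Fin r → R) :=
  ⟨covRank (R := R) M, LinearMap.ker (cov (R := R) M)⟩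

/-- The augmentation of a minimal resolution. -/
noncomputable def syzAug (M : Type u) [AddCommGroup M] [Module R M] [Module.Finite R M] :
    (Fin (syzInit (R := R) M).1 → R) →ₗ[R] M := cov M

lemma syzAug_exact (M : Type u) [AddCommGroup M] [Module R M] [Module.Finite R M] :
    Exact (syzMap (syzInit (R := R) M)) (syzAug (R := R) M) :=
  exact_subtype_comp (cov (R := R) M)
    (f := cov (R := R) (LinearMap.ker (cov (R := R) M))) (cov_surjective _)

/-- The successive syzygies in a minimal resolution. -/
noncomputable def syzSeq (M : Type u) [AddCommGroup M] [Module R M] [Module.Finite R M] :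
    ℕ → Σ r : ℕ, Submodule R (Fin r → R) :=
  Nat.rec (syzInit M) (fun _ => syzStep)

/-- The minimal free resolution. -/
noncomputable def minRes (M : Type u) [AddCommGroup M] [Module R M] [Module.Finite R M] :
    FreeResolution R M where
  rank i := (syzSeq (R := R) M i).1
  d i := syzMap (syzSeq (R := R) M i)
  aug := syzAug M
  aug_surjective := cov_surjective M
  exact_aug := syzAug_exact M
  exact i := syzMap_exact (syzSeq (R := R) M i)

omit [IsNoetherianRing R] in
lemma rank_le_eLen_cov (M : Type u) [AddCommGroup M] [Module R M] [Module.Finite R M] :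
    (covRank (R := R) M : ℕ∞) ≤ eLen R κ M 0 := by
  refine le_trans ?_ (eLen_zero_ge κ (f := (LinearMap.ker (cov (R := R) M)).subtype)
    (cov_surjective (R := R) M) (LinearMap.exact_subtype_ker_map _) (residue_comp_eq_zero ?_))
  · rw [eLen_free_zero]; simp
  · simpa using ker_cov_le (R := R) M

omit [IsNoetherianRing R] in
lemma eLen_ker_cov (M : Type u) [AddCommGroup M] [Module R M] [Module.Finite R M] (n : ℕ) :
    eLen R κ (LinearMap.ker (cov (R := R) M)) n ≤ eLen R κ M (n + 1) :=
  eLen_le_of_free κ (Submodule.injective_subtype _)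
    (cov_surjective (R := R) M) (LinearMap.exact_subtype_ker_map _) (residue_comp_eq_zero
      (by simpa using ker_cov_le (R := R) M)) n

lemma minRes_rank_le (M : Type u) [AddCommGroup M] [Module R M] [Module.Finite R M] (n : ℕ) :
    ((minRes (R := R) M).rank n : ℕ∞) ≤ eLen R κ M n := by
  have key : ∀ i n, eLen R κ (syzSeq (R := R) M i).2 n ≤ eLen R κ M (n + 1 + i) := by
    intro i
    induction i with
    | zero => exact eLen_ker_cov M
    | succ i ih =>
      intro n
      refine (eLen_ker_cov (R := R) (syzSeq (R := R) M i).2 n).trans ((ih (n + 1)).trans ?_)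
      rw [show n + 1 + 1 + i = n + 1 + (i + 1) by ring]
  cases n with
  | zero => exact rank_le_eLen_cov M
  | succ i =>
    refine (rank_le_eLen_cov (R := R) (syzSeq (R := R) M i).2).trans ((key i 0).trans ?_)
    rw [show 0 + 1 + i = i + 1 by ring]

lemma eLen_lt_top (M : Type u) [AddCommGroup M] [Module R M] [Module.Finite R M] (n : ℕ) :
    ∃ c : ℕ, eLen R κ M n ≤ c := ⟨_, eLen_le_rank κ (minRes M) n⟩

/-- Polynomial growth of the Betti numbers. -/
def PolyGrowth (M : Type u) [AddCommGroup M] [Module R M] : Prop :=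
  ∃ C d : ℕ, ∀ n : ℕ, eLen R κ M n ≤ ((C * (n + 1) ^ d : ℕ) : ℕ∞)

lemma exists_bound_fin (f : ℕ → ℕ∞) (h : ∀ n, ∃ c : ℕ, f n ≤ c) (N : ℕ) :
    ∃ C : ℕ, ∀ n < N, f n ≤ C := by
  choose c hc using h
  refine ⟨∑ i ∈ Finset.range N, c i, fun n hn => (hc n).trans ?_⟩
  exact_mod_cast Finset.single_le_sum (f := c) (fun _ _ => Nat.zero_le _) (Finset.mem_range.2 hn)

omit [IsNoetherianRing R] in
lemma PolyGrowth.of_finitePd {M : Type u} [AddCommGroup M] [Module R M]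
    (h : HasFinitePd R M) : PolyGrowth (R := R) M := by
  obtain ⟨F, t, ht⟩ := h
  obtain ⟨C, hC⟩ := exists_bound_fin (eLen R κ M) (fun n => ⟨_, eLen_le_rank κ F n⟩) t
  refine ⟨C, 0, fun n => ?_⟩
  by_cases hn : n < t
  · simpa using hC n hn
  · refine (eLen_le_rank κ F n).trans ?_
    rw [ht n (by omega)]; simp

lemma PolyGrowth.of_syzygy {M M₁ S : Type u} [AddCommGroup M] [Module R M] [AddCommGroup M₁]
    [Module R M₁] [AddCommGroup S] [Module R S] [Module.Finite R M] {n : ℕ} {f : M →ₗ[R] M₁}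
    {g : M₁ →ₗ[R] S} (hS : IsNthSyzygy R M n S) (hf : Injective f) (hg : Surjective g)
    (hfg : Exact f g) (h : PolyGrowth (R := R) M₁) : PolyGrowth (R := R) M := by
  obtain ⟨C, d, hC⟩ := h
  obtain ⟨B, hB⟩ := exists_bound_fin (eLen R κ M) (eLen_lt_top M) (n + 1)
  refine ⟨C * 2 ^ d + B, d + 1, ?_⟩
  intro j
  induction j using Nat.strong_induction_on with
  | _ j ih =>
    by_cases hj : j < n + 1
    · refine (hB j hj).trans ?_
      norm_cast
      have : 1 ≤ (j + 1) ^ (d + 1) := Nat.one_le_pow _ _ (by omega)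
      nlinarith [Nat.zero_le (C * 2 ^ d)]
    · obtain ⟨i, rfl⟩ : ∃ i, j = i + 1 + n := ⟨j - 1 - n, by omega⟩
      refine (eLen_syzygy κ hS (i + 1)).trans ((eLen_succ_right κ hf hg hfg i).trans
        ((add_le_add (ih i (by omega)) (hC (i + 1))).trans ?_))
      norm_cast
      have h1 : (i + 1 + 1) ^ d ≤ 2 ^ d * (i + 1) ^ d := by
        rw [← mul_pow]; exact Nat.pow_le_pow_left (by omega) _
      have h2 : (i + 1) ^ (d + 1) + (i + 1) ^ d ≤ (i + 1 + n + 1) ^ (d + 1) := by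
        calc (i + 1) ^ (d + 1) + (i + 1) ^ d = (i + 1) ^ d * (i + 1 + 1) := by ring
          _ ≤ (i + 1 + 1) ^ d * (i + 1 + 1) :=
            Nat.mul_le_mul_right _ (Nat.pow_le_pow_left (by omega) _)
          _ = (i + 1 + 1) ^ (d + 1) := by ring
          _ ≤ _ := Nat.pow_le_pow_left (by omega) _
      calc (C * 2 ^ d + B) * (i + 1) ^ (d + 1) + C * (i + 1 + 1) ^ d
          ≤ (C * 2 ^ d + B) * (i + 1) ^ (d + 1) + C * (2 ^ d * (i + 1) ^ d) := by gcongr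
        _ ≤ (C * 2 ^ d + B) * ((i + 1) ^ (d + 1) + (i + 1) ^ d) := by
          nlinarith [Nat.zero_le (B * (i + 1) ^ d)]
        _ ≤ _ := Nat.mul_le_mul_left _ h2

lemma PolyGrowth.of_uredChain {s : ℕ} {M : Type u} [AddCommGroup M] [Module R M]
    [Module.Finite R M] (h : URedChain R (HasFinitePd R) s M) : PolyGrowth (R := R) M := by
  induction s generalizing M with
  | zero => exact PolyGrowth.of_finitePd h
  | succ s ih =>
    obtain ⟨M₁, _, _, _, S, _, _, _, n, f, g, hS, hf, hg, hfg, h⟩ := h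
    exact PolyGrowth.of_syzygy hS hf hg hfg (ih h)

lemma exists_poly_resolution {M : Type u} [AddCommGroup M] [Module R M] [Module.Finite R M]
    (h : uredDim R (HasFinitePd R) M ≠ ⊤) :
    ∃ (F : FreeResolution R M) (C d : ℕ), ∀ n, F.rank n ≤ C * (n + 1) ^ d := by
  have : ∃ t, URedChain R (HasFinitePd R) t M := by
    by_contra! hcon
    apply h
    rw [uredDim, sInf_eq_top]
    rintro _ ⟨t, -, ht⟩
    exact absurd ht (hcon t)
  obtain ⟨t, ht⟩ := this
  obtain ⟨C, d, hC⟩ := PolyGrowth.of_uredChain ht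
  exact ⟨minRes M, C, d, fun n => by exact_mod_cast (minRes_rank_le M n).trans (hC n)⟩

end Minimal
end GA

namespace GA
variable {R : Type u} [CommRing R] [IsLocalRing R]
local notation "𝔪" => IsLocalRing.maximalIdeal R
local notation "κ" => IsLocalRing.ResidueField R

lemma Stage.Bd_le_gr (s : Stage R) (n : ℤ) : s.G.Bd n ≤ s.G.gr n := by
  rintro _ ⟨b, hb, rfl⟩
  exact s.G.gr_of_eq (s.G.d_mem hb) (by ring)

lemma Stage.Bd_le_smul (s : Stage R) (n : ℤ) : s.G.Bd n ≤ 𝔪 • s.G.gr n := by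
  rintro _ ⟨b, hb, rfl⟩
  simpa using s.minimal _ hb

/-- The degree zero part of a stage. -/
noncomputable def Stage.grZeroEquiv (s : Stage R) : R ≃ₗ[R] s.G.gr 0 :=
  LinearEquiv.ofBijective ((LinearMap.toSpanSingleton R (s.G.gr 0) ⟨1, s.G.one_mem⟩)) <| by
    constructor
    · rw [← LinearMap.ker_eq_bot, LinearMap.ker_eq_bot']
      intro r hr
      exact s.good.one_inj r (congrArg Subtype.val hr)
    · rintro ⟨a, ha⟩
      obtain ⟨r, rfl⟩ := s.good.gr_zero a ha
      exact ⟨r, rfl⟩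

lemma Stage.range_inclusion_le (s : Stage R) {n : ℤ} {K : Submodule R s.A} (hK : K ≤ s.G.gr n)
    (h : K ≤ 𝔪 • s.G.gr n) :
    LinearMap.range (Submodule.inclusion hK) ≤ 𝔪 • (⊤ : Submodule R (s.G.gr n)) := by
  rintro _ ⟨x, rfl⟩
  rw [Submodule.mem_smul_top_iff]
  exact h x.2

/-- The differential, onto the boundaries. -/
noncomputable def Stage.dMap (s : Stage R) (n : ℤ) : s.G.gr (n + 1) →ₗ[R] s.G.Bd n :=
  s.G.d.restrict fun x hx => ⟨x, hx, rfl⟩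

lemma Stage.dMap_surjective (s : Stage R) (n : ℤ) : Surjective (s.dMap n) := by
  rintro ⟨_, x, hx, rfl⟩
  exact ⟨⟨x, hx⟩, rfl⟩

lemma Stage.dMap_exact (s : Stage R) (n : ℤ) {K : Submodule R s.A} (hK : K ≤ s.G.gr (n + 1))
    (h : K = s.G.Cyc (n + 1)) :
    Exact (Submodule.inclusion hK) (s.dMap n) := by
  subst h
  intro x
  constructor
  · intro hx
    exact ⟨⟨x, x.2, congrArg Subtype.val hx⟩, rfl⟩
  · rintro ⟨y, rfl⟩
    exact Subtype.ext y.2.2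

lemma Stage.Bd_eq_Cyc (s : Stage R) {i : ℤ} (h : s.G.AcycLT (i + 1)) (hi : i ≠ 0) :
    s.G.Bd i = s.G.Cyc i := by
  refine le_antisymm ?_ ?_
  · rintro _ ⟨b, hb, rfl⟩
    exact ⟨s.Bd_le_gr i ⟨b, hb, rfl⟩, s.good.dd b⟩
  · rw [← s.G.Zt_of_ne hi]; exact h i (by omega)

lemma Stage.eLen_Bd (s : Stage R) (i : ℕ) (h : s.G.AcycLT (i + 1)) (m : ℕ) :
    eLen R κ (s.G.Bd i) m ≤ eLen R κ κ (m + 1 + i) := by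
  induction i generalizing m with
  | zero =>
    have hle : s.G.Bd (0 : ℕ) ≤ s.G.gr 0 := s.Bd_le_gr 0
    refine eLen_le_of_free κ (f := s.grZeroEquiv.symm.toLinearMap ∘ₗ Submodule.inclusion hle)
      (g := Algebra.linearMap R κ) ?_ IsLocalRing.residue_surjective ?_
      (residue_comp_eq_zero ?_) m
    · exact s.grZeroEquiv.symm.injective.comp (Submodule.inclusion_injective _)
    · intro r
      constructor
      · intro hr
        have hr : r ∈ 𝔪 := (IsLocalRing.residue_eq_zero_iff r).1 hr
        have : r • (1 : s.A) ∈ s.G.Bd (0 : ℕ) := by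
          apply h 0 (by simp)
          rw [s.G.Zt_zero]
          exact Submodule.smul_mem_smul hr s.G.one_mem
        refine ⟨⟨_, this⟩, ?_⟩
        rw [LinearMap.comp_apply, LinearEquiv.coe_coe, LinearEquiv.symm_apply_eq]
        rfl
      · rintro ⟨x, rfl⟩
        have h1 := s.range_inclusion_le hle (s.Bd_le_smul 0) ⟨x, rfl⟩
        have h2 := Submodule.mem_map_of_mem (f := s.grZeroEquiv.symm.toLinearMap) h1
        rw [Submodule.map_smul''] at h2
        have h3 : s.grZeroEquiv.symm (Submodule.inclusion hle x) ∈ 𝔪 :=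
          (Ideal.mul_le_left (I := 𝔪)) h2
        exact (IsLocalRing.residue_eq_zero_iff _).2 h3
    · rw [LinearMap.range_comp]
      refine (Submodule.map_mono (s.range_inclusion_le hle (s.Bd_le_smul 0))).trans ?_
      rw [Submodule.map_smul'']
      exact Submodule.smul_mono le_rfl le_top
  | succ i ih =>
    have := (s.ff (i + 1)).1
    refine (eLen_le_of_free κ (f := Submodule.inclusion (s.Bd_le_gr (i + 1)))
      (g := s.dMap i) (Submodule.inclusion_injective _) (s.dMap_surjective i)
      (s.dMap_exact i _ (s.Bd_eq_Cyc (by exact_mod_cast h) (by omega)))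
      (residue_comp_eq_zero (s.range_inclusion_le _ (s.Bd_le_smul _))) m).trans
      ((ih (fun j hj => h j (by push_cast; omega)) (m + 1)).trans ?_)
    rw [show m + 1 + 1 + i = m + 1 + (i + 1) by ring]

lemma Stage.rk_le_eLen (s : Stage R) (n : ℕ) (h : s.G.AcycLT (n + 1)) :
    (s.G.rk n : ℕ∞) ≤ eLen R κ κ n := by
  cases n with
  | zero =>
    have : s.G.rk (0 : ℕ) = 1 := by
      rw [rk, ← Module.finrank_self R]
      exact s.grZeroEquiv.symm.finrank_eq
    rw [this, eLen_zero_eq, Nat.cast_one, Order.one_le_iff_ne_zero, ← pos_iff_ne_zero,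
      Module.length_pos_iff]
    exact ⟨LinearMap.id, 0, fun hh => one_ne_zero (LinearMap.congr_fun hh (1 : κ))⟩
  | succ i =>
    have := (s.ff (i + 1)).1
    have := (s.ff (i + 1)).2
    have hC := s.Bd_eq_Cyc (i := i + 1) (by exact_mod_cast h) (by omega)
    have h1 := eLen_zero_ge κ (f := Submodule.inclusion (s.Bd_le_gr (i + 1)))
      (g := s.dMap i) (s.dMap_surjective i)
      (s.dMap_exact i _ hC)
      (residue_comp_eq_zero (s.range_inclusion_le _ (s.Bd_le_smul _)))
    rw [eLen_free_zero] at h1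
    refine (le_trans (by exact_mod_cast le_refl _) h1).trans
      ((s.eLen_Bd i (fun j hj => h j (by push_cast; omega)) 0).trans ?_)
    rw [show 0 + 1 + i = i + 1 by ring]

lemma Stage.Reach.rk_le {s s' : Stage R} (h : s.Reach s') (n : ℤ) : s.G.rk n ≤ s'.G.rk n := by
  induction h with
  | refl => exact le_rfl
  | tail _ h2 ih =>
    obtain ⟨p, z, ⟨h2⟩⟩ := h2
    exact ih.trans (h2.adj.rk_le (Stage.ff _) n)

lemma Stage.e_le_of_resolution [IsNoetherianRing R] {s : Stage R} (h : (Stage.init R).Reach s)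
    (F : FreeResolution R κ) {C d : ℕ} (hF : ∀ n, F.rank n ≤ C * (n + 1) ^ d) : s.e ≤ d + 1 := by
  refine Stage.Reach.e_bound h (C := C) (d := d) fun n => ?_
  obtain ⟨s', hs', ha⟩ := s.kill (n + 1)
  refine (Stage.Reach.rk_le hs' n).trans (le_trans ?_ (hF n))
  exact_mod_cast (s'.rk_le_eLen n (by exact_mod_cast ha)).trans (eLen_le_rank κ F n)

end GA

namespace GA

section Depth
variable {S : Type u} [CommRing S] [IsLocalRing S]

lemma mem_smul_top_of_one_tmul {P : Type*} [AddCommGroup P] [Module S P] {x : P}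
    (h : (1 : IsLocalRing.ResidueField S) ⊗ₜ[S] x = 0) :
    x ∈ IsLocalRing.maximalIdeal S • (⊤ : Submodule S P) := by
  have := congrArg (TensorProduct.quotTensorEquivQuotSMul P (IsLocalRing.maximalIdeal S)) h
  have h0 := this.trans (LinearEquiv.map_zero _)
  have h2 : TensorProduct.quotTensorEquivQuotSMul P (IsLocalRing.maximalIdeal S)
      ((1 : IsLocalRing.ResidueField S) ⊗ₜ[S] x) = Submodule.Quotient.mk x := by
    have := TensorProduct.quotTensorEquivQuotSMul_mk_tmul (IsLocalRing.maximalIdeal S) 1 x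
    rw [one_smul] at this
    exact this
  exact (Submodule.Quotient.mk_eq_zero _).1 (h2.symm.trans h0)

lemma free_of_depth_zero {y : S} (hy : y ≠ 0) (hym : ∀ a ∈ IsLocalRing.maximalIdeal S, y * a = 0)
    {K P M : Type*} [AddCommGroup K] [AddCommGroup P] [AddCommGroup M] [Module S K] [Module S P]
    [Module S M] [Module.Free S K] [Module.Finite S K] [Module.Free S P] [Module.Finite S P]
    {f : K →ₗ[S] P} {g : P →ₗ[S] M} (hf : Injective f) (hg : Surjective g) (hfg : Exact f g) :
    Module.Free S M ∧ (Module.finrank S M : ℤ) = Module.finrank S P - Module.finrank S K := by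
  have hkill : ∀ p ∈ IsLocalRing.maximalIdeal S • (⊤ : Submodule S P), y • p = 0 := by
    intro p hp
    refine Submodule.smul_induction_on hp (fun a ha n _ => ?_) (fun a b ha hb => ?_)
    · rw [smul_smul, hym a ha, zero_smul]
    · rw [smul_add, ha, hb, add_zero]
  have hinj : Injective (f.lTensor (IsLocalRing.ResidueField S)) := by
    have hs : ∀ t : TensorProduct S (IsLocalRing.ResidueField S) K,
        ∃ x, t = (1 : IsLocalRing.ResidueField S) ⊗ₜ[S] x := by
      intro t
      induction t with
      | zero => exact ⟨0, by simp⟩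
      | tmul a x =>
        obtain ⟨s, rfl⟩ := IsLocalRing.residue_surjective a
        refine ⟨s • x, ?_⟩
        rw [← TensorProduct.smul_tmul, Algebra.smul_def, mul_one]; rfl
      | add a b ha hb =>
        obtain ⟨x, rfl⟩ := ha
        obtain ⟨y, rfl⟩ := hb
        exact ⟨x + y, (TensorProduct.tmul_add _ _ _).symm⟩
    rw [← LinearMap.ker_eq_bot, LinearMap.ker_eq_bot']
    intro t ht
    obtain ⟨x, rfl⟩ := hs t
    rw [LinearMap.lTensor_tmul] at ht
    have h1 := hkill _ (mem_smul_top_of_one_tmul ht)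
    rw [← map_smul] at h1
    have h2 : y • x = 0 := hf (h1.trans (map_zero f).symm)
    let b := Module.Free.chooseBasis S K
    have h3 : ∀ i, b.repr x i ∈ IsLocalRing.maximalIdeal S := by
      intro i
      by_contra hcon
      have hu : IsUnit (b.repr x i) := by simpa using hcon
      have h4 : y * b.repr x i = 0 := by
        have := congrArg (fun z => b.repr z i) h2
        simpa using this
      exact hy ((hu.mul_left_eq_zero).1 h4)
    rw [← b.sum_repr x, TensorProduct.tmul_sum]
    refine Finset.sum_eq_zero fun i _ => ?_
    rw [← TensorProduct.smul_tmul, Algebra.smul_def, mul_one]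
    have := (IsLocalRing.residue_eq_zero_iff _).2 (h3 i)
    rw [IsLocalRing.ResidueField.algebraMap_eq, this, TensorProduct.zero_tmul]
  have hM : Module.Free S M := Module.free_of_lTensor_residueField_injective f g hg hfg hinj
  refine ⟨hM, ?_⟩
  have : Module.Finite S M := Module.Finite.of_surjective g hg
  obtain ⟨l, hl⟩ := g.exists_rightInverse_of_surjective (LinearMap.range_eq_top.2 hg)
  have e := (hfg.splitSurjectiveEquiv hf ⟨l, hl⟩).1.finrank_eq
  rw [Module.finrank_prod] at e
  omega
end Depth

/-- `FFR B n M ρ`: the module `M` has a resolution of length `n` by finite free modules, with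
Euler characteristic `ρ`. -/
def FFR (B : Type u) [CommRing B] :
    ℕ → ∀ (M : Type u) [AddCommGroup M] [Module B M], ℤ → Prop
  | 0, M, _, _, ρ => Module.Free B M ∧ Module.Finite B M ∧ (Module.finrank B M : ℤ) = ρ
  | n + 1, M, _, _, ρ => ∃ (r : ℕ) (π : (Fin r → B) →ₗ[B] M), Surjective π ∧
      FFR B n (LinearMap.ker π) (r - ρ)

section Ass
variable {B : Type u} [CommRing B] [IsNoetherianRing B]

lemma FFR.localized (p : Ideal B) [p.IsPrime] (hp : IsAssociatedPrime p B) (n : ℕ) :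
    ∀ (M : Type u) [AddCommGroup M] [Module B M] (ρ : ℤ), FFR B n M ρ →
    Module.Free (Localization p.primeCompl) (LocalizedModule p.primeCompl M) ∧
    Module.Finite (Localization p.primeCompl) (LocalizedModule p.primeCompl M) ∧
    (Module.finrank (Localization p.primeCompl) (LocalizedModule p.primeCompl M) : ℤ) = ρ := by
  have hloc : IsLocalRing (Localization p.primeCompl) := Localization.AtPrime.isLocalRing p
  induction n with
  | zero =>
    rintro M _ _ ρ ⟨h1, h2, h3⟩
    refine ⟨Module.free_of_isLocalizedModule p.primeCompl (LocalizedModule.mkLinearMap p.primeCompl M),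
      Module.Finite.of_isLocalizedModule p.primeCompl (LocalizedModule.mkLinearMap p.primeCompl M), ?_⟩
    rw [Module.finrank_of_isLocalizedModule_of_free (Localization p.primeCompl) p.primeCompl
      (LocalizedModule.mkLinearMap p.primeCompl M), h3]
  | succ n ih =>
    rintro M _ _ ρ ⟨r, π, hπ, hK⟩
    obtain ⟨h1, h2, h3⟩ := ih _ _ hK
    obtain ⟨-, x, hx⟩ := isAssociatedPrime_iff.1 hp
    have hfree : Module.Free (Localization p.primeCompl) (LocalizedModule p.primeCompl (Fin r → B)) :=
      Module.free_of_isLocalizedModule p.primeCompl (LocalizedModule.mkLinearMap p.primeCompl _)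
    have hfin : Module.Finite (Localization p.primeCompl) (LocalizedModule p.primeCompl (Fin r → B)) :=
      Module.Finite.of_isLocalizedModule p.primeCompl (LocalizedModule.mkLinearMap p.primeCompl _)
    have hrk := Module.finrank_of_isLocalizedModule_of_free (Localization p.primeCompl) p.primeCompl
      (LocalizedModule.mkLinearMap p.primeCompl (Fin r → B))
    have hsurj := LocalizedModule.map_surjective p.primeCompl π hπ
    have hex : Exact (LocalizedModule.map p.primeCompl (LinearMap.ker π).subtype)
        (LocalizedModule.map p.primeCompl π) :=
      LocalizedModule.map_exact p.primeCompl _ _ (LinearMap.exact_subtype_ker_map π)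
    have hinj := LocalizedModule.map_injective p.primeCompl _ (LinearMap.ker π).injective_subtype
    have hx0 : algebraMap B (Localization p.primeCompl) x ≠ 0 := by
      intro h0
      obtain ⟨u, hu⟩ := (IsLocalization.map_eq_zero_iff p.primeCompl _ x).1 h0
      refine u.2 (hx.ge ?_)
      rw [Submodule.mem_colon_singleton]
      simpa using hu
    have hxm : ∀ a ∈ IsLocalRing.maximalIdeal (Localization p.primeCompl),
        algebraMap B (Localization p.primeCompl) x * a = 0 := by
      intro a ha
      obtain ⟨⟨b, s⟩, rfl⟩ := IsLocalization.mk'_surjective p.primeCompl a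
      have hb : b ∈ p := (IsLocalization.AtPrime.mk'_mem_maximal_iff _ p b s).1 ha
      rw [hx, Submodule.mem_colon_singleton] at hb
      rw [← IsLocalization.mk'_one (M := p.primeCompl) (Localization p.primeCompl) x,
        ← IsLocalization.mk'_mul]
      have hb' : x * b = 0 := by simpa [mul_comm] using hb
      simp [hb']
    obtain ⟨h4, h5⟩ := free_of_depth_zero
      (K := LocalizedModule p.primeCompl (LinearMap.ker π)) hx0 hxm hinj hsurj hex
    refine ⟨h4, Module.Finite.of_surjective _ hsurj, ?_⟩
    have : Nontrivial B := (algebraMap B (Localization p.primeCompl)).domain_nontrivial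
    rw [h5, h3, hrk, Module.finrank_fin_fun]
    ring

/-- An ideal whose quotient has a finite free resolution is zero or contains a nonzerodivisor. -/
theorem FFR.eq_bot_or_exists_nzd {J : Ideal B} {n : ℕ} {ρ : ℤ} (h : FFR B n (B ⧸ J) ρ) :
    J = ⊥ ∨ ∃ x ∈ J, x ∈ nonZeroDivisors B := by
  by_contra hcon
  push Not at hcon
  obtain ⟨hJ, hnz⟩ := hcon
  have hsub : (J : Set B) ⊆ ⋃ p ∈ associatedPrimes B B, (p : Set B) := by
    rw [biUnion_associatedPrimes_eq_compl_nonZeroDivisors]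
    exact fun x hx => hnz x hx
  obtain ⟨p, hp, hJp⟩ := (Ideal.subset_union_prime_finite (associatedPrimes.finite B B)
    (f := fun p => p) ⊤ ⊤ (fun i hi _ _ => IsAssociatedPrime.isPrime hi)).1 hsub
  have hle : ∀ q : Ideal B, ∀ [q.IsPrime],
      Surjective (LocalizedModule.map q.primeCompl J.mkQ) := fun q _ =>
    LocalizedModule.map_surjective q.primeCompl _ J.mkQ_surjective
  have hrB : ∀ q : Ideal B, ∀ [q.IsPrime],
      Module.finrank (Localization q.primeCompl) (LocalizedModule q.primeCompl B) = 1 := by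
    intro q _
    have : IsLocalRing (Localization q.primeCompl) := Localization.AtPrime.isLocalRing q
    rw [Module.finrank_of_isLocalizedModule_of_free (Localization q.primeCompl) q.primeCompl
      (LocalizedModule.mkLinearMap q.primeCompl B)]
    have : Nontrivial B := (algebraMap B (Localization q.primeCompl)).domain_nontrivial
    simp
  have hρ : ρ = 1 := by
    have := IsAssociatedPrime.isPrime hp
    have : IsLocalRing (Localization p.primeCompl) := Localization.AtPrime.isLocalRing p
    obtain ⟨h1, h2, h3⟩ := h.localized p hp
    have hfinB : Module.Finite (Localization p.primeCompl) (LocalizedModule p.primeCompl B) :=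
      Module.Finite.of_isLocalizedModule p.primeCompl (LocalizedModule.mkLinearMap p.primeCompl _)
    have hle1 := LinearMap.finrank_le_finrank_of_surjective (hle p)
    rw [hrB] at hle1
    have hnt : Nontrivial (LocalizedModule p.primeCompl (B ⧸ J)) := by
      refine ⟨⟨LocalizedModule.mk (Submodule.Quotient.mk 1) 1, LocalizedModule.mk 0 1, ?_⟩⟩
      intro h0
      obtain ⟨u, hu⟩ := LocalizedModule.mk_eq.1 h0
      apply u.2
      apply hJp
      rw [← Submodule.Quotient.mk_eq_zero]
      have hu' : (u : B) • (Submodule.Quotient.mk 1 : B ⧸ J) = 0 := by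
        simpa [Submonoid.smul_def] using hu
      rw [← Submodule.Quotient.mk_smul, smul_eq_mul, mul_one] at hu'
      exact hu'
    have := (Module.finrank_pos_iff_of_free (Localization p.primeCompl)
      (LocalizedModule p.primeCompl (B ⧸ J))).2 hnt
    omega
  obtain ⟨x, hx, hx0⟩ := Submodule.exists_mem_ne_zero_of_ne_bot hJ
  obtain ⟨q, hq, hqx⟩ := exists_le_isAssociatedPrime_of_isNoetherianRing B x hx0
  have := hq.isPrime
  have : IsLocalRing (Localization q.primeCompl) := Localization.AtPrime.isLocalRing q
  obtain ⟨h1, h2, h3⟩ := h.localized q hq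
  have hfreeB : Module.Free (Localization q.primeCompl) (LocalizedModule q.primeCompl B) :=
    Module.free_of_isLocalizedModule q.primeCompl (LocalizedModule.mkLinearMap q.primeCompl _)
  have hfinB : Module.Finite (Localization q.primeCompl) (LocalizedModule q.primeCompl B) :=
    Module.Finite.of_isLocalizedModule q.primeCompl (LocalizedModule.mkLinearMap q.primeCompl _)
  have hinj : Injective (LocalizedModule.map q.primeCompl J.mkQ) := by
    let e := LinearEquiv.ofFinrankEq (R := Localization q.primeCompl)
      (LocalizedModule q.primeCompl (B ⧸ J)) (LocalizedModule q.primeCompl B) (by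
        rw [hrB]; omega)
    have := OrzechProperty.injective_of_surjective_endomorphism
      (e.toLinearMap ∘ₗ LocalizedModule.map q.primeCompl J.mkQ) (e.surjective.comp (hle q))
    exact Injective.of_comp this
  have hz : (LocalizedModule.mk x 1 : LocalizedModule q.primeCompl B) = LocalizedModule.mk 0 1 := by
    apply hinj
    rw [LocalizedModule.map_mk, LocalizedModule.map_mk]
    congr 1
    rw [map_zero]
    exact (Submodule.Quotient.mk_eq_zero _).2 hx
  obtain ⟨u, hu⟩ := LocalizedModule.mk_eq.1 hz
  apply u.2
  apply hqx
  rw [Submodule.mem_colon_singleton]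
  simpa [Submonoid.smul_def] using hu

/-- Prime avoidance: the nonzerodivisor can be chosen to be a minimal generator. -/
theorem FFR.exists_nzd [IsLocalRing B] {J : Ideal B} {n : ℕ} {ρ : ℤ} (h : FFR B n (B ⧸ J) ρ)
    (hJ : J ≠ ⊥) : ∃ x ∈ J, x ∉ IsLocalRing.maximalIdeal B * J ∧ x ∈ nonZeroDivisors B := by
  by_contra hcon
  push Not at hcon
  have hsub : (J : Set B) ⊆ ⋃ p ∈ insert (IsLocalRing.maximalIdeal B * J) (associatedPrimes B B),
      (p : Set B) := by
    rw [Set.biUnion_insert, biUnion_associatedPrimes_eq_compl_nonZeroDivisors]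
    intro x hx
    by_cases hx' : x ∈ IsLocalRing.maximalIdeal B * J
    · exact Or.inl hx'
    · exact Or.inr (hcon x hx hx')
  obtain ⟨p, hp, hJp⟩ := (Ideal.subset_union_prime_finite
    ((associatedPrimes.finite B B).insert _)
    (f := fun p => p) (IsLocalRing.maximalIdeal B * J) ⊤ (fun i hi hi' _ =>
      IsAssociatedPrime.isPrime (hi.resolve_left hi'))).1 hsub
  rcases hp with rfl | hp
  · apply hJ
    refine Submodule.eq_bot_of_le_smul_of_le_jacobson_bot (IsLocalRing.maximalIdeal B) J
      (IsNoetherian.noetherian J) hJp ?_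
    rw [IsLocalRing.jacobson_eq_maximalIdeal _ bot_ne_top]
  · obtain ⟨x, hx, hx'⟩ := h.eq_bot_or_exists_nzd.resolve_left hJ
    have : x ∈ ⋃ p ∈ associatedPrimes B B, (p : Set B) := by
      simp only [Set.mem_iUnion]
      exact ⟨p, hp, hJp hx⟩
    rw [biUnion_associatedPrimes_eq_compl_nonZeroDivisors] at this
    exact this hx'
end Ass
end GA

namespace GA

section MatrixComplex
variable {B : Type u} [CommRing B]

/-- A matrix acting on tuples of elements of a module. -/
def matAct {m n : ℕ} (D : Fin m → Fin n → B) {M : Type u} [AddCommGroup M] [Module B M] :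
    (Fin n → M) →ₗ[B] (Fin m → M) :=
  LinearMap.pi fun i => ∑ j, D i j • LinearMap.proj j

lemma matAct_apply {m n : ℕ} (D : Fin m → Fin n → B) {M : Type u} [AddCommGroup M] [Module B M]
    (v : Fin n → M) (i : Fin m) : matAct D v i = ∑ j, D i j • v j := by
  simp [matAct]

lemma matAct_comp {m n : ℕ} (D : Fin m → Fin n → B) {M N : Type u} [AddCommGroup M] [Module B M]
    [AddCommGroup N] [Module B N] (f : M →ₗ[B] N) (v : Fin n → M) :
    matAct D (fun j => f (v j)) = fun i => f (matAct D v i) := by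
  funext i
  simp [matAct_apply]

variable (r : ℕ → ℕ) (D : ∀ n, Fin (r n) → Fin (r (n + 1)) → B)

/-- Exactness in degree `n + 1` of a sequence of matrices acting on tuples in a module. -/
def MatEx (M : Type u) [AddCommGroup M] [Module B M] (n : ℕ) : Prop :=
  ∀ v : Fin (r (n + 1)) → M, matAct (D n) v = 0 → ∃ w, matAct (D (n + 1)) w = v

variable {r D}

lemma matAct_lift_free {m n s : ℕ} (D : Fin m → Fin n → B) (v : Fin m → (Fin s → B))
    (h : ∀ c, ∃ w : Fin n → B, matAct D w = fun i => v i c) :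
    ∃ w : Fin n → (Fin s → B), matAct D w = v := by
  choose w hw using h
  refine ⟨fun j c => w c j, ?_⟩
  funext i c
  have := congrFun (hw c) i
  rw [matAct_apply] at this
  rw [matAct_apply, ← this]
  simp

lemma MatEx.free {n : ℕ} (h : MatEx r D B n) (s : ℕ) : MatEx r D (Fin s → B) n := by
  intro v hv
  refine matAct_lift_free _ v fun c => h _ ?_
  have := matAct_comp (D n) (LinearMap.proj (R := B) (φ := fun _ : Fin s => B) c) v
  rw [hv] at this
  exact this

lemma MatEx.shift (hdd : ∀ (M : Type u) [AddCommGroup M] [Module B M] n (v : Fin (r (n + 2)) → M),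
      matAct (D n) (matAct (D (n + 1)) v) = 0)
    {M : Type u} [AddCommGroup M] [Module B M] {s : ℕ} {π : (Fin s → B) →ₗ[B] M}
    (hπ : Surjective π) {n : ℕ} (hB : MatEx r D B n) (hM : MatEx r D M (n + 1)) :
    MatEx r D (LinearMap.ker π) n := by
  intro v hv
  obtain ⟨w, hw⟩ := hB.free s (fun j => (v j : Fin s → B)) (by
    have := matAct_comp (D n) (LinearMap.ker π).subtype v
    rw [hv] at this
    exact this)
  obtain ⟨ub, hub⟩ := hM (fun j => π (w j)) (by
    rw [matAct_comp, hw]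
    funext i
    exact (v i).2)
  choose u hu using fun j => hπ (ub j)
  have hu' : (fun j => π (u j)) = ub := funext hu
  have hk : ∀ j, w j - matAct (D (n + 2)) u j ∈ LinearMap.ker π := by
    intro j
    rw [LinearMap.mem_ker, map_sub, sub_eq_zero]
    have := congrFun (matAct_comp (D (n + 2)) π u) j
    rw [← this, hu', hub]
  refine ⟨fun j => ⟨_, hk j⟩, ?_⟩
  have h1 := matAct_comp (D (n + 1)) (LinearMap.ker π).subtype (fun j => ⟨_, hk j⟩)
  funext i
  apply Subtype.ext
  have h2 := congrFun h1 i
  refine h2.symm.trans ?_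
  have h3 : (fun j => (LinearMap.ker π).subtype ⟨_, hk j⟩) = w - matAct (D (n + 2)) u := rfl
  rw [h3, map_sub, hdd, sub_zero, hw]

variable [IsLocalRing B] [IsNoetherianRing B]

lemma MatEx.ker_eq_bot (hdd : ∀ (M : Type u) [AddCommGroup M] [Module B M] n
      (v : Fin (r (n + 2)) → M), matAct (D n) (matAct (D (n + 1)) v) = 0)
    (hr : 0 < r 0) (hmem : ∀ i j, D 0 i j ∈ IsLocalRing.maximalIdeal B)
    (hsurj : ∀ v : Fin (r 0) → B, (∀ i, v i ∈ IsLocalRing.maximalIdeal B) →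
      ∃ w, matAct (D 0) w = v)
    {M : Type u} [AddCommGroup M] [Module B M] {s : ℕ} {π : (Fin s → B) →ₗ[B] M}
    (hπ : Surjective π) (hmin : LinearMap.ker π ≤ IsLocalRing.maximalIdeal B • ⊤)
    (hM : MatEx r D M 0) : LinearMap.ker π = ⊥ := by
  refine Submodule.eq_bot_of_le_smul_of_le_jacobson_bot (IsLocalRing.maximalIdeal B) _
    (IsNoetherian.noetherian _) ?_ (by rw [IsLocalRing.jacobson_eq_maximalIdeal _ bot_ne_top])
  intro x hx
  have hxm : ∀ c, x c ∈ IsLocalRing.maximalIdeal B := by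
    intro c
    have : LinearMap.proj (R := B) (φ := fun _ : Fin s => B) c x ∈
      (IsLocalRing.maximalIdeal B • (⊤ : Submodule B (Fin s → B))).map (LinearMap.proj c) :=
      Submodule.mem_map_of_mem (hmin hx)
    rw [Submodule.map_smul''] at this
    refine (Submodule.smul_le (P := IsLocalRing.maximalIdeal B)).2 (fun a ha b _ => ?_) this
    exact Ideal.mul_mem_right b _ ha
  obtain ⟨w, hw⟩ := matAct_lift_free (D 0) (fun _ => x) fun c => hsurj _ fun _ => hxm c
  obtain ⟨ub, hub⟩ := hM (fun j => π (w j)) (by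
    rw [matAct_comp, hw]
    funext i
    exact hx)
  choose u hu using fun j => hπ (ub j)
  have hu' : (fun j => π (u j)) = ub := funext hu
  have hk : ∀ j, w j - matAct (D 1) u j ∈ LinearMap.ker π := by
    intro j
    rw [LinearMap.mem_ker, map_sub, sub_eq_zero]
    have := congrFun (matAct_comp (D 1) π u) j
    rw [← this, hu', hub]
  have h3 : matAct (D 0) (w - matAct (D 1) u) = fun _ => x := by
    rw [map_sub, hdd, sub_zero, hw]
  have h4 := congrFun h3 ⟨0, hr⟩
  rw [matAct_apply] at h4
  rw [← h4]
  exact Submodule.sum_mem _ fun j _ => Submodule.smul_mem_smul (hmem _ _) (hk j)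

/-- If a module is homologically trivial in high degrees against the resolution given by
matrices `D` of the residue field, then it has a finite free resolution. -/
theorem MatEx.exists_FFR (hdd : ∀ (M : Type u) [AddCommGroup M] [Module B M] n
      (v : Fin (r (n + 2)) → M), matAct (D n) (matAct (D (n + 1)) v) = 0)
    (hr : 0 < r 0) (hmem : ∀ i j, D 0 i j ∈ IsLocalRing.maximalIdeal B)
    (hsurj : ∀ v : Fin (r 0) → B, (∀ i, v i ∈ IsLocalRing.maximalIdeal B) →
      ∃ w, matAct (D 0) w = v) (hB : ∀ n, MatEx r D B n) (T : ℕ) :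
    ∀ (M : Type u) [AddCommGroup M] [Module B M] [Module.Finite B M],
      (∀ n ≥ T, MatEx r D M n) → ∃ ρ, FFR B T M ρ := by
  induction T with
  | zero =>
    intro M _ _ _ hM
    obtain ⟨s, π, hπ, hmin⟩ := exists_minimal_cover (R := B) M
    have hk := MatEx.ker_eq_bot hdd hr hmem hsurj hπ hmin (hM 0 le_rfl)
    exact ⟨_, Module.Free.of_equiv (LinearEquiv.ofBijective π ⟨LinearMap.ker_eq_bot.1 hk, hπ⟩),
      inferInstance, rfl⟩
  | succ T ih =>
    intro M _ _ _ hM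
    obtain ⟨s, π, hπ, hmin⟩ := exists_minimal_cover (R := B) M
    obtain ⟨ρ, hρ⟩ := ih (LinearMap.ker π) fun n hn =>
      MatEx.shift hdd hπ (hB n) (hM (n + 1) (by omega))
    exact ⟨s - ρ, s, π, hπ, by simpa using hρ⟩
end MatrixComplex
end GA

namespace GA
section Curved
variable {Q : Type u} [CommRing Q] {E : Type u} [Ring E] [Algebra Q E]
  {E' : Type u} [Ring E'] [Algebra Q E']

lemma mem_sup_span_smul {V : Type*} [AddCommGroup V] [Module Q V] {F : Ideal Q} {f : Q}
    {N : Submodule Q V} {x : V} :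
    x ∈ (F ⊔ Ideal.span {f}) • N ↔ ∃ g ∈ N, x - f • g ∈ F • N := by
  rw [Submodule.sup_smul, Submodule.ideal_span_singleton_smul, Submodule.mem_sup]
  constructor
  · rintro ⟨y, hy, w, hw, rfl⟩
    obtain ⟨g, hg, rfl⟩ := (Submodule.mem_smul_pointwise_iff_exists _ _ _).1 hw
    exact ⟨g, hg, by simpa using hy⟩
  · rintro ⟨g, hg, h⟩
    exact ⟨_, h, _, Submodule.smul_mem_pointwise_smul g f N hg, by simp⟩

/-- Coordinates of a homogeneous component. -/
noncomputable def FF.coord [IsLocalRing Q] {G : GA Q E} (h : FF G) (n : ℤ) :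
    G.gr n ≃ₗ[Q] (Fin (Module.finrank Q (G.gr n)) → Q) :=
  have := (h n).1
  have := (h n).2
  (Module.finBasis Q (G.gr n)).equivFun

lemma FF.mem_smul_iff [IsLocalRing Q] {G : GA Q E} (h : FF G) {n : ℤ} (𝔟 : Ideal Q) (x : G.gr n) :
    (x : E) ∈ 𝔟 • G.gr n ↔ ∀ i, h.coord n x i ∈ 𝔟 := by
  constructor
  · intro hx i
    have hx' : x ∈ 𝔟 • (⊤ : Submodule Q (G.gr n)) := by
      have h1 : 𝔟 • G.gr n = (𝔟 • (⊤ : Submodule Q (G.gr n))).map (G.gr n).subtype := by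
        rw [Submodule.map_smul'', Submodule.map_top, Submodule.range_subtype]
      rw [h1] at hx
      obtain ⟨y, hy, hyx⟩ := hx
      rwa [← Subtype.ext hyx]
    refine Submodule.smul_induction_on hx' (fun a ha n _ => ?_) (fun a b ha hb => ?_)
    · simpa using Ideal.mul_mem_right _ _ ha
    · simpa using add_mem ha hb
  · intro hx
    have h2 : x = ∑ i, h.coord n x i • (h.coord n).symm (Pi.single i 1) := by
      apply (h.coord n).injective
      funext j
      simp [Pi.single_apply]
    rw [h2, Submodule.coe_sum]
    exact sum_mem fun i _ => Submodule.smul_mem_smul (hx i) (Subtype.mem _)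

lemma FF.mem_of_smul_mem [IsLocalRing Q] {G : GA Q E} (h : FF G) {n : ℤ} {F : Ideal Q} {f : Q}
    (hf : ∀ q, f * q ∈ F → q ∈ F) {x : E} (hx : x ∈ G.gr n) (hfx : f • x ∈ F • G.gr n) :
    x ∈ F • G.gr n := by
  rw [h.mem_smul_iff F ⟨x, hx⟩]
  intro i
  apply hf
  have := (h.mem_smul_iff F (f • ⟨x, hx⟩)).1 hfx i
  rwa [map_smul] at this

lemma d_mem_smul {G : GA Q E} {F : Ideal Q} {n : ℤ} {x : E} (hx : x ∈ F • G.gr n) :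
    G.d x ∈ F • G.gr (n - 1) := by
  have := Submodule.mem_map_of_mem (f := G.d) hx
  rw [Submodule.map_smul''] at this
  refine Submodule.smul_mono le_rfl ?_ this
  rintro _ ⟨y, hy, rfl⟩
  exact G.d_mem hy

/-- `G` is a complex modulo `F`, resolving `Q ⧸ 𝔞` over `Q ⧸ F`. -/
structure Curved (G : GA Q E) (F 𝔞 : Ideal Q) : Prop where
  ff : FF G
  le : F ≤ 𝔞
  dd : ∀ n, ∀ e ∈ G.gr n, G.d (G.d e) ∈ F • G.gr (n - 2)
  res : ∀ n, 1 ≤ n → ∀ e ∈ G.gr n, G.d e ∈ F • G.gr (n - 1) →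
    ∃ h ∈ G.gr (n + 1), e - G.d h ∈ F • G.gr n
  gr_zero : ∀ e ∈ G.gr 0, ∃ r : Q, e = r • 1
  one_inj : ∀ r : Q, r • (1 : E) = 0 → r = 0
  h0 : ∀ c : Q, c ∈ 𝔞 ↔ ∃ z ∈ G.gr 1, G.d z = c • 1

lemma Curved.smul_one_mem {G : GA Q E} {F 𝔞 : Ideal Q} (h : Curved G F 𝔞) {𝔟 : Ideal Q} {c : Q} :
    c • (1 : E) ∈ 𝔟 • G.gr 0 ↔ c ∈ 𝔟 := by
  refine ⟨fun hc => ?_, fun hc => Submodule.smul_mem_smul hc G.one_mem⟩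
  have : ∃ b ∈ 𝔟, c • (1 : E) = b • 1 := by
    refine Submodule.smul_induction_on hc (fun a ha e he => ?_) ?_
    · obtain ⟨r, rfl⟩ := h.gr_zero e he
      exact ⟨a * r, Ideal.mul_mem_right _ _ ha, by rw [smul_smul]⟩
    · rintro x y ⟨a, ha, rfl⟩ ⟨b, hb, rfl⟩
      exact ⟨a + b, add_mem ha hb, by rw [add_smul]⟩
  obtain ⟨b, hb, hcb⟩ := this
  have := h.one_inj (c - b) (by rw [sub_smul, hcb, sub_self])
  rwa [sub_eq_zero.1 this]

lemma Curved.base : Curved (base Q) ⊥ ⊥ where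
  ff := FF.base
  le := le_rfl
  dd := by simp [GA.base]
  res := by
    intro n hn e he _
    have : (GA.base Q).gr n = ⊥ := if_neg (by omega)
    rw [this] at he
    exact ⟨0, zero_mem _, by simp [(Submodule.mem_bot Q).1 he]⟩
  gr_zero := by intro a _; exact ⟨a, by simp⟩
  one_inj := by simp
  h0 := by
    intro c
    simp only [GA.base, Ideal.mem_bot]
    constructor
    · rintro rfl; exact ⟨0, zero_mem _, by simp⟩
    · rintro ⟨z, _, hz⟩; simpa using hz.symm

variable {G : GA Q E} {G' : GA Q E'} {F 𝔞 : Ideal Q}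

lemma Adj.gr_zero' {p : ℤ} {z : E} (a : Adj G G' p z) (h : ∀ e ∈ G.gr 0, ∃ r : Q, e = r • 1) :
    ∀ e ∈ G'.gr 0, ∃ r : Q, e = r • 1 := by
  intro f hf
  have hp := a.p_pos
  obtain ⟨r, hr⟩ := h _ (a.co_mem hf 0 (by simp))
  refine ⟨r, ?_⟩
  rw [a.eq_ins (by omega) hf, hr, map_smul, a.ins_one]

lemma Adj.one_inj' {p : ℤ} {z : E} (a : Adj G G' p z) (h : ∀ r : Q, r • (1 : E) = 0 → r = 0) :
    ∀ r : Q, r • (1 : E') = 0 → r = 0 := by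
  intro r hr
  apply h
  have := congrArg (a.co 0) hr
  rw [← a.ins_one, map_smul, map_zero, a.co_ins _ _ _ a.al_zero] at this
  simpa using this

/-- Adjoining an odd variable of degree one killing an element `x` regular modulo `𝔞`. -/
lemma Curved.adj_one [IsLocalRing Q] {x : Q} (h : Curved G ⊥ 𝔞) (a : Adj G G' 1 (x • 1))
    (hal : ∀ i, a.al i → i < 2) (hx : ∀ q, x * q ∈ 𝔞 → q ∈ 𝔞) :
    Curved G' ⊥ (𝔞 ⊔ Ideal.span {x}) where
  ff := h.ff.adj a
  le := bot_le
  dd := by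
    intro n e he
    have hG : ∀ n, ∀ y ∈ G.gr n, G.d (G.d y) = 0 := fun n y hy => by simpa using h.dd n y hy
    have : G'.d (G'.d e) = 0 := by
      apply a.co_ext
      intro i
      rw [a.co_d, a.co_d, a.co_d, a.co_al (i + 1 + 1) _ (fun hc => by have := hal _ hc; omega),
        map_add, hG _ _ (a.co_mem he i rfl)]
      simp [G.σd]
    rw [this]; exact zero_mem _
  res := by
    intro n hn e he hde
    have hde : G'.d e = 0 := by simpa using hde
    have hs : ∀ i : ℕ, 2 ≤ i → a.co i e = 0 := fun i hi =>
      a.co_al i _ (fun hc => by have := hal _ hc; omega)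
    have hd0 : G.d (a.co 0 e) + x • G.σ (a.co 1 e) = 0 := by
      have := congrArg (a.co 0) hde
      rw [a.co_d, map_zero] at this
      simpa using this
    have hd1 : G.d (a.co 1 e) = 0 := by
      have := congrArg (a.co 1) hde
      rw [a.co_d, map_zero, hs 2 le_rfl] at this
      simpa using this
    have he1 : a.co 1 e ∈ G.gr (n - 1) := a.co_mem he 1 (by simp)
    have he0 : a.co 0 e ∈ G.gr n := a.co_mem he 0 (by simp)
    obtain ⟨k, hk, hk'⟩ : ∃ k ∈ G.gr n, G.d k = a.co 1 e := by
      by_cases hn1 : n = 1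
      · subst hn1
        obtain ⟨c, hc⟩ := h.gr_zero _ (by simpa using he1)
        rw [hc, map_smul, map_one, smul_smul] at hd0
        have hxa : x * -c ∈ 𝔞 := (h.h0 _).2 ⟨a.co 0 e, he0, by
          rw [mul_neg, neg_smul]; exact eq_neg_of_add_eq_zero_left hd0⟩
        have hc' : c ∈ 𝔞 := by simpa using hx _ hxa
        obtain ⟨k, hk, hk'⟩ := (h.h0 _).1 hc'
        exact ⟨k, hk, by rw [hk', hc]⟩
      · obtain ⟨k, hk, hk'⟩ := h.res (n - 1) (by omega) _ he1 (by rw [hd1]; exact zero_mem _)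
        exact ⟨k, G.gr_of_eq hk (by ring), by
          have : a.co 1 e - G.d k = 0 := by simpa using hk'
          exact (sub_eq_zero.1 this).symm⟩
    have hdk := a.d_ins_succ 0 a.al_one k
    rw [hk'] at hdk
    have h2 : G.d (a.co 0 e - x • G.σ k) = 0 := by
      rw [map_sub, map_smul]
      have : G.d (G.σ k) = - G.σ (a.co 1 e) := by rw [← hk', G.σd, neg_neg]
      rw [this, smul_neg, sub_neg_eq_add, hd0]
    obtain ⟨l, hl, hl'⟩ := h.res n hn (a.co 0 e - x • G.σ k)
      (sub_mem he0 (Submodule.smul_mem _ _ (G.σ_mem hk))) (by rw [h2]; exact zero_mem _)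
    have hl'' : a.co 0 e - x • G.σ k = G.d l := by
      have : a.co 0 e - x • G.σ k - G.d l = 0 := by simpa using hl'
      exact sub_eq_zero.1 this
    refine ⟨a.ins 1 k + a.ins 0 l, add_mem (a.ins_mem a.al_one hk (by simp))
      (a.ins_mem a.al_zero hl (by simp)), ?_⟩
    have : e - G'.d (a.ins 1 k + a.ins 0 l) = 0 := by
      rw [map_add, a.d_ins_zero, hdk, ← hl'', sub_eq_zero]
      apply a.co_ext
      intro i
      rw [map_add, map_add, a.co_ins _ _ _ a.al_one, a.co_ins _ _ _ a.al_zero,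
        a.co_ins _ _ _ a.al_zero]
      match i with
      | 0 => simp
      | 1 => simp
      | i + 2 => simp [hs (i + 2) (by omega)]
    rw [this]; exact zero_mem _
  gr_zero := a.gr_zero' h.gr_zero
  one_inj := a.one_inj' h.one_inj
  h0 := by
    intro c
    constructor
    · intro hc
      obtain ⟨b, hb, w, hw, rfl⟩ := Submodule.mem_sup.1 hc
      obtain ⟨q, rfl⟩ := Ideal.mem_span_singleton'.1 hw
      obtain ⟨k, hk, hk'⟩ := (h.h0 b).1 hb
      refine ⟨a.ins 0 k + a.ins 1 (q • 1), add_mem (a.ins_mem a.al_zero hk (by simp))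
        (a.ins_mem a.al_one (Submodule.smul_mem _ _ G.one_mem) (by simp)), ?_⟩
      rw [map_add, a.d_ins_zero, hk', a.d_ins_succ 0 a.al_one, map_smul G.d,
        G.d_gr_zero G.one_mem]
      simp only [smul_zero, map_zero, zero_add, map_smul, map_one, a.ins_one]
      rw [smul_mul_smul_comm, one_mul, map_smul, a.ins_one, add_smul]
    · rintro ⟨w, hw, hdw⟩
      obtain ⟨r, hr⟩ := h.gr_zero _ (a.co_mem (m := 0) hw 1 (by simp))
      have := congrArg (a.co 0) hdw
      rw [a.co_d, hr, map_smul (a.co 0), ← a.ins_one, a.co_ins _ _ _ a.al_zero, if_pos rfl,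
        map_smul G.σ, map_one, smul_mul_smul_comm, one_mul] at this
      have hb : c - r * x ∈ 𝔞 := (h.h0 _).2 ⟨_, a.co_mem hw 0 (by simp), by
        rw [sub_smul, ← this]; simp⟩
      rw [← sub_add_cancel c (r * x)]
      exact Submodule.add_mem_sup hb (Ideal.mem_span_singleton'.2 ⟨r, rfl⟩)

end Curved
end GA

namespace GA
section Curved
variable {Q : Type u} [CommRing Q] {E : Type u} [Ring E] [Algebra Q E]
  {E' : Type u} [Ring E'] [Algebra Q E'] {G : GA Q E} {G' : GA Q E'} {F 𝔞 : Ideal Q}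

lemma Curved.adj_two_dd {f : Q} {z : E} (h : Curved G F 𝔞) (a : Adj G G' 2 z)
    (hz : G.d z = f • 1) (n : ℤ) (e : E') (he : e ∈ G'.gr n) :
    G'.d (G'.d e) ∈ (F ⊔ Ideal.span {f}) • G'.gr (n - 2) := by
  rw [a.mem_smul_gr _ _ _ (G'.gr_of_eq (G'.d_mem (G'.d_mem he)) (by ring))]
  intro i
  have h1 : a.co i (G'.d (G'.d e)) = G.d (G.d (a.co i e)) + f • a.co (i + 1) e := by
    have := a.z_term i e
    simp only [a.co_d, map_add, map_mul, G.leib, G.σσ, hz, G.σd, add_mul, mul_assoc, this]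
    simp
    abel
  rw [h1]
  refine add_mem ?_ ?_
  · refine Submodule.smul_mono_left le_sup_left ?_
    have := h.dd _ _ (a.co_mem he i rfl)
    rwa [show n - i * 2 - 2 = n - 2 - i * 2 by ring] at this
  · refine Submodule.smul_mem_smul (Ideal.mem_sup_right (Ideal.mem_span_singleton_self f)) ?_
    exact a.co_mem he (i + 1) (by push_cast; ring)

/-- The key step in the exactness of the adjunction: the leading coefficient of a cycle modulo
`F + (f)` is a boundary modulo `F + (f)`, up to a multiple of `z`. -/
lemma Curved.adj_two_lead [IsLocalRing Q] {f : Q} {z : E} (h : Curved G F 𝔞) (a : Adj G G' 2 z)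
    (hz : G.d z = f • 1) (hzm : z ∈ G.gr 1) (hf : ∀ q, f * q ∈ F → q ∈ F) {n : ℤ} (hn : 1 ≤ n)
    {e : E'} (he : e ∈ G'.gr n) (hde : G'.d e ∈ (F ⊔ Ideal.span {f}) • G'.gr (n - 1)) (m : ℕ)
    (hm : ∀ i : ℕ, m < i → a.co i e = 0) :
    ∃ k ∈ G.gr (n - m * 2 + 1), ∃ c : Q, c • (1 : E) ∈ G.gr (n - m * 2 - 1) ∧
      a.co m e - G.d k - c • z ∈ (F ⊔ Ideal.span {f}) • G.gr (n - m * 2) := by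
  set F' := F ⊔ Ideal.span {f} with hF'
  have hFF' : ∀ N : Submodule Q E, F • N ≤ F' • N := fun N => Submodule.smul_mono_left le_sup_left
  have hco := (a.mem_smul_gr F' _ _ (G'.d_mem he)).1 hde
  have hem := a.co_mem he m rfl
  obtain ⟨q, hq⟩ : ∃ q, q = n - m * 2 := ⟨_, rfl⟩
  rw [← hq] at hem ⊢
  have hdm : G.d (a.co m e) ∈ F' • G.gr (q - 1) := by
    have := hco m
    rw [a.co_d, hm (m + 1) (by omega), map_zero, zero_mul, add_zero] at this
    rwa [show n - 1 - m * 2 = q - 1 by omega] at this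
  obtain ⟨g, hg, hgF⟩ := mem_sup_span_smul.1 hdm
  rcases lt_trichotomy q 0 with hq0 | hq0 | hq0
  · rw [G.eq_zero_of_neg hq0 hem]
    exact ⟨0, zero_mem _, 0, by simp, by simp⟩
  · subst hq0
    obtain ⟨c, hc⟩ := h.gr_zero _ hem
    obtain ⟨m, rfl⟩ : ∃ l, m = l + 1 := ⟨m - 1, by omega⟩
    have h1 := hco m
    rw [a.co_d, hc, map_smul, map_one, smul_mul_assoc, one_mul,
      show n - 1 - (m : ℤ) * 2 = 1 by push_cast at hq; omega] at h1
    obtain ⟨g, hg, hgF⟩ := mem_sup_span_smul.1 h1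
    have h2 := d_mem_smul hgF
    rw [show (1 : ℤ) - 1 = 0 by norm_num] at h2
    have h3 : G.d (G.d (a.co m e)) ∈ F • G.gr 0 := by
      have := h.dd _ _ (a.co_mem he m rfl)
      rwa [show n - m * 2 - 2 = 0 by push_cast at hq; omega] at this
    have h4 : f • (c • (1 : E) - G.d g) ∈ F • G.gr 0 := by
      have := sub_mem h2 h3
      rw [map_sub, map_add, map_smul, map_smul, hz] at this
      convert this using 1
      rw [smul_sub, smul_smul, smul_smul, mul_comm]
      abel
    have h5 := h.ff.mem_of_smul_mem hf (sub_mem (Submodule.smul_mem _ c G.one_mem)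
      (G.gr_of_eq (G.d_mem hg) (by ring))) h4
    refine ⟨g, G.gr_of_eq hg (by ring), 0, by simp, ?_⟩
    rw [hc, zero_smul, sub_zero]
    exact hFF' _ h5
  by_cases hq1 : q = 1
  · subst hq1
    obtain ⟨c, rfl⟩ := h.gr_zero g (by simpa using hg)
    obtain ⟨k, hk, hk'⟩ := h.res 1 le_rfl (a.co m e - c • z)
      (sub_mem hem (Submodule.smul_mem _ _ hzm)) (by
        rw [map_sub, map_smul, hz, smul_smul, mul_comm c f, ← smul_smul]; exact hgF)
    refine ⟨k, hk, c, by simpa using Submodule.smul_mem _ c G.one_mem, ?_⟩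
    rw [sub_right_comm]
    exact hFF' _ hk'
  · have hdg : G.d g ∈ F • G.gr (q - 1 - 1) := by
      refine h.ff.mem_of_smul_mem hf (G.d_mem hg) ?_
      have h1 := d_mem_smul hgF
      have h2 := h.dd _ _ hem
      rw [show q - 2 = q - 1 - 1 by ring] at h2
      have := sub_mem h2 h1
      rw [map_sub, map_smul] at this
      simpa using this
    obtain ⟨k, hk, hk'⟩ := h.res (q - 1) (by omega) g hg hdg
    have hk : k ∈ G.gr q := G.gr_of_eq hk (by ring)
    obtain ⟨l, hl, hl'⟩ := h.res q (by omega) (a.co m e - f • k)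
      (sub_mem hem (Submodule.smul_mem _ _ hk)) (by
        rw [map_sub, map_smul]
        have := add_mem hgF (Submodule.smul_mem _ f hk')
        convert this using 1
        rw [smul_sub]; abel)
    refine ⟨l, hl, 0, by simp, ?_⟩
    rw [zero_smul, sub_zero]
    have := add_mem (hFF' _ hl') (Submodule.smul_mem_smul
      (Ideal.mem_sup_right (Ideal.mem_span_singleton_self f) : f ∈ F') hk)
    convert this using 1
    abel

/-- Adjoining a divided power variable of degree two whose boundary `z` satisfies `d z = f`, with
`f` regular modulo `F`. -/
lemma Curved.adj_two [IsLocalRing Q] {f : Q} {z : E} (h : Curved G F 𝔞) (a : Adj G G' 2 z)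
    (hal : ∀ i, a.al i) (hz : G.d z = f • 1) (hf : ∀ q, f * q ∈ F → q ∈ F) :
    Curved G' (F ⊔ Ideal.span {f}) 𝔞 where
  ff := h.ff.adj a
  le := by
    have hzm : z ∈ G.gr 1 := a.z_mem
    rw [sup_le_iff, Ideal.span_singleton_le_iff_mem]
    exact ⟨h.le, (h.h0 f).2 ⟨z, hzm, hz⟩⟩
  dd := h.adj_two_dd a hz
  res := by
    intro n hn
    have hzm : z ∈ G.gr 1 := a.z_mem
    set F' := F ⊔ Ideal.span {f} with hF'
    have key : ∀ m : ℕ, ∀ e ∈ G'.gr n, G'.d e ∈ F' • G'.gr (n - 1) →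
        (∀ i : ℕ, m ≤ i → a.co i e = 0) → ∃ k ∈ G'.gr (n + 1), e - G'.d k ∈ F' • G'.gr n := by
      intro m
      induction m with
      | zero =>
        intro e he _ hi
        refine ⟨0, zero_mem _, ?_⟩
        rw [map_zero, sub_zero, a.mem_smul_gr _ _ _ he]
        intro i
        rw [hi i (by omega)]
        exact zero_mem _
      | succ m ih =>
        intro e he hde hi
        obtain ⟨k, hk, c, hc, hkc⟩ := h.adj_two_lead a hz hzm hf hn he hde m
          (fun i hi' => hi i (by omega))
        set K := a.ins m k + a.ins (m + 1) (c • 1) with hKdef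
        have hK : K ∈ G'.gr (n + 1) := add_mem (a.ins_mem (hal _) hk (by ring))
          (a.ins_mem (hal _) hc (by push_cast; ring))
        set u := a.co m e - G.d k - c • z with hu
        have huF : a.ins m u ∈ F' • G'.gr n := by
          rw [a.mem_smul_gr _ _ _ (a.ins_mem (hal _) (Submodule.smul_le_right hkc) (by ring))]
          intro i
          rw [a.co_ins _ _ _ (hal _)]
          split_ifs with him
          · subst him; exact hkc
          · exact zero_mem _
        set e' := e - G'.d K - a.ins m u with he'
        have hdK : G'.d K ∈ G'.gr n := G'.gr_of_eq (G'.d_mem hK) (by ring)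
        obtain ⟨k', hk', hke⟩ := ih e'
          (sub_mem (sub_mem he hdK) (Submodule.smul_le_right huF)) (by
            rw [he', map_sub, map_sub]
            refine sub_mem (sub_mem hde ?_) (d_mem_smul huF)
            have := h.adj_two_dd a hz _ _ hK
            rwa [show n + 1 - 2 = n - 1 by ring] at this) (by
            intro i him
            rw [he', map_sub, map_sub, a.co_ins _ _ _ (hal _), a.co_d, hKdef, map_add (a.co i),
              map_add (a.co (i + 1)),
              a.co_ins _ _ _ (hal _), a.co_ins _ _ _ (hal _), a.co_ins _ _ _ (hal _),
              a.co_ins _ _ _ (hal _), if_neg (show i + 1 ≠ m by omega)]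
            by_cases h1 : i = m
            · subst h1
              rw [if_pos rfl, if_pos rfl, if_pos rfl, if_neg (by omega), hu]
              simp
              abel
            · have hne : i ≠ m := h1
              rw [if_neg h1, if_neg h1, if_neg (show i + 1 ≠ m + 1 by omega), hi i (by omega)]
              split_ifs <;> simp [G.d_gr_zero G.one_mem])
        refine ⟨K + k', add_mem hK hk', ?_⟩
        have := add_mem hke huF
        convert this using 1
        rw [he', map_add]
        abel
    intro e he hde
    exact key _ e he hde fun i hi => a.co_eq_zero he (by
      have := a.exists_bound n
      have h2 : ((n.toNat + 1 : ℕ) : ℤ) ≤ i := by exact_mod_cast hi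
      linarith)
  gr_zero := a.gr_zero' h.gr_zero
  one_inj := a.one_inj' h.one_inj
  h0 := by
    intro c
    rw [h.h0]
    constructor
    · rintro ⟨w, hw, hw'⟩
      exact ⟨a.ins 0 w, a.ins_mem a.al_zero hw (by simp), by
        rw [a.d_ins_zero, hw', map_smul, a.ins_one]⟩
    · rintro ⟨w, hw, hw'⟩
      refine ⟨a.co 0 w, a.co_mem hw 0 (by simp), ?_⟩
      have := congrArg (a.co 0) hw'
      rw [a.co_d, a.co_eq_zero (i := 0 + 1) hw (by norm_num), map_smul, ← a.ins_one,
        a.co_ins _ _ _ a.al_zero] at this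
      simpa using this
end Curved
end GA

namespace GA
section Lift
variable {Q A : Type u} [CommRing Q] [CommRing A] (π : Q →+* A)
variable {E : Type u} [Ring E] [Algebra Q E] {D : Type u} [Ring D] [Algebra A D]

/-- `Lift π G H` presents `H` as the reduction of `G` along the surjection `π`. -/
structure Lift (G : GA Q E) (H : GA A D) where
  φ : E →+* D
  smul : ∀ (q : Q) e, φ (q • e) = π q • φ e
  σ : ∀ e, φ (G.σ e) = H.σ (φ e)
  d : ∀ e, φ (G.d e) = H.d (φ e)
  mem : ∀ {n e}, e ∈ G.gr n → φ e ∈ H.gr n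
  surj : ∀ {n x}, x ∈ H.gr n → ∃ e ∈ G.gr n, φ e = x
  ker : ∀ {n e}, e ∈ G.gr n → φ e = 0 → e ∈ RingHom.ker π • G.gr n

variable {π}

/-- The lift of the ground ring. -/
def Lift.base (hπ : Surjective π) : Lift π (base Q) (base A) where
  φ := π
  smul := by simp
  σ := by simp [GA.base]
  d := by simp [GA.base]
  mem := by
    intro n e he
    by_cases hn : n = 0
    · subst hn; simp [GA.base]
    · simp_all [GA.base]
  surj := by
    intro n x hx
    by_cases hn : n = 0
    · subst hn
      obtain ⟨q, rfl⟩ := hπ x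
      exact ⟨q, by simp [GA.base], rfl⟩
    · have : x = 0 := by simpa [GA.base, hn] using hx
      exact ⟨0, zero_mem _, by simp [this]⟩
  ker := by
    intro n e he h
    by_cases hn : n = 0
    · subst hn
      have := Submodule.smul_mem_smul (I := RingHom.ker π) (N := (GA.base Q).gr 0) h
        (GA.base Q).one_mem
      simpa using this
    · have : e = 0 := by simpa [GA.base, hn] using he
      rw [this]; exact zero_mem _

variable {G : GA Q E} {H : GA A D}

/-- Lifting the adjunction of an odd variable. -/
def Lift.odd (l : Lift π G H) {p : ℤ} {z : E} (hp : Odd p) (hp1 : 1 ≤ p) (hz : z ∈ G.gr (p - 1)) :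
    Lift π (G.odd p z hp hp1 hz) (H.odd p (l.φ z) hp hp1 (l.mem hz)) where
  φ :=
    { toFun := fun f => ⟨l.φ f.re, l.φ f.im⟩
      map_one' := by ext <;> simp
      map_zero' := by ext <;> simp
      map_add' := by intro f g; ext <;> simp
      map_mul' := by intro f g; ext <;> simp [l.σ] }
  smul := by intro q e; ext <;> simp [l.smul]
  σ := by intro e; ext <;> simp [GA.odd, l.σ]
  d := by intro e; ext <;> simp [GA.odd, l.σ, l.d]
  mem := by intro n e he; exact ⟨l.mem he.1, l.mem he.2⟩
  surj := by
    rintro n ⟨x, y⟩ ⟨hx, hy⟩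
    obtain ⟨a, ha, rfl⟩ := l.surj hx
    obtain ⟨b, hb, rfl⟩ := l.surj hy
    exact ⟨⟨a, b⟩, ⟨ha, hb⟩, rfl⟩
  ker := by
    intro n e he h
    have h1 := congrArg OddExt.re h
    have h2 := congrArg OddExt.im h
    rw [(oddAdj G p z hp hp1 hz).mem_smul_gr _ _ _ he]
    intro i
    match i with
    | 0 =>
      change e.re ∈ _
      simpa using l.ker he.1 h1
    | 1 =>
      change e.im ∈ _
      simpa using l.ker he.2 h2
    | i + 2 => exact zero_mem _

/-- Lifting the adjunction of an even variable. -/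
def Lift.even (l : Lift π G H) {p : ℤ} {z : E} (hp : Even p) (hp1 : 1 ≤ p)
    (hz : z ∈ G.gr (p - 1)) :
    Lift π (G.even p z hp hp1 hz) (H.even p (l.φ z) hp hp1 (l.mem hz)) where
  φ :=
    { toFun := fun f => ⟨fun i => l.φ (f.c i)⟩
      map_one' := by ext i; simp only [EvenExt.c_one]; split_ifs <;> simp
      map_zero' := by ext; simp
      map_add' := by intro f g; ext; simp
      map_mul' := by intro f g; ext; simp [EvenExt.c_mul] }
  smul := by intro q e; ext i; simp [l.smul]
  σ := by intro e; ext i; simp [GA.even, l.σ]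
  d := by intro e; ext i; simp [GA.even, l.σ, l.d]
  mem := by intro n e he i; exact l.mem (he i)
  surj := by
    rintro n x hx
    choose a ha h using fun i => l.surj (hx i)
    exact ⟨⟨a⟩, ha, EvenExt.ext (funext h)⟩
  ker := by
    intro n e he h
    rw [(evenAdj G p z hp hp1 hz).mem_smul_gr _ _ _ he]
    exact fun i => l.ker (he i) (congrFun (congrArg EvenExt.c h) i)

lemma Lift.eq_zero (l : Lift π G H) {n : ℤ} {e : E} (he : e ∈ RingHom.ker π • G.gr n) :
    l.φ e = 0 := by
  refine Submodule.smul_induction_on he (fun q hq x hx => ?_) (fun x y hx hy => ?_)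
  · rw [l.smul, (RingHom.mem_ker).1 hq, zero_smul]
  · rw [map_add, hx, hy, add_zero]

variable [IsLocalRing A]

/-- A step of Tate's construction can be lifted. -/
lemma Lift.exists_step {s : Stage A} (l : Lift π G s.G) {p : ℤ} {z : E} (hz : z ∈ G.gr (p - 1))
    (h : Legal s.G s.t p (l.φ z)) :
    ∃ (s' : Stage A) (_ : s.StepBy s' p (l.φ z)) (E' : Type u) (_ : Ring E') (_ : Algebra Q E')
      (G' : GA Q E') (a : Adj G G' p z), (Odd p → ∀ i, a.al i → i < 2) ∧ (Even p → ∀ i, a.al i) ∧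
        Nonempty (Lift π G' s'.G) := by
  have hp1 : 1 ≤ p := s.good.t_pos.trans h.le
  rcases Int.even_or_odd p with hp | hp
  · let a := evenAdj s.G p (l.φ z) hp hp1 (l.mem hz)
    refine ⟨⟨EvenExt s.G, GA.even s.G p _ hp hp1 (l.mem hz), p, s.e + 1, a.good s.good h,
      s.ff.adj a⟩, ⟨h, a, rfl, Or.inr ⟨hp, fun i => trivial, rfl⟩⟩, EvenExt G, inferInstance,
      inferInstance, GA.even G p z hp hp1 hz, evenAdj G p z hp hp1 hz,
      fun h => absurd hp (Int.not_even_iff_odd.2 h), fun _ _ => trivial, ⟨l.even hp hp1 hz⟩⟩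
  · let a := oddAdj s.G p (l.φ z) hp hp1 (l.mem hz)
    refine ⟨⟨OddExt s.G, GA.odd s.G p _ hp hp1 (l.mem hz), p, s.e, a.good s.good h,
      s.ff.adj a⟩, ⟨h, a, rfl, Or.inl ⟨hp, fun i hi => Nat.lt_succ_of_le hi, rfl⟩⟩, OddExt G,
      inferInstance, inferInstance, GA.odd G p z hp hp1 hz, oddAdj G p z hp hp1 hz,
      fun _ i hi => Nat.lt_succ_of_le hi, fun h => absurd h (Int.not_even_iff_odd.2 hp),
      ⟨l.odd hp hp1 hz⟩⟩
end Lift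
end GA

namespace GA
section Koszul
open RingTheory.Sequence Ideal

lemma isWeaklyRegular_append_singleton {Q : Type u} [CommRing Q] {l : List Q} {x : Q} :
    IsWeaklyRegular Q (l ++ [x]) ↔
      IsWeaklyRegular Q l ∧ ∀ q, x * q ∈ ofList l → q ∈ ofList l := by
  rw [isWeaklyRegular_append_iff, isWeaklyRegular_singleton_iff, and_congr_right_iff]
  intro _
  rw [isSMulRegular_iff_right_eq_zero_of_smul, Submodule.Quotient.mk_surjective _ |>.forall]
  refine forall_congr' fun q => ?_
  rw [← Submodule.Quotient.mk_smul, Submodule.Quotient.mk_eq_zero, Submodule.Quotient.mk_eq_zero]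
  simp

lemma notMem_of_regular {Q : Type u} [CommRing Q] [IsLocalRing Q] [IsNoetherianRing Q]
    {l l' : List Q} {x : Q} (h : IsRegular Q (l ++ x :: l'))
    (hm : ofList (l ++ x :: l') = IsLocalRing.maximalIdeal Q) :
    x ∉ ofList l ⊔ IsLocalRing.maximalIdeal Q ^ 2 := by
  intro hx
  have h1 : IsLocalRing.maximalIdeal Q ≤ ofList (l ++ l') := by
    refine Submodule.le_of_le_smul_of_le_jacobson_bot (IsNoetherian.noetherian _)
      (IsLocalRing.maximalIdeal_le_jacobson ⊥) (I := IsLocalRing.maximalIdeal Q) ?_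
    rw [smul_eq_mul, ← pow_two]
    conv_lhs => rw [← hm]
    rw [ofList_append, ofList_cons, ofList_append]
    refine sup_le (le_sup_of_le_left le_sup_left) (sup_le ?_ (le_sup_of_le_left le_sup_right))
    rw [Ideal.span_singleton_le_iff_mem]
    exact (sup_le_sup_right le_sup_left _ : ofList l ⊔ _ ≤ _) hx
  have h2 : IsRegular Q ((l ++ l') ++ [x]) := IsLocalRing.isRegular_of_perm h (by
    rw [List.append_assoc]
    exact List.Perm.append_left l (by simpa using (List.perm_append_comm (l₁ := [x]) (l₂ := l'))))
  have h3 := (isWeaklyRegular_append_singleton.1 h2.toIsWeaklyRegular).2 1 (by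
    rw [mul_one]
    refine h1 ?_
    rw [← hm, ofList_append, ofList_cons]
    exact Ideal.mem_sup_right (Ideal.mem_sup_left (Ideal.mem_span_singleton_self x)))
  have h4 : ofList (l ++ l') ≤ IsLocalRing.maximalIdeal Q := by
    rw [← hm, ofList_append, ofList_append, ofList_cons]
    exact sup_le_sup_left le_sup_right _
  exact (Ideal.ne_top_iff_one _).1 (IsLocalRing.maximalIdeal.isMaximal Q).ne_top (h4 h3)

variable {Q A : Type u} [CommRing Q] [CommRing A] [IsLocalRing Q] [IsLocalRing A]
  {π : Q →+* A}

lemma Good.exists_smul_one {D : Type u} [Ring D] [Algebra A D] {H : GA A D} {t : ℤ} (h : Good H t)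
    {𝔟 : Ideal A} {w : D} (hw : w ∈ 𝔟 • H.gr 0) : ∃ b ∈ 𝔟, w = b • 1 := by
  refine Submodule.smul_induction_on hw (fun a ha e he => ?_) ?_
  · obtain ⟨r, rfl⟩ := h.gr_zero e he
    exact ⟨a * r, Ideal.mul_mem_right _ _ ha, by rw [smul_smul]⟩
  · rintro x y ⟨a, ha, rfl⟩ ⟨b, hb, rfl⟩
    exact ⟨a + b, add_mem ha hb, by rw [add_smul]⟩

variable {E : Type u} [Ring E] [Algebra Q E] {G : GA Q E} {𝔞 : Ideal Q}

lemma Lift.exists_preimage (hπ : Surjective π) {s : Stage A} (l : Lift π G s.G)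
    {F : Ideal Q} (hC : Curved G F 𝔞) {c : Q} {y w : s.A} {𝔟 : Ideal Q}
    (hy : y ∈ s.G.gr 1) (hw : w ∈ 𝔟.map π • s.G.gr 0) (h : π c • (1 : s.A) = s.G.d y + w) :
    c ∈ 𝔞 ⊔ 𝔟 ⊔ RingHom.ker π := by
  obtain ⟨Y, hY, rfl⟩ := l.surj hy
  obtain ⟨r, hr⟩ := hC.gr_zero _ (G.gr_of_eq (G.d_mem hY) (by norm_num))
  obtain ⟨b, hb, rfl⟩ := s.good.exists_smul_one hw
  obtain ⟨b, hb', rfl⟩ := (Ideal.mem_map_iff_of_surjective π hπ).1 hb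
  rw [← l.d, hr, l.smul, map_one, ← add_smul, ← sub_eq_zero, ← sub_smul] at h
  have h := s.good.one_inj _ h
  have h1 : c - (r + b) ∈ RingHom.ker π := by rw [RingHom.mem_ker]; simpa using h
  have h2 : r ∈ 𝔞 := (hC.h0 r).2 ⟨Y, hY, hr⟩
  have := add_mem (Ideal.mem_sup_left (T := RingHom.ker π)
    (add_mem (Ideal.mem_sup_left (T := 𝔟) h2) (Ideal.mem_sup_right hb'))) (Ideal.mem_sup_right h1)
  simpa using this

lemma Lift.legal_one (hπ : Surjective π) (hker : RingHom.ker π ≤ IsLocalRing.maximalIdeal Q ^ 2)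
    {s : Stage A} (ht : s.t = 1) (l : Lift π G s.G) (hC : Curved G ⊥ 𝔞)
    {x : Q} (hx : x ∈ IsLocalRing.maximalIdeal Q)
    (hx' : x ∉ 𝔞 ⊔ IsLocalRing.maximalIdeal Q ^ 2) : Legal s.G s.t 1 (l.φ (x • 1)) where
  le := ht.le
  mem := by
    rw [sub_self, Zt_zero, l.smul, map_one, ← IsLocalRing.map_maximalIdeal_of_surjective π hπ]
    exact Submodule.smul_mem_smul (Ideal.mem_map_of_mem π hx) s.G.one_mem
  nmem := by
    intro h
    rw [sub_self, Zt_zero, Submodule.mem_sup] at h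
    obtain ⟨_, ⟨y, hy, rfl⟩, w, hw, h⟩ := h
    rw [← Submodule.mul_smul, ← pow_two, ← IsLocalRing.map_maximalIdeal_of_surjective π hπ,
      ← Ideal.map_pow] at hw
    rw [l.smul, map_one] at h
    have := l.exists_preimage hπ hC (by simpa using hy) hw h.symm
    exact hx' (sup_le le_rfl (hker.trans le_sup_right) this)
  acyc := by
    intro i hi y hy
    rw [s.G.eq_zero_of_neg (by omega) (s.G.Zt_le_Cyc _ hy).1]
    exact zero_mem _

/-- The Koszul complex of a regular system of parameters, as part of Tate's construction. -/
theorem exists_koszul [IsNoetherianRing Q] (hπ : Surjective π)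
    (hker : RingHom.ker π ≤ IsLocalRing.maximalIdeal Q ^ 2) {rs : List Q} (h : IsRegular Q rs)
    (hm : ofList rs = IsLocalRing.maximalIdeal Q) (l : List Q) : ∀ l', rs = l ++ l' →
    ∃ s : Stage A, (Stage.init A).Reach s ∧ s.t = 1 ∧ s.e = 0 ∧
      (∀ n : ℤ, l.length < n → s.G.gr n = ⊥) ∧
      ∃ (E : Type u) (_ : Ring E) (_ : Algebra Q E) (G : GA Q E), Nonempty (Lift π G s.G) ∧
        Curved G ⊥ (ofList l) := by
  induction l using List.reverseRecOn with
  | nil =>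
    intro l' _
    refine ⟨Stage.init A, .refl, rfl, rfl, fun n hn => if_neg ?_, Q, inferInstance, inferInstance,
      base Q, ⟨Lift.base hπ⟩, by rw [ofList_nil]; exact Curved.base⟩
    simp at hn; omega
  | append_singleton l x ih =>
    intro l' hl
    rw [List.append_assoc, List.singleton_append] at hl
    subst hl
    obtain ⟨s, hr, ht, he, hb, E, _, _, G, ⟨L⟩, hC⟩ := ih _ rfl
    have hx : x ∈ IsLocalRing.maximalIdeal Q := by
      rw [← hm]; exact Ideal.subset_span (by simp)
    have hreg : IsWeaklyRegular Q (l ++ [x]) := by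
      have := h.toIsWeaklyRegular
      rw [show l ++ x :: l' = (l ++ [x]) ++ l' by simp, isWeaklyRegular_append_iff] at this
      exact this.1
    obtain ⟨s', hs, E', _, _, G', a, ha, -, hL⟩ := L.exists_step (p := 1) (z := x • 1)
      (by simpa using Submodule.smul_mem _ x G.one_mem)
      (L.legal_one hπ hker ht hC hx (notMem_of_regular h hm))
    refine ⟨s', .tail hr ⟨_, _, ⟨hs⟩⟩, hs.t_eq, ?_, ?_, E', _, _, G', hL, ?_⟩
    · rcases hs.par with h | h
      · omega
      · exact absurd h.1 (by decide)
    · intro n hn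
      rw [eq_bot_iff]
      intro f hf
      rw [Submodule.mem_bot]
      refine hs.adj.co_ext _ _ fun i => ?_
      rw [map_zero]
      simp only [List.length_append, List.length_singleton, Nat.cast_add, Nat.cast_one] at hn
      have hm := hs.adj.co_mem hf i rfl
      by_cases hi : i < 2
      · rw [hb _ (by omega)] at hm
        simpa using hm
      · refine hs.adj.co_al _ _ fun h => hi ?_
        rcases hs.par with h' | h'
        · exact h'.2.1 _ h
        · exact absurd h'.1 (by decide)
    · rw [ofList_append, ofList_singleton]
      exact hC.adj_one a (ha (by decide)) (isWeaklyRegular_append_singleton.1 hreg).2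

lemma Lift.acycLT_one (hπ : Surjective π) {s : Stage A} (l : Lift π G s.G) {F : Ideal Q}
    (hC : Curved G F (IsLocalRing.maximalIdeal Q)) : s.G.AcycLT 1 := by
  intro i hi y hy
  rcases lt_or_eq_of_le (Int.lt_add_one_iff.1 (by simpa using hi) : i ≤ 0) with h | rfl
  · rw [s.G.eq_zero_of_neg h (s.G.Zt_le_Cyc _ hy).1]
    exact zero_mem _
  · rw [Zt_zero, ← IsLocalRing.map_maximalIdeal_of_surjective π hπ] at hy
    obtain ⟨b, hb, rfl⟩ := s.good.exists_smul_one hy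
    obtain ⟨b, hb', rfl⟩ := (Ideal.mem_map_iff_of_surjective π hπ).1 hb
    obtain ⟨z, hz, hdz⟩ := (hC.h0 b).1 hb'
    exact ⟨l.φ z, l.mem hz, by rw [← l.d, hdz, l.smul, map_one]⟩

end Koszul
end GA

namespace GA
section Matrices
variable {Q : Type u} [CommRing Q] [IsLocalRing Q] {E : Type u} [Ring E] [Algebra Q E]
  {G : GA Q E} {F : Ideal Q}

/-- The differential in a fixed degree. -/
def dmap (G : GA Q E) (n : ℕ) : G.gr ((n + 1 : ℕ) : ℤ) →ₗ[Q] G.gr (n : ℤ) :=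
  G.d.restrict fun _ hx => G.gr_of_eq (G.d_mem hx) (by push_cast; ring)

omit [IsLocalRing Q] in
lemma coe_dmap (n : ℕ) (x : G.gr ((n + 1 : ℕ) : ℤ)) : (G.dmap n x : E) = G.d x := rfl

/-- The matrices of the differential modulo `F`. -/
noncomputable def FF.mat (h : FF G) (F : Ideal Q) (n : ℕ) :
    Fin (Module.finrank Q (G.gr (n : ℤ))) → Fin (Module.finrank Q (G.gr ((n + 1 : ℕ) : ℤ))) →
      Q ⧸ F :=
  fun i j => Ideal.Quotient.mk F (h.coord n (G.dmap n ((h.coord _).symm (Pi.single j 1))) i)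

variable {M : Type u} [AddCommGroup M] [Module (Q ⧸ F) M] {ψ : Q →+ M}

lemma FF.matAct_mat (h : FF G) (hψ : ∀ q q', ψ (q * q') = Ideal.Quotient.mk F q • ψ q') (n : ℕ)
    (x : G.gr ((n + 1 : ℕ) : ℤ)) :
    matAct (h.mat F n) (fun j => ψ (h.coord _ x j)) = fun i => ψ (h.coord n (G.dmap n x) i) := by
  funext i
  rw [matAct_apply]
  have h1 : h.coord _ x = ∑ j, h.coord _ x j • Pi.single j (1 : Q) := by
    conv_lhs => rw [pi_eq_sum_univ' (h.coord _ x)]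
  have h2 : x = ∑ j, h.coord _ x j • (h.coord _).symm (Pi.single j (1 : Q)) := by
    apply (h.coord _).injective
    rw [map_sum]
    simp only [map_smul, LinearEquiv.apply_symm_apply]
    exact h1
  conv_rhs => rw [h2]
  simp only [map_sum, map_smul, Finset.sum_apply, Pi.smul_apply, smul_eq_mul]
  refine Finset.sum_congr rfl fun j _ => ?_
  rw [mul_comm, hψ]
  rfl

lemma FF.matEx_mat (h : FF G) (hψ : ∀ q q', ψ (q * q') = Ideal.Quotient.mk F q • ψ q')
    (hs : Surjective ψ) {𝔟 : Ideal Q} (hk : ∀ q, ψ q = 0 ↔ q ∈ 𝔟) {n : ℕ}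
    (hn : ∀ e ∈ G.gr ((n + 1 : ℕ) : ℤ), G.d e ∈ 𝔟 • G.gr (n : ℤ) →
      ∃ k ∈ G.gr ((n + 2 : ℕ) : ℤ), e - G.d k ∈ 𝔟 • G.gr ((n + 1 : ℕ) : ℤ)) :
    MatEx _ (h.mat F) M n := by
  intro v hv
  choose q hq using fun j => hs (v j)
  obtain ⟨x, hx⟩ := (h.coord ((n + 1 : ℕ) : ℤ)).surjective q
  have hvx : v = fun j => ψ (h.coord _ x j) := by funext j; rw [hx, hq]
  rw [hvx, h.matAct_mat hψ] at hv
  obtain ⟨k, hkm, hk'⟩ := hn x x.2 (by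
    rw [← coe_dmap, h.mem_smul_iff]
    exact fun i => (hk _).1 (congrFun hv i))
  refine ⟨fun j => ψ (h.coord _ ⟨k, hkm⟩ j), ?_⟩
  refine (h.matAct_mat hψ (n + 1) ⟨k, hkm⟩).trans ?_
  rw [hvx]
  funext j
  have h1 := (h.mem_smul_iff 𝔟 (x - G.dmap (n + 1) ⟨k, hkm⟩)).1 hk' j
  rw [map_sub, Pi.sub_apply, ← hk, map_sub, sub_eq_zero] at h1
  exact h1.symm

variable {𝔞 : Ideal Q}

lemma Curved.mat_dd (h : Curved G F 𝔞) (M : Type u) [AddCommGroup M] [Module (Q ⧸ F) M] (n : ℕ)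
    (v : Fin (Module.finrank Q (G.gr ((n + 2 : ℕ) : ℤ))) → M) :
    matAct (h.ff.mat F n) (matAct (h.ff.mat F (n + 1)) v) = 0 := by
  have hψ : ∀ q q', (Ideal.Quotient.mk F).toAddMonoidHom (q * q') =
      Ideal.Quotient.mk F q • (Ideal.Quotient.mk F).toAddMonoidHom q' := by
    intro q q'; simp
  have hB : ∀ v : Fin (Module.finrank Q (G.gr ((n + 2 : ℕ) : ℤ))) → Q ⧸ F,
      matAct (h.ff.mat F n) (matAct (h.ff.mat F (n + 1)) v) = 0 := by
    intro v
    choose q hq using fun j => Ideal.Quotient.mk_surjective (v j)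
    obtain ⟨x, hx⟩ := (h.ff.coord ((n + 2 : ℕ) : ℤ)).surjective q
    have hvx : v = fun j => (Ideal.Quotient.mk F).toAddMonoidHom (h.ff.coord _ x j) := by
      funext j; rw [hx, ← hq]; rfl
    have h1 := h.ff.matAct_mat hψ (n + 1) x
    rw [hvx]
    refine (congrArg _ h1).trans ?_
    rw [h.ff.matAct_mat hψ]
    funext i
    refine Ideal.Quotient.eq_zero_iff_mem.2 ?_
    refine (h.ff.mem_smul_iff F _).1 ?_ i
    have := h.dd _ _ x.2
    rwa [show ((n + 2 : ℕ) : ℤ) - 2 = n by push_cast; ring] at this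
  have hsum : v = ∑ c, fun j => LinearMap.toSpanSingleton (Q ⧸ F) M (v c)
      ((Pi.single c 1 : Fin (Module.finrank Q (G.gr ((n + 2 : ℕ) : ℤ))) → Q ⧸ F) j) := by
    funext j
    simp [Finset.sum_apply, Pi.single_apply]
  rw [hsum, map_sum, map_sum]
  refine Finset.sum_eq_zero fun c _ => ?_
  rw [matAct_comp, matAct_comp, hB]
  funext i
  simp

variable {A : Type u} [CommRing A] [IsLocalRing A] {π : Q →+* A} [IsNoetherianRing Q]

/-- If the reduction along `π` of a resolution of the residue field of `Q ⧸ F` is exact in high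
degrees, then `ker π` is `F` or contains a minimal generator modulo `F` which is regular
modulo `F`. -/
theorem Lift.exists_regular {s : Stage A} (l : Lift π G s.G)
    (h : Curved G F (IsLocalRing.maximalIdeal Q)) (hF : F ≤ RingHom.ker π) {T : ℕ}
    (hT : ∀ i : ℤ, T ≤ i → s.G.Cyc i ≤ s.G.Bd i) (hne : RingHom.ker π ≠ F) :
    ∃ f ∈ RingHom.ker π, f ∉ F ⊔ IsLocalRing.maximalIdeal Q * RingHom.ker π ∧
      ∀ q, f * q ∈ F → q ∈ F := by
  have hFtop : F ≠ ⊤ := fun hh =>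
    (IsLocalRing.maximalIdeal.isMaximal Q).ne_top (top_le_iff.1 (hh ▸ h.le))
  have : Nontrivial (Q ⧸ F) := Ideal.Quotient.nontrivial_iff.2 hFtop
  have : IsLocalRing (Q ⧸ F) :=
    IsLocalRing.of_surjective' (Ideal.Quotient.mk F) Ideal.Quotient.mk_surjective
  set 𝔫 := IsLocalRing.maximalIdeal Q
  set I := RingHom.ker π
  set J := I.map (Ideal.Quotient.mk F)
  have hmax : IsLocalRing.maximalIdeal (Q ⧸ F) = 𝔫.map (Ideal.Quotient.mk F) :=
    (IsLocalRing.map_maximalIdeal_of_surjective _ Ideal.Quotient.mk_surjective).symm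
  have hmk : ∀ (𝔟 : Ideal Q) q, F ≤ 𝔟 →
      (Ideal.Quotient.mk F q ∈ 𝔟.map (Ideal.Quotient.mk F) ↔ q ∈ 𝔟) := by
    intro 𝔟 q hb
    rw [← Ideal.mem_comap, Ideal.comap_map_of_surjective _ Ideal.Quotient.mk_surjective,
      ← RingHom.ker_eq_comap_bot, Ideal.mk_ker, sup_eq_left.2 hb]
  have hψ : ∀ q q', (Ideal.Quotient.mk F).toAddMonoidHom (q * q') =
      Ideal.Quotient.mk F q • (Ideal.Quotient.mk F).toAddMonoidHom q' := by
    intro q q'; simp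
  obtain ⟨ρ, hρ⟩ := MatEx.exists_FFR (r := fun n => Module.finrank Q (G.gr (n : ℤ)))
    (D := h.ff.mat F) (fun M _ _ n v => h.mat_dd M n v) (by
      by_contra h0
      have h0 : Module.finrank Q (G.gr ((0 : ℕ) : ℤ)) = 0 := by simpa using h0
      have : IsEmpty (Fin (Module.finrank Q (G.gr ((0 : ℕ) : ℤ)))) := by
        rw [h0]; infer_instance
      have h1 : (⟨1, G.one_mem⟩ : G.gr ((0 : ℕ) : ℤ)) = 0 :=
        (h.ff.coord ((0 : ℕ) : ℤ)).injective (Subsingleton.elim _ _)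
      have h2 : (1 : E) = 0 := congrArg Subtype.val h1
      exact one_ne_zero (h.one_inj 1 (by rw [one_smul, h2]))) (by
      intro i j
      rw [hmax]
      refine Ideal.mem_map_of_mem _ ((h.ff.mem_smul_iff 𝔫 _).1 ?_ i)
      rw [coe_dmap]
      generalize ((h.ff.coord ((0 + 1 : ℕ) : ℤ)).symm (Pi.single j 1)) = x
      have hx : (x : E) ∈ G.gr 1 := x.2
      obtain ⟨c, hc⟩ := h.gr_zero _ (G.gr_of_eq (G.d_mem hx) (by norm_num))
      rw [hc]
      exact h.smul_one_mem.2 ((h.h0 c).2 ⟨x, hx, hc⟩)) (by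
      intro v hv
      choose q hq using fun j => Ideal.Quotient.mk_surjective (v j)
      obtain ⟨x, hx⟩ := (h.ff.coord ((0 : ℕ) : ℤ)).surjective q
      have hxm : (x : E) ∈ 𝔫 • G.gr ((0 : ℕ) : ℤ) := by
        rw [h.ff.mem_smul_iff]
        intro i
        rw [hx, ← hmk 𝔫 _ h.le, ← hmax, hq]
        exact hv i
      obtain ⟨c, hc⟩ := h.gr_zero _ x.2
      rw [hc] at hxm
      obtain ⟨z, hz, hdz⟩ := (h.h0 c).1 (h.smul_one_mem.1 hxm)
      refine ⟨_, (h.ff.matAct_mat hψ 0 ⟨z, hz⟩).trans ?_⟩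
      have : G.dmap 0 ⟨z, hz⟩ = x := Subtype.ext (by rw [coe_dmap, hc, ← hdz])
      rw [this, hx]
      exact funext hq) (fun n => by
      refine h.ff.matEx_mat hψ Ideal.Quotient.mk_surjective
        (fun q => Ideal.Quotient.eq_zero_iff_mem) ?_
      intro e he hde
      obtain ⟨k, hk, hk'⟩ := h.res _ (by push_cast; omega) e he (by
        rwa [show ((n + 1 : ℕ) : ℤ) - 1 = n by push_cast; ring])
      exact ⟨k, G.gr_of_eq hk (by push_cast; ring), hk'⟩) T ((Q ⧸ F) ⧸ J) (fun n hn => by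
      refine h.ff.matEx_mat (𝔟 := I)
        (ψ := ((Ideal.Quotient.mk J).comp (Ideal.Quotient.mk F)).toAddMonoidHom)
        (fun q q' => by simp [Algebra.smul_def])
        (Ideal.Quotient.mk_surjective.comp Ideal.Quotient.mk_surjective) (fun q => by
          refine Iff.trans Ideal.Quotient.eq_zero_iff_mem (hmk I q hF)) ?_
      intro e he hde
      have h1 : s.G.d (l.φ e) = 0 := by rw [← l.d]; exact l.eq_zero hde
      obtain ⟨y, hy, hy'⟩ := hT ((n + 1 : ℕ) : ℤ) (by push_cast; omega) ⟨l.mem he, h1⟩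
      obtain ⟨Y, hY, rfl⟩ := l.surj hy
      refine ⟨Y, G.gr_of_eq hY (by push_cast; ring), l.ker (sub_mem he
        (G.gr_of_eq (G.d_mem hY) (by ring))) ?_⟩
      rw [map_sub, l.d, hy', sub_self])
  obtain ⟨x, hxJ, hxm, hx0⟩ := hρ.exists_nzd (fun hJ => hne (le_antisymm (by
    intro q hq
    have : Ideal.Quotient.mk F q ∈ J := Ideal.mem_map_of_mem _ hq
    rw [hJ] at this
    exact Ideal.Quotient.eq_zero_iff_mem.1 this) hF))
  obtain ⟨f, hf, rfl⟩ := (Ideal.mem_map_iff_of_surjective _ Ideal.Quotient.mk_surjective).1 hxJ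
  refine ⟨f, hf, fun hc => hxm ?_, fun q hq => ?_⟩
  · rw [hmax, ← Ideal.map_mul]
    have := Ideal.mem_map_of_mem (Ideal.Quotient.mk F) hc
    rwa [Ideal.map_sup, Ideal.map_quotient_self, bot_sup_eq] at this
  · rw [← Ideal.Quotient.eq_zero_iff_mem, map_mul] at hq
    rw [← Ideal.Quotient.eq_zero_iff_mem]
    exact (mem_nonZeroDivisors_iff.1 hx0).1 _ hq

end Matrices
end GA

namespace GA
section Even
open RingTheory.Sequence Ideal

variable {Q A : Type u} [CommRing Q] [CommRing A] [IsLocalRing Q] [IsLocalRing A]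
  {π : Q →+* A} {E : Type u} [Ring E] [Algebra Q E] {G : GA Q E} {F : Ideal Q}

lemma Lift.legal_two (hπ : Surjective π) {s : Stage A} (ht : s.t ≤ 2) (l : Lift π G s.G)
    (hC : Curved G F (IsLocalRing.maximalIdeal Q)) {f : Q} {z : E} (hz : z ∈ G.gr 1)
    (hdz : G.d z = f • 1) (hf : f ∈ RingHom.ker π)
    (hf' : f ∉ F ⊔ IsLocalRing.maximalIdeal Q * RingHom.ker π) : Legal s.G s.t 2 (l.φ z) where
  le := ht
  mem := by
    rw [show (2 : ℤ) - 1 = 1 by norm_num, Zt_of_ne _ one_ne_zero]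
    rw [mem_Cyc]
    refine ⟨l.mem hz, ?_⟩
    rw [← l.d, hdz, l.smul, (RingHom.mem_ker).1 hf, zero_smul]
  nmem := by
    intro h
    rw [show (2 : ℤ) - 1 = 1 by norm_num, Zt_of_ne _ one_ne_zero, Submodule.mem_sup] at h
    obtain ⟨_, ⟨y, hy, rfl⟩, w, hw, h⟩ := h
    obtain ⟨Y, hY, rfl⟩ := l.surj hy
    set 𝔟 := IsLocalRing.maximalIdeal Q * RingHom.ker π with h𝔟
    have hU : ∃ U ∈ G.gr 1, l.φ U = w ∧ G.d U ∈ 𝔟 • G.gr 0 := by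
      rw [← IsLocalRing.map_maximalIdeal_of_surjective π hπ] at hw
      refine Submodule.smul_induction_on hw (fun a ha c hc => ?_) ?_
      · obtain ⟨a, ha', rfl⟩ := (Ideal.mem_map_iff_of_surjective π hπ).1 ha
        obtain ⟨C, hC, rfl⟩ := l.surj hc.1
        refine ⟨a • C, Submodule.smul_mem _ _ hC, l.smul _ _, ?_⟩
        rw [map_smul, h𝔟, Submodule.mul_smul]
        refine Submodule.smul_mem_smul ha' ?_
        exact l.ker (G.gr_of_eq (G.d_mem hC) (by norm_num)) (by rw [l.d]; exact hc.2)
      · rintro x y ⟨U, hU, rfl, hU'⟩ ⟨V, hV, rfl, hV'⟩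
        exact ⟨U + V, add_mem hU hV, map_add _ _ _, by rw [map_add]; exact add_mem hU' hV'⟩
    obtain ⟨U, hU, rfl, hdU⟩ := hU
    have hdY : G.d Y ∈ G.gr 1 := G.gr_of_eq (G.d_mem hY) (by norm_num)
    have h1 : z - G.d Y - U ∈ RingHom.ker π • G.gr 1 := l.ker (sub_mem (sub_mem hz hdY) hU) (by
      rw [map_sub, map_sub, l.d, ← h, add_sub_cancel_left, sub_self])
    have h2 : ∀ x ∈ RingHom.ker π • G.gr 1, G.d x ∈ 𝔟 • G.gr 0 := by
      intro x hx
      refine Submodule.smul_induction_on hx (fun a ha c hc => ?_) (fun x y hx hy => ?_)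
      · obtain ⟨r, hr⟩ := hC.gr_zero _ (G.gr_of_eq (G.d_mem hc) (by norm_num))
        rw [map_smul, hr, smul_smul, hC.smul_one_mem, h𝔟, mul_comm a r]
        exact Ideal.mul_mem_mul ((hC.h0 r).2 ⟨c, hc, hr⟩) ha
      · rw [map_add]; exact add_mem hx hy
    have h3 := h2 _ h1
    have h4 := hC.dd _ _ hY
    rw [show (1 : ℤ) + 1 - 2 = 0 by norm_num] at h4
    apply hf'
    rw [← hC.smul_one_mem, ← hdz]
    have h5 := add_mem (Submodule.smul_mono_left le_sup_left h4)
      (Submodule.smul_mono_left (le_sup_right : 𝔟 ≤ F ⊔ 𝔟) (add_mem h3 hdU))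
    rw [map_sub, map_sub] at h5
    simpa using h5
  acyc := by
    intro i hi
    exact l.acycLT_one hπ hC i (by omega)

theorem exists_list_aux [IsNoetherianRing Q] [IsNoetherianRing A] (hπ : Surjective π) (N : ℕ)
    (hN : ∀ s : Stage A, (Stage.init A).Reach s → s.e ≤ N) (k : ℕ) :
    ∀ (s : Stage A) (E : Type u) [Ring E] [Algebra Q E] (G : GA Q E) (fs : List Q),
      (Stage.init A).Reach s → NilFam s.G → s.t ≤ 2 → Lift π G s.G →
      Curved G (ofList fs) (IsLocalRing.maximalIdeal Q) → IsWeaklyRegular Q fs →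
      ofList fs ≤ RingHom.ker π → N < s.e + k →
      ∃ fs : List Q, IsWeaklyRegular Q fs ∧ ofList fs = RingHom.ker π := by
  induction k with
  | zero =>
    intro s E _ _ G fs hr _ _ _ _ _ _ hk
    have := hN s hr
    omega
  | succ k ih =>
    intro s E _ _ G fs hr hnil ht l hC hfs hle hk
    by_cases hne : RingHom.ker π = ofList fs
    · exact ⟨fs, hfs, hne.symm⟩
    obtain ⟨T, hT⟩ := s.exists_tail (l.acycLT_one hπ hC) hnil N
      fun s' hs' => hN s' (hr.trans hs')
    obtain ⟨f, hf, hf', hreg⟩ := l.exists_regular hC hle (T := T.toNat)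
      (fun i hi => hT i (by omega)) hne
    have hfm : f ∈ IsLocalRing.maximalIdeal Q := by
      refine IsLocalRing.le_maximalIdeal ?_ hf
      exact RingHom.ker_ne_top π
    obtain ⟨z, hz, hdz⟩ := (hC.h0 f).1 hfm
    obtain ⟨s', hs, E', _, _, G', a, -, ha, ⟨l'⟩⟩ := l.exists_step (p := 2) (z := z)
      (by simpa using hz) (l.legal_two hπ ht hC hz hdz hf hf')
    have hstep : s.Step s' := ⟨_, _, ⟨hs⟩⟩
    have hr' : s.Reach s' := .single hstep
    refine ih s' E' G' (fs ++ [f]) (hr.tail hstep) (Stage.Reach.nilFam hr' hnil) hs.t_eq.le l' ?_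
      (isWeaklyRegular_append_singleton.2 ⟨hfs, hreg⟩) ?_ ?_
    · rw [ofList_append, ofList_singleton]
      exact hC.adj_two a (ha (by decide)) hdz hreg
    · rw [ofList_append, ofList_singleton, sup_le_iff, Ideal.span_singleton_le_iff_mem]
      exact ⟨hle, hf⟩
    · rcases hs.par with h | h
      · exact absurd h.1 (by decide)
      · omega

/-- If the number of even variables in Tate's construction over `A` is bounded, then the kernel of a
minimal presentation of `A` by a regular local ring is generated by a regular sequence. -/
theorem exists_list [IsNoetherianRing Q] (hπ : Surjective π)
    (hker : RingHom.ker π ≤ IsLocalRing.maximalIdeal Q ^ 2) {rs : List Q} (h : IsRegular Q rs)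
    (hm : ofList rs = IsLocalRing.maximalIdeal Q) (N : ℕ)
    (hN : ∀ s : Stage A, (Stage.init A).Reach s → s.e ≤ N) :
    ∃ fs : List Q, IsRegular Q fs ∧ ofList fs = RingHom.ker π := by
  have : IsNoetherianRing A := isNoetherianRing_of_surjective Q A π hπ
  obtain ⟨s, hr, ht, he, hb, E, _, _, G, ⟨l⟩, hC⟩ := exists_koszul hπ hker h hm rs [] (by simp)
  rw [hm] at hC
  obtain ⟨fs, h1, h2⟩ := exists_list_aux hπ N hN (N + 1) s E G [] hr
    (.of_bounded s.ff _ hb (l.acycLT_one hπ hC 0 (by norm_num))) (by omega) l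
    (by rwa [ofList_nil]) (IsWeaklyRegular.nil _ _) (by simp) (by omega)
  refine ⟨fs, .of_isWeaklyRegular_of_mem_maximalIdeal _ (fun r hr => ?_) h1, h2⟩
  refine IsLocalRing.le_maximalIdeal (RingHom.ker_ne_top π) ?_
  rw [← h2]
  exact Ideal.subset_span hr
end Even
end GA

namespace GA

section PolynomialCover

variable (k : Type u) [Field k]

/-- The tautological surjection from the polynomial ring on a field to that field. -/
noncomputable def ev : MvPolynomial k ℤ →+* k := MvPolynomial.eval₂Hom (Int.castRingHom k) id

/-- The kernel of the tautological surjection. -/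
noncomputable abbrev evKer : Ideal (MvPolynomial k ℤ) := RingHom.ker (ev k)

variable {k}

@[simp] theorem ev_X (a : k) : ev k (MvPolynomial.X a) = a := by simp [ev]

theorem ev_surjective : Surjective (ev k) := fun a => ⟨_, ev_X a⟩

/-- The vector of partial derivatives, evaluated at the tautological point. -/
noncomputable def jac (h : MvPolynomial k ℤ) : k → k := fun a => ev k (MvPolynomial.pderiv a h)

theorem jac_add (g h : MvPolynomial k ℤ) : jac (g + h) = jac g + jac h := by
  ext a; simp [jac]

theorem jac_C (n : ℤ) : jac (k := k) (MvPolynomial.C n) = 0 := by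
  ext a; simp [jac]

theorem jac_mul (g h : MvPolynomial k ℤ) : jac (g * h) = ev k g • jac h + ev k h • jac g := by
  ext a; simp [jac, Derivation.leibniz]

open Classical in
theorem jac_X (a : k) : jac (MvPolynomial.X a) = Pi.single a 1 := by
  ext b
  by_cases h : b = a
  · subst h; simp [jac]
  · simp [jac, MvPolynomial.pderiv_X_of_ne (Ne.symm h), h]

theorem sub_eq_sum_pderiv {B σ : Type*} [CommRing B] [Fintype σ] (N : Ideal B)
    (hN : ∀ x ∈ N, ∀ y ∈ N, x * y = 0) (g s : MvPolynomial σ ℤ →+* B)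
    (hgs : ∀ i, g (.X i) - s (.X i) ∈ N) (h : MvPolynomial σ ℤ) :
    g h - s h = ∑ i, g (MvPolynomial.pderiv i h) * (g (.X i) - s (.X i)) := by
  classical
  suffices H : g h - s h ∈ N ∧
      g h - s h = ∑ i, g (MvPolynomial.pderiv i h) * (g (.X i) - s (.X i)) from H.2
  induction h using MvPolynomial.induction_on with
  | C n => simp
  | add p q hp hq =>
    refine ⟨by simpa [add_sub_add_comm] using N.add_mem hp.1 hq.1, ?_⟩
    simp only [map_add, add_mul, Finset.sum_add_distrib, ← hp.2, ← hq.2]; ring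
  | mul_X p i hp =>
    have h1 : g (p * .X i) - s (p * .X i)
        = g p * (g (.X i) - s (.X i)) + g (.X i) * (g p - s p) := by
      have := hN _ hp.1 _ (hgs i)
      simp only [map_mul]
      linear_combination (-1 : B) * this
    refine ⟨h1 ▸ N.add_mem (N.mul_mem_left _ (hgs i)) (N.mul_mem_left _ hp.1), ?_⟩
    rw [h1, hp.2]
    simp only [Derivation.leibniz, smul_eq_mul, map_add, map_mul, add_mul, Finset.sum_add_distrib,
      Finset.mul_sum, mul_assoc]
    congr 1
    rw [Finset.sum_eq_single i]
    · simp
    · intro b _ hb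
      simp [MvPolynomial.pderiv_X_of_ne (Ne.symm hb)]
    · simp

end PolynomialCover
end GA

namespace GA

section PolynomialCover
variable {k : Type u} [Field k]

theorem mem_of_jac_eq_zero (p : ℕ) [Fact p.Prime] [CharP k p] {h : MvPolynomial k ℤ}
    (hh : h ∈ evKer k) (hj : jac h = 0) :
    h ∈ evKer k * evKer k ⊔ Ideal.span {(p : MvPolynomial k ℤ)} := by
  classical
  set I : Ideal (MvPolynomial k ℤ) := evKer k * evKer k ⊔ Ideal.span {(p : MvPolynomial k ℤ)}
    with hI
  let B := MvPolynomial k ℤ ⧸ I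
  have hIle : I ≤ evKer k := by
    refine sup_le Ideal.mul_le_right ?_
    rw [Ideal.span_singleton_le_iff_mem, RingHom.mem_ker]
    simp
  let q : B →+* k := Ideal.Quotient.lift I (ev k) fun a ha => hIle ha
  have hqmk : ∀ x, q (Ideal.Quotient.mk I x) = ev k x := fun x => Ideal.Quotient.lift_mk _ _ _
  have hpB : (p : B) = 0 := by
    have : Ideal.Quotient.mk I (p : MvPolynomial k ℤ) = 0 :=
      Ideal.Quotient.eq_zero_iff_mem.mpr (Ideal.mem_sup_right (Ideal.mem_span_singleton_self _))
    simpa using this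
  have : Nontrivial B := RingHom.domain_nontrivial q
  have : CharP B p := by
    refine (CharP.charP_iff_prime_eq_zero Fact.out).mpr hpB
  let : Algebra (ZMod p) B := ZMod.algebra B p
  let : Algebra (ZMod p) k := ZMod.algebra k p
  have hker : ∀ x ∈ RingHom.ker q, ∀ y ∈ RingHom.ker q, x * y = 0 := by
    intro x hx y hy
    obtain ⟨x, rfl⟩ := Ideal.Quotient.mk_surjective x
    obtain ⟨y, rfl⟩ := Ideal.Quotient.mk_surjective y
    rw [RingHom.mem_ker, hqmk] at hx hy
    rw [← map_mul]
    exact Ideal.Quotient.eq_zero_iff_mem.mpr (Ideal.mem_sup_left (Ideal.mul_mem_mul hx hy))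
  have hcomm : q.comp (algebraMap (ZMod p) B) = algebraMap (ZMod p) k := Subsingleton.elim _ _
  let qa : B →ₐ[ZMod p] k := { q with commutes' := fun r => RingHom.congr_fun hcomm r }
  have hqs : Surjective qa := fun a => ⟨Ideal.Quotient.mk I (.X a), by
    change q _ = a
    rw [hqmk, ev_X]⟩
  obtain ⟨T, h₀, rfl⟩ := MvPolynomial.exists_finset_rename h
  let k₀ := IntermediateField.adjoin (ZMod p) (T : Set k)
  have : Algebra.EssFiniteType (ZMod p) k₀ :=
    IntermediateField.essFiniteType_iff.mpr ⟨T, rfl⟩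
  have : Algebra.FormallySmooth (ZMod p) k₀ := inferInstance
  let s : k₀ →ₐ[ZMod p] B := Algebra.FormallySmooth.liftOfSurjective k₀.val qa hqs
    ⟨2, by
      rw [pow_two, Submodule.zero_eq_bot, eq_bot_iff, Ideal.mul_le]
      exact fun x hx y hy => hker x hx y hy⟩
  have hs : ∀ x, q (s x) = x := fun x => Algebra.FormallySmooth.liftOfSurjective_apply k₀.val qa hqs
    ⟨2, by
      rw [pow_two, Submodule.zero_eq_bot, eq_bot_iff, Ideal.mul_le]
      exact fun x hx y hy => hker x hx y hy⟩ x
  let c : T → k₀ := fun a => ⟨a, IntermediateField.subset_adjoin _ _ a.2⟩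
  let e₀ : MvPolynomial T ℤ →+* k₀ := MvPolynomial.eval₂Hom (Int.castRingHom k₀) c
  let ren : MvPolynomial T ℤ →+* MvPolynomial k ℤ :=
    (MvPolynomial.rename (Subtype.val : T → k)).toRingHom
  let g : MvPolynomial T ℤ →+* B := (Ideal.Quotient.mk I).comp ren
  have he₀ : ∀ x, (e₀ x : k) = ev k (ren x) := by
    intro x
    have : (k₀.val.toRingHom).comp e₀ = (ev k).comp ren := by
      refine MvPolynomial.ringHom_ext (fun z => by simp) fun i => ?_
      change ((e₀ (.X i) : k₀) : k) = ev k (MvPolynomial.rename Subtype.val (.X i))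
      rw [MvPolynomial.rename_X, ev_X]
      simp [e₀, c]
    exact RingHom.congr_fun this x
  have hgs : ∀ i, g (.X i) - (s.toRingHom.comp e₀) (.X i) ∈ RingHom.ker q := by
    intro i
    rw [RingHom.mem_ker, map_sub, sub_eq_zero]
    change q (Ideal.Quotient.mk I _) = q (s _)
    rw [hqmk, hs, he₀]
  have key := sub_eq_sum_pderiv (RingHom.ker q) hker g (s.toRingHom.comp e₀) hgs h₀
  have h1 : (s.toRingHom.comp e₀) h₀ = 0 := by
    have : e₀ h₀ = 0 := by
      apply Subtype.ext
      rw [he₀]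
      exact hh
    simp [this]
  rw [h1, sub_zero, Finset.sum_eq_zero] at key
  · exact Ideal.Quotient.eq_zero_iff_mem.mp key
  · intro i _
    refine hker _ ?_ _ (hgs i)
    rw [RingHom.mem_ker]
    change q (Ideal.Quotient.mk I _) = 0
    rw [hqmk]
    have := congrFun hj i
    simp only [jac, Pi.zero_apply] at this
    rw [MvPolynomial.pderiv_rename Subtype.val_injective] at this
    exact this

end PolynomialCover
end GA

namespace GA

section PolynomialCover
variable {k : Type u} [Field k] {A : Type u} [CommRing A]

theorem exists_correction (M : Ideal A) (θ : k →+* A ⧸ M) {n : ℕ} (hn : 1 ≤ n)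
    (f : MvPolynomial k ℤ →+* A) (hf : ∀ h, Ideal.Quotient.mk M (f h) = θ (ev k h))
    (𝔟 : Ideal (MvPolynomial k ℤ)) (hb : 𝔟 ≤ evKer k) (hfb : ∀ h ∈ 𝔟, f h ∈ M ^ n)
    (hj : ∀ h ∈ 𝔟, jac h = 0 → f h ∈ M ^ (n + 1)) :
    ∃ f' : MvPolynomial k ℤ →+* A,
      (∀ h, f' h - f h ∈ M ^ n) ∧ ∀ h ∈ 𝔟, f' h ∈ M ^ (n + 1) := by
  classical
  let V := ↥(M ^ n) ⧸ (M • ⊤ : Submodule A ↥(M ^ n))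
  let : Module k V := Module.compHom V θ
  let mk : ↥(M ^ n) →ₗ[A] V := Submodule.mkQ _
  have hmk : ∀ x : ↥(M ^ n), mk x = 0 ↔ (x : A) ∈ M ^ (n + 1) := by
    intro x
    rw [Submodule.mkQ_apply, Submodule.Quotient.mk_eq_zero, Submodule.mem_smul_top_iff, pow_succ']
    rfl
  have hsm : ∀ (h : MvPolynomial k ℤ) (v : V), ev k h • v = f h • v := by
    intro h v
    change θ (ev k h) • v = _
    rw [← hf]
    obtain ⟨w, rfl⟩ := Submodule.mkQ_surjective _ v
    rfl
  let φ : ∀ h : 𝔟, V := fun h => mk ⟨f h, hfb h h.2⟩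
  have hjac : ∀ (r : MvPolynomial k ℤ) (h : 𝔟),
      jac ((r • h : 𝔟) : MvPolynomial k ℤ) = ev k r • jac (h : MvPolynomial k ℤ) := by
    intro r h
    have h0 : ev k (h : MvPolynomial k ℤ) = 0 := hb h.2
    rw [Submodule.coe_smul, smul_eq_mul, jac_mul, h0, zero_smul, add_zero]
  have hφ : ∀ (r : MvPolynomial k ℤ) (h : 𝔟), φ (r • h) = ev k r • φ h := by
    intro r h
    rw [hsm, ← map_smul]
    refine congrArg mk (Subtype.ext ?_)
    simp
  let Γ : Submodule k ((k → k) × V) :=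
    { carrier := {x | ∃ h : 𝔟, x = (jac (h : MvPolynomial k ℤ), φ h)}
      zero_mem' := ⟨0, by
        ext1
        · ext a; simp [jac]
        · exact ((hmk _).mpr (by simp)).symm⟩
      add_mem' := by
        rintro _ _ ⟨g, rfl⟩ ⟨h, rfl⟩
        refine ⟨g + h, ?_⟩
        ext1
        · exact (jac_add _ _).symm
        · change mk _ + mk _ = mk _
          rw [← map_add]
          congr 1
          ext
          simp
      smul_mem' := by
        rintro c _ ⟨h, rfl⟩
        obtain ⟨r, rfl⟩ := ev_surjective c
        exact ⟨r • h, by rw [hjac, hφ, Prod.smul_mk]⟩ }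
  let pr : Γ →ₗ[k] (k → k) := (LinearMap.fst k _ _).comp Γ.subtype
  have hpr : LinearMap.ker pr = ⊥ := by
    rw [LinearMap.ker_eq_bot']
    rintro ⟨_, h, rfl⟩ hx
    have hx' : jac (h : MvPolynomial k ℤ) = 0 := hx
    ext1
    ext1
    · exact hx'
    · exact (hmk _).mpr (hj h h.2 hx')
  obtain ⟨r, hr⟩ := pr.exists_leftInverse_of_injective hpr
  let E : (k → k) →ₗ[k] V := -((LinearMap.snd k (k → k) V).comp (Γ.subtype.comp r))
  have hE : ∀ h : 𝔟, E (jac (h : MvPolynomial k ℤ)) = - φ h := by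
    intro h
    have := LinearMap.congr_fun hr ⟨_, h, rfl⟩
    have h2 : r (jac (h : MvPolynomial k ℤ)) = ⟨(jac (h : MvPolynomial k ℤ), φ h), h, rfl⟩ := this
    simp [E, h2]
  choose e he using fun a : k => Submodule.mkQ_surjective _ (E (Pi.single a 1))
  let f' : MvPolynomial k ℤ →+* A :=
    MvPolynomial.eval₂Hom (Int.castRingHom A) fun a => f (.X a) + (e a : A)
  have key : ∀ h, ∃ m : ↥(M ^ n), f' h = f h + m ∧ mk m = E (jac h) := by
    intro h
    induction h using MvPolynomial.induction_on with
    | C z => exact ⟨0, by simp [f'], by rw [jac_C, map_zero, map_zero]⟩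
    | add g h hg hh =>
      obtain ⟨m, h1, h2⟩ := hg
      obtain ⟨m', h3, h4⟩ := hh
      refine ⟨m + m', ?_, by rw [jac_add, map_add, map_add, h2, h4]⟩
      rw [map_add, map_add, h1, h3, Submodule.coe_add]
      ring
    | mul_X h a hh =>
      obtain ⟨m, h1, h2⟩ := hh
      refine ⟨f h • e a + f (.X a) • m + (m : A) • e a, ?_, ?_⟩
      · rw [map_mul, h1, map_mul]
        simp only [f', MvPolynomial.eval₂Hom_X', Submodule.coe_add, Submodule.coe_smul,
          smul_eq_mul]
        ring
      · have h3 : mk ((m : A) • e a) = 0 := by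
          rw [hmk, Submodule.coe_smul, smul_eq_mul, pow_succ']
          exact Ideal.mul_mem_mul (Ideal.pow_le_self (by omega) m.2) (e a).2
        rw [map_add, map_add, h3, add_zero, map_smul, map_smul, jac_mul, map_add, map_smul,
          map_smul, h2, jac_X, ev_X, hsm, ← he a]
        congr 1
        rw [← hsm, ev_X]
  refine ⟨f', fun h => ?_, fun h hh => ?_⟩
  · obtain ⟨m, h1, -⟩ := key h
    rw [h1, add_sub_cancel_left]
    exact m.2
  · obtain ⟨m, h1, h2⟩ := key h
    have h3 := hE ⟨h, hh⟩
    rw [← h2] at h3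
    have h4 : mk (m + ⟨f h, hfb h hh⟩) = 0 := by
      rw [map_add, h3]
      exact neg_add_cancel _
    rw [hmk] at h4
    rw [h1, add_comm (f h)]
    exact h4

end PolynomialCover
end GA

namespace GA

section PolynomialCover
variable {k : Type u} [Field k] {A : Type u} [CommRing A]

/-- One step of the construction of a Cohen ring as a tower of quotients of a polynomial ring. -/
structure CohenStep (p n : ℕ) (𝔞 𝔞' : Ideal (MvPolynomial k ℤ)) : Prop where
  le : 𝔞' ≤ 𝔞
  mul_le : evKer k * 𝔞 ≤ 𝔞'
  le_sup : 𝔞 ≤ 𝔞' ⊔ Ideal.span {(p : MvPolynomial k ℤ) ^ n}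
  jac_mem : ∀ h ∈ 𝔞', jac h = 0 → h ∈ evKer k * 𝔞
  pow_notMem : (p : MvPolynomial k ℤ) ^ n ∉ 𝔞'

theorem map_mem_pow_succ {M : Ideal A} {θ : k →+* A ⧸ M} {n : ℕ}
    {f : MvPolynomial k ℤ →+* A} (hf : ∀ h, Ideal.Quotient.mk M (f h) = θ (ev k h))
    {𝔞 : Ideal (MvPolynomial k ℤ)} (hfa : ∀ h ∈ 𝔞, f h ∈ M ^ n)
    {h : MvPolynomial k ℤ} (hh : h ∈ evKer k * 𝔞) : f h ∈ M ^ (n + 1) := by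
  suffices evKer k * 𝔞 ≤ (M ^ (n + 1)).comap f from this hh
  rw [Ideal.mul_le]
  intro r hr s hs
  rw [Ideal.mem_comap, map_mul, pow_succ']
  refine Ideal.mul_mem_mul ?_ (hfa s hs)
  rw [← Ideal.Quotient.eq_zero_iff_mem, hf, show ev k r = 0 from hr, map_zero]

theorem CohenStep.exists_lift {p n : ℕ} {𝔞 𝔞' : Ideal (MvPolynomial k ℤ)}
    (H : CohenStep p n 𝔞 𝔞') (hn : 1 ≤ n) (ha : 𝔞 ≤ evKer k) (M : Ideal A) (θ : k →+* A ⧸ M)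
    {f : MvPolynomial k ℤ →+* A} (hf : ∀ h, Ideal.Quotient.mk M (f h) = θ (ev k h))
    (hfa : ∀ h ∈ 𝔞, f h ∈ M ^ n) :
    ∃ f' : MvPolynomial k ℤ →+* A, (∀ h, Ideal.Quotient.mk M (f' h) = θ (ev k h)) ∧
      (∀ h, f' h - f h ∈ M ^ n) ∧ ∀ h ∈ 𝔞', f' h ∈ M ^ (n + 1) := by
  obtain ⟨f', h1, h2⟩ := exists_correction M θ hn f hf 𝔞' (H.le.trans ha)
    (fun h hh => hfa h (H.le hh)) fun h hh hj => map_mem_pow_succ hf hfa (H.jac_mem h hh hj)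
  refine ⟨f', fun h => ?_, h1, h2⟩
  rw [← hf]
  exact Ideal.Quotient.eq.mpr (Ideal.pow_le_self (by omega) (h1 h))

/-- The inductive hypothesis in the construction of a Cohen ring. -/
structure CohenLevel {W : Type u} [CommRing W] (M : Ideal W) (θ : k →+* W ⧸ M) (p n : ℕ)
    (𝔞 : Ideal (MvPolynomial k ℤ)) : Prop where
  le : 𝔞 ≤ evKer k
  ker_le : evKer k ≤ 𝔞 ⊔ Ideal.span {(p : MvPolynomial k ℤ)}
  pow_mem : (p : MvPolynomial k ℤ) ^ n ∈ 𝔞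
  jac_mem : ∀ h ∈ 𝔞, jac h = 0 → h ∈ evKer k * 𝔞 ⊔ Ideal.span {(p : MvPolynomial k ℤ) ^ n}
  exists_lift : ∃ F : MvPolynomial k ℤ →+* W,
    (∀ h, Ideal.Quotient.mk M (F h) = θ (ev k h)) ∧ ∀ h ∈ 𝔞, F h ∈ M ^ n

theorem cast_mem_evKer (p : ℕ) [CharP k p] : (p : MvPolynomial k ℤ) ∈ evKer k := by
  rw [RingHom.mem_ker]; simp

theorem cohenLevel_one {W : Type u} [CommRing W] (M : Ideal W) (θ : k →+* W ⧸ M) (p : ℕ)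
    [Fact p.Prime] [CharP k p] : CohenLevel M θ p 1 (evKer k) where
  le := le_rfl
  ker_le := le_sup_left
  pow_mem := by rw [pow_one]; exact cast_mem_evKer p
  jac_mem h hh hj := by rw [pow_one]; exact mem_of_jac_eq_zero p hh hj
  exists_lift := by
    choose c hc using fun a : k => Ideal.Quotient.mk_surjective (θ a)
    have key : ∀ h, Ideal.Quotient.mk M
        (MvPolynomial.eval₂Hom (Int.castRingHom W) c h) = θ (ev k h) := by
      intro h
      have : (Ideal.Quotient.mk M).comp (MvPolynomial.eval₂Hom (Int.castRingHom W) c)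
          = θ.comp (ev k) :=
        MvPolynomial.ringHom_ext (fun z => by simp) fun i => by simp [hc]
      exact RingHom.congr_fun this h
    refine ⟨_, key, fun h hh => ?_⟩
    rw [pow_one, ← Ideal.Quotient.eq_zero_iff_mem, key, show ev k h = 0 from hh, map_zero]

theorem CohenLevel.exists_succ {W : Type u} [CommRing W] {M : Ideal W} {θ : k →+* W ⧸ M} {p n : ℕ}
    [CharP k p] (hn : 1 ≤ n) {𝔞 : Ideal (MvPolynomial k ℤ)}
    (H : CohenLevel M θ p n 𝔞) (hM : (p : W) ^ n ∉ M ^ (n + 1)) :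
    ∃ 𝔞' : Ideal (MvPolynomial k ℤ), CohenLevel M θ p (n + 1) 𝔞' ∧ CohenStep p n 𝔞 𝔞' := by
  obtain ⟨F, hF, hFa⟩ := H.exists_lift
  have hmax : (evKer k).IsMaximal := RingHom.ker_isMaximal_of_surjective _ ev_surjective
  let : Field (MvPolynomial k ℤ ⧸ evKer k) := Ideal.Quotient.field _
  let V := 𝔞 ⧸ (evKer k • ⊤ : Submodule (MvPolynomial k ℤ) 𝔞)
  let mk : 𝔞 →ₗ[MvPolynomial k ℤ] V := Submodule.mkQ _
  have hmk : ∀ x : 𝔞, mk x = 0 ↔ (x : MvPolynomial k ℤ) ∈ evKer k * 𝔞 := by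
    intro x
    rw [Submodule.mkQ_apply, Submodule.Quotient.mk_eq_zero, Submodule.mem_smul_top_iff]
    rfl
  let P : 𝔞 := ⟨(p : MvPolynomial k ℤ) ^ n, H.pow_mem⟩
  have hP : mk P ≠ 0 := by
    rw [Ne, hmk]
    intro h
    have := map_mem_pow_succ hF hFa h
    rw [map_pow, map_natCast] at this
    exact hM this
  obtain ⟨l, hl⟩ := Module.Projective.exists_dual_eq_one (MvPolynomial k ℤ ⧸ evKer k) hP
  let l' : 𝔞 →ₗ[MvPolynomial k ℤ] (MvPolynomial k ℤ ⧸ evKer k) :=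
    (l.restrictScalars (MvPolynomial k ℤ)).comp mk
  have hl' : l' P = 1 := hl
  have hlJ : ∀ x : 𝔞, (x : MvPolynomial k ℤ) ∈ evKer k * 𝔞 → l' x = 0 := by
    intro x hx
    change l (mk x) = 0
    rw [(hmk x).mpr hx, map_zero]
  let 𝔞' : Ideal (MvPolynomial k ℤ) := Submodule.map 𝔞.subtype (LinearMap.ker l')
  have hmem : ∀ x : 𝔞, (x : MvPolynomial k ℤ) ∈ 𝔞' ↔ l' x = 0 := by
    intro x
    constructor
    · rintro ⟨y, hy, hxy⟩
      rw [← Subtype.ext hxy]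
      exact hy
    · exact fun h => ⟨x, h, rfl⟩
  have hle : 𝔞' ≤ 𝔞 := by
    rintro _ ⟨y, -, rfl⟩
    exact y.2
  have hpJ : (p : MvPolynomial k ℤ) ∈ evKer k := cast_mem_evKer p
  have hpnJ : (p : MvPolynomial k ℤ) ^ n ∈ evKer k := Ideal.pow_mem_of_mem _ hpJ _ (by omega)
  have hmul : evKer k * 𝔞 ≤ 𝔞' := fun x hx =>
    (hmem ⟨x, Ideal.mul_le_right (I := evKer k) hx⟩).mpr (hlJ _ hx)
  have hsmul : ∀ q : MvPolynomial k ℤ, l' (q • P) = Ideal.Quotient.mk _ q := by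
    intro q
    rw [map_smul, hl', Algebra.smul_def, mul_one]
    rfl
  have hstep : CohenStep p n 𝔞 𝔞' :=
    { le := hle
      mul_le := hmul
      le_sup := by
        intro x hx
        obtain ⟨q, hq⟩ := Ideal.Quotient.mk_surjective (l' ⟨x, hx⟩)
        have h1 : ((⟨x, hx⟩ - q • P : 𝔞) : MvPolynomial k ℤ) ∈ 𝔞' := by
          rw [hmem, map_sub, hsmul, hq, sub_self]
        rw [← sub_add_cancel x (q * (p : MvPolynomial k ℤ) ^ n)]
        exact Submodule.add_mem_sup h1 (Ideal.mul_mem_left _ _ (Ideal.mem_span_singleton_self _))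
      jac_mem := by
        intro h hh hj
        obtain ⟨j, hj', r, hr, rfl⟩ := Submodule.mem_sup.mp (H.jac_mem h (hle hh) hj)
        obtain ⟨q, rfl⟩ := Ideal.mem_span_singleton'.mp hr
        have hj'' := hmul hj'
        have h1 : ((q • P : 𝔞) : MvPolynomial k ℤ) ∈ 𝔞' := by
          have := 𝔞'.sub_mem hh hj''
          rwa [add_sub_cancel_left] at this
        rw [hmem, hsmul, Ideal.Quotient.eq_zero_iff_mem] at h1
        exact Ideal.add_mem _ hj' (Ideal.mul_mem_mul h1 H.pow_mem)
      pow_notMem := by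
        intro h
        have := (hmem P).mp h
        rw [hl'] at this
        exact one_ne_zero this }
  refine ⟨𝔞', ?_, hstep⟩
  have hker : evKer k ≤ 𝔞' ⊔ Ideal.span {(p : MvPolynomial k ℤ)} := by
    refine H.ker_le.trans (sup_le (hstep.le_sup.trans (sup_le_sup_left ?_ _)) le_sup_right)
    rw [Ideal.span_singleton_le_span_singleton]
    exact dvd_pow_self _ (by omega)
  exact
    { le := hle.trans H.le
      ker_le := hker
      pow_mem := hmul (by rw [pow_succ']; exact Ideal.mul_mem_mul hpJ H.pow_mem)
      jac_mem := by
        intro h hh hj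
        have h1 := hstep.jac_mem h hh hj
        have h2 : evKer k * 𝔞
            ≤ evKer k * 𝔞' ⊔ Ideal.span {(p : MvPolynomial k ℤ) ^ (n + 1)} := by
          refine (Ideal.mul_mono_right hstep.le_sup).trans ?_
          rw [Ideal.mul_sup]
          refine sup_le le_sup_left ?_
          refine (Ideal.mul_mono_left hker).trans ?_
          rw [Ideal.sup_mul, Ideal.span_singleton_mul_span_singleton, ← pow_succ']
          refine sup_le_sup_right ?_ _
          rw [mul_comm]
          exact Ideal.mul_mono_left ((Ideal.span_singleton_le_iff_mem _).mpr hpnJ)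
        exact h2 h1
      exists_lift := by
        obtain ⟨F', h1, -, h2⟩ := hstep.exists_lift hn H.le M θ hF hFa
        exact ⟨F', h1, h2⟩ }

variable (k) in
/-- A tower of ideals of a polynomial ring whose quotients are the truncations of a Cohen ring. -/
theorem exists_cohen_tower (p : ℕ) [Fact p.Prime] [CharP k p] :
    ∃ 𝔞 : ℕ → Ideal (MvPolynomial k ℤ), 𝔞 0 = evKer k ∧
      ∀ n, (p : MvPolynomial k ℤ) ^ (n + 1) ∈ 𝔞 n ∧
        evKer k ≤ 𝔞 n ⊔ Ideal.span {(p : MvPolynomial k ℤ)} ∧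
        𝔞 n ≤ evKer k ∧ CohenStep p (n + 1) (𝔞 n) (𝔞 (n + 1)) := by
  let K := AlgebraicClosure k
  have : CharP K p := charP_of_injective_algebraMap (algebraMap k K).injective p
  let W := WittVector p K
  let M : Ideal W := Ideal.span {(p : W)}
  let θ : k →+* W ⧸ M :=
    (WittVector.quotientPEquiv (p := p) (k := K)).symm.toRingHom.comp (algebraMap k K)
  have hM : ∀ n, (p : W) ^ n ∉ M ^ (n + 1) := by
    intro n h
    rw [Ideal.span_singleton_pow, Ideal.mem_span_singleton] at h
    have hirr : Irreducible (p : W) := WittVector.irreducible p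
    have := (pow_dvd_pow_iff hirr.ne_zero hirr.not_isUnit).mp h
    omega
  choose g hg hg' using fun (n : ℕ) (𝔞 : {𝔞 // CohenLevel M θ p (n + 1) 𝔞}) =>
    𝔞.2.exists_succ (by omega) (hM (n + 1))
  let a : ∀ n : ℕ, {𝔞 : Ideal (MvPolynomial k ℤ) // CohenLevel M θ p (n + 1) 𝔞} := fun n =>
    Nat.rec ⟨evKer k, cohenLevel_one M θ p⟩ (fun n 𝔞 => ⟨g n 𝔞, hg n 𝔞⟩) n
  exact ⟨fun n => (a n).1, rfl, fun n =>
    ⟨(a n).2.pow_mem, (a n).2.ker_le, (a n).2.le, hg' n (a n)⟩⟩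

end PolynomialCover
end GA

namespace GA

section Uniformizer

theorem isNoetherianRing_of_uniformizer {C K : Type u} [CommRing C] [Field K] (ρ : C →+* K)
    (hunit : ∀ c, ρ c ≠ 0 → IsUnit c) (ϖ : C)
    (hker : RingHom.ker ρ = Ideal.span {ϖ}) (hnzd : ∀ c, ϖ * c = 0 → c = 0)
    (hsep : ∀ c, (∀ n, ϖ ^ n ∣ c) → c = 0) :
    IsNoetherianRing C ∧ ∃ _ : IsLocalRing C, IsLocalRing.maximalIdeal C = Ideal.span {ϖ} := by
  have : Nontrivial C := RingHom.domain_nontrivial ρ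
  have hϖ : ρ ϖ = 0 := by
    rw [← RingHom.mem_ker, hker]; exact Ideal.mem_span_singleton_self _
  have hunit' : ∀ c, IsUnit c ↔ ρ c ≠ 0 := fun c => ⟨fun h => (h.map ρ).ne_zero, hunit c⟩
  have hpow : ∀ (n : ℕ) (c : C), ϖ ^ n * c = 0 → c = 0 := by
    intro n
    induction n with
    | zero => intro c h; simpa using h
    | succ n ih =>
      intro c h
      rw [pow_succ', mul_assoc] at h
      exact ih c (hnzd _ h)
  have hfac : ∀ c : C, c ≠ 0 → ∃ (n : ℕ) (v : C), IsUnit v ∧ c = ϖ ^ n * v := by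
    intro c hc
    have hex : ∃ n, ¬ ϖ ^ n ∣ c := by
      by_contra! hcon
      exact hc (hsep c hcon)
    classical
    have h0 : Nat.find hex ≠ 0 := by
      intro h
      have := Nat.find_spec hex
      rw [h, pow_zero] at this
      exact this (one_dvd _)
    obtain ⟨m, hm⟩ := Nat.exists_eq_succ_of_ne_zero h0
    have h1 : ϖ ^ m ∣ c := not_not.mp (Nat.find_min hex (by omega))
    obtain ⟨v, rfl⟩ := h1
    refine ⟨m, v, hunit v fun hv => ?_, rfl⟩
    rw [← RingHom.mem_ker, hker, Ideal.mem_span_singleton] at hv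
    have := Nat.find_spec hex
    rw [hm, Nat.succ_eq_add_one, pow_succ] at this
    exact this (mul_dvd_mul_left _ hv)
  have : NoZeroDivisors C := by
    refine ⟨fun {a b} hab => ?_⟩
    by_contra! hcon
    obtain ⟨n, v, hv, rfl⟩ := hfac a hcon.1
    rw [mul_assoc] at hab
    have := hpow n _ hab
    exact hcon.2 ((hv.mul_right_eq_zero).mp this)
  have : IsDomain C := NoZeroDivisors.to_isDomain C
  have hϖ0 : ϖ ≠ 0 := by
    rintro rfl
    exact one_ne_zero (hnzd 1 (by simp))
  have hirr : Irreducible ϖ := by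
    refine ⟨fun h => (hunit' ϖ).mp h hϖ, fun a b hab => ?_⟩
    have h1 : ρ a * ρ b = 0 := by rw [← map_mul, ← hab, hϖ]
    rcases mul_eq_zero.mp h1 with h | h
    · right
      rw [← RingHom.mem_ker, hker, Ideal.mem_span_singleton] at h
      obtain ⟨c, rfl⟩ := h
      rw [mul_assoc] at hab
      exact IsUnit.of_mul_eq_one c (by
        rw [mul_comm]
        exact (mul_left_cancel₀ hϖ0 (by rw [mul_one]; exact hab)).symm)
    · left
      rw [← RingHom.mem_ker, hker, Ideal.mem_span_singleton] at h
      obtain ⟨c, rfl⟩ := h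
      refine IsUnit.of_mul_eq_one c (mul_left_cancel₀ hϖ0 ?_)
      rw [mul_one]
      conv_rhs => rw [hab]
      ring
  have hdvr : IsDiscreteValuationRing C :=
    IsDiscreteValuationRing.ofHasUnitMulPowIrreducibleFactorization
      ⟨ϖ, hirr, fun {x} hx => by
        obtain ⟨n, v, hv, rfl⟩ := hfac x hx
        exact ⟨n, hv.unit, rfl⟩⟩
  exact ⟨inferInstance, inferInstance, hirr.maximalIdeal_eq⟩

/-- The inverse limit of the quotients by a decreasing sequence of ideals. -/
def invLim {P : Type u} [CommRing P] (𝔞 : ℕ → Ideal P) (h : ∀ n, 𝔞 (n + 1) ≤ 𝔞 n) :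
    Subring (∀ n, P ⧸ 𝔞 n) where
  carrier := {c | ∀ n, Ideal.Quotient.factor (h n) (c (n + 1)) = c n}
  mul_mem' ha hb n := by simp [ha n, hb n]
  one_mem' n := by simp
  add_mem' ha hb n := by simp [ha n, hb n]
  zero_mem' n := by simp
  neg_mem' ha n := by simp [ha n]

end Uniformizer

section PolynomialCover
variable {k : Type u} [Field k]

theorem exists_mul_sub_one_mem {q : MvPolynomial k ℤ} (hq : q ∉ evKer k) :
    ∃ y, q * y - 1 ∈ evKer k := by
  obtain ⟨y, hy⟩ := ev_surjective (ev k q)⁻¹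
  refine ⟨y, ?_⟩
  rw [RingHom.mem_ker, map_sub, map_mul, hy, map_one, mul_inv_cancel₀ hq, sub_self]

theorem CohenStep.mem_of_pow_mul_mem {p n : ℕ} {𝔞 𝔞' : Ideal (MvPolynomial k ℤ)}
    (H : CohenStep p n 𝔞 𝔞') (hp : (p : MvPolynomial k ℤ) ^ n ∈ 𝔞) {q : MvPolynomial k ℤ}
    (hq : (p : MvPolynomial k ℤ) ^ n * q ∈ 𝔞') : q ∈ evKer k := by
  by_contra hcon
  obtain ⟨y, hy⟩ := exists_mul_sub_one_mem hcon
  apply H.pow_notMem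
  have h1 := 𝔞'.mul_mem_right y hq
  have h2 := H.mul_le (Ideal.mul_mem_mul hy hp)
  have := 𝔞'.sub_mem h1 h2
  convert this using 1
  ring

theorem mem_of_mul_mem {p : ℕ} {𝔞 : ℕ → Ideal (MvPolynomial k ℤ)} (h0 : 𝔞 0 = evKer k)
    (hpow : ∀ n, (p : MvPolynomial k ℤ) ^ (n + 1) ∈ 𝔞 n)
    (hstep : ∀ n, CohenStep p (n + 1) (𝔞 n) (𝔞 (n + 1))) (n : ℕ) {x : MvPolynomial k ℤ}
    (hx : (p : MvPolynomial k ℤ) * x ∈ 𝔞 (n + 1)) : x ∈ 𝔞 n := by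
  have hp : (p : MvPolynomial k ℤ) ∈ evKer k := by simpa [h0] using hpow 0
  induction n with
  | zero =>
    rw [h0]
    exact (hstep 0).mem_of_pow_mul_mem (hpow 0) (by simpa using hx)
  | succ n ih =>
    have h1 := ih ((hstep (n + 1)).le hx)
    obtain ⟨a, ha, r, hr, rfl⟩ := Submodule.mem_sup.mp ((hstep n).le_sup h1)
    obtain ⟨q, rfl⟩ := Ideal.mem_span_singleton'.mp hr
    have h2 : (p : MvPolynomial k ℤ) * a ∈ 𝔞 (n + 1 + 1) :=
      (hstep (n + 1)).mul_le (Ideal.mul_mem_mul hp ha)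
    have h3 : (p : MvPolynomial k ℤ) ^ (n + 1 + 1) * q ∈ 𝔞 (n + 1 + 1) := by
      convert (𝔞 (n + 1 + 1)).sub_mem hx h2 using 1
      ring
    have h4 := (hstep (n + 1)).mem_of_pow_mul_mem (hpow (n + 1)) h3
    exact (𝔞 (n + 1)).add_mem ha ((hstep n).mul_le (Ideal.mul_mem_mul h4 (hpow n)))

end PolynomialCover
end GA

namespace GA

section CohenRing

theorem cohen_limit {k : Type u} [Field k] {p : ℕ}
    {𝔞 : ℕ → Ideal (MvPolynomial k ℤ)} (h0 : 𝔞 0 = evKer k)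
    (hpow : ∀ n, (p : MvPolynomial k ℤ) ^ (n + 1) ∈ 𝔞 n)
    (hker : ∀ n, evKer k ≤ 𝔞 n ⊔ Ideal.span {(p : MvPolynomial k ℤ)})
    (hstep : ∀ n, CohenStep p (n + 1) (𝔞 n) (𝔞 (n + 1))) :
    (IsNoetherianRing (invLim 𝔞 fun n => (hstep n).le) ∧
      ∃ _ : IsLocalRing (invLim 𝔞 fun n => (hstep n).le),
        IsLocalRing.maximalIdeal (invLim 𝔞 fun n => (hstep n).le)
          = Ideal.span {((p : ℕ) : invLim 𝔞 fun n => (hstep n).le)}) ∧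
      ∀ c : invLim 𝔞 fun n => (hstep n).le, (p : invLim 𝔞 fun n => (hstep n).le) * c = 0 → c = 0 := by
  set C := invLim 𝔞 fun n => (hstep n).le with hC
  have hpJ : (p : MvPolynomial k ℤ) ∈ evKer k := by simpa [h0] using hpow 0
  have hle : ∀ n, 𝔞 n ≤ evKer k := by
    intro n
    induction n with
    | zero => exact h0.le
    | succ n ih => exact (hstep n).le.trans ih
  have hpC : ∀ n, ((p : C) : ∀ n, MvPolynomial k ℤ ⧸ 𝔞 n) n
      = Ideal.Quotient.mk (𝔞 n) (p : MvPolynomial k ℤ) := by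
    intro n; simp
  have hext : ∀ c d : C, (∀ n, (c : ∀ n, MvPolynomial k ℤ ⧸ 𝔞 n) n
      = (d : ∀ n, MvPolynomial k ℤ ⧸ 𝔞 n) n) → c = d := fun c d h => Subtype.ext (funext h)
  have hcomp : ∀ (c : C) (n : ℕ) (x y : MvPolynomial k ℤ),
      (c : ∀ n, MvPolynomial k ℤ ⧸ 𝔞 n) (n + 1) = Ideal.Quotient.mk _ x →
      (c : ∀ n, MvPolynomial k ℤ ⧸ 𝔞 n) n = Ideal.Quotient.mk _ y → x - y ∈ 𝔞 n := by
    intro c n x y hx hy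
    have := c.2 n
    rw [hx, hy, Ideal.Quotient.factor_mk] at this
    exact Ideal.Quotient.eq.mp this
  have hnzd : ∀ c : C, (p : C) * c = 0 → c = 0 := by
    intro c hc
    refine hext c 0 fun n => ?_
    obtain ⟨x, hx⟩ := Ideal.Quotient.mk_surjective ((c : ∀ n, MvPolynomial k ℤ ⧸ 𝔞 n) (n + 1))
    obtain ⟨y, hy⟩ := Ideal.Quotient.mk_surjective ((c : ∀ n, MvPolynomial k ℤ ⧸ 𝔞 n) n)
    have h1 : ((p : C) * c : C).1 (n + 1) = 0 := by rw [hc]; rfl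
    change ((p : C) : ∀ n, MvPolynomial k ℤ ⧸ 𝔞 n) (n + 1) * c.1 (n + 1) = 0 at h1
    rw [hpC, ← hx, ← map_mul, Ideal.Quotient.eq_zero_iff_mem] at h1
    have h2 := mem_of_mul_mem h0 hpow hstep n h1
    have h3 := hcomp c n x y hx.symm hy.symm
    change c.1 n = 0
    rw [← hy, Ideal.Quotient.eq_zero_iff_mem]
    have := (𝔞 n).sub_mem h2 h3
    rwa [sub_sub_cancel] at this
  refine ⟨?_, hnzd⟩
  let ρ₀ : MvPolynomial k ℤ ⧸ 𝔞 0 →+* k := Ideal.Quotient.lift _ (ev k) fun a ha => hle 0 ha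
  let ρ : C →+* k := ρ₀.comp ((Pi.evalRingHom _ 0).comp C.subtype)
  have hρ : ∀ (c : C) (n : ℕ) (x : MvPolynomial k ℤ),
      (c : ∀ n, MvPolynomial k ℤ ⧸ 𝔞 n) n = Ideal.Quotient.mk _ x → ρ c = ev k x := by
    intro c n
    induction n with
    | zero =>
      intro x hx
      change ρ₀ (c.1 0) = _
      rw [hx]
      rfl
    | succ n ih =>
      intro x hx
      refine ih x ?_
      rw [← c.2 n, hx, Ideal.Quotient.factor_mk]
  refine isNoetherianRing_of_uniformizer ρ ?_ (p : C) ?_ hnzd ?_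
  · intro c hc
    have hJ : ∀ n, ∀ x ∈ evKer k, x ^ (n + 1) ∈ 𝔞 n := by
      intro n x hx
      obtain ⟨a, ha, r, hr, rfl⟩ := Submodule.mem_sup.mp (hker n hx)
      obtain ⟨q, rfl⟩ := Ideal.mem_span_singleton'.mp hr
      rw [← Ideal.Quotient.eq_zero_iff_mem, map_pow, map_add, Ideal.Quotient.eq_zero_iff_mem.mpr ha,
        zero_add, ← map_pow, mul_pow, Ideal.Quotient.eq_zero_iff_mem]
      exact Ideal.mul_mem_left _ _ (hpow n)
    have hinv : ∀ n, ∃ y, (c : ∀ n, MvPolynomial k ℤ ⧸ 𝔞 n) n * y = 1 := by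
      intro n
      obtain ⟨x, hx⟩ := Ideal.Quotient.mk_surjective ((c : ∀ n, MvPolynomial k ℤ ⧸ 𝔞 n) n)
      rw [hρ c n x hx.symm] at hc
      obtain ⟨y, hy⟩ := exists_mul_sub_one_mem hc
      have hnil : IsNilpotent (Ideal.Quotient.mk (𝔞 n) (x * y - 1)) :=
        ⟨n + 1, by rw [← map_pow, Ideal.Quotient.eq_zero_iff_mem]; exact hJ n _ hy⟩
      have h1 := hnil.isUnit_add_one
      rw [map_sub, map_one, sub_add_cancel, map_mul, hx] at h1
      obtain ⟨z, hz⟩ := (isUnit_of_mul_isUnit_left h1).exists_right_inv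
      exact ⟨z, hz⟩
    choose y hy using hinv
    refine IsUnit.of_mul_eq_one ⟨y, fun n => ?_⟩ (hext _ _ fun n => hy n)
    have h1 : (c : ∀ n, MvPolynomial k ℤ ⧸ 𝔞 n) n *
        Ideal.Quotient.factor ((hstep n).le) (y (n + 1)) = 1 := by
      rw [← c.2 n, ← map_mul, hy, map_one]
    have h2 := hy n
    calc _ = ((c : ∀ n, MvPolynomial k ℤ ⧸ 𝔞 n) n * y n)
          * Ideal.Quotient.factor ((hstep n).le) (y (n + 1)) := by rw [h2, one_mul]
      _ = y n * ((c : ∀ n, MvPolynomial k ℤ ⧸ 𝔞 n) n *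
          Ideal.Quotient.factor ((hstep n).le) (y (n + 1))) := by ring
      _ = y n := by rw [h1, mul_one]
  · apply le_antisymm
    · intro c hc
      choose x hx using fun n =>
        Ideal.Quotient.mk_surjective ((c : ∀ n, MvPolynomial k ℤ ⧸ 𝔞 n) n)
      have hb : ∀ n, ∃ b, x (n + 1) - p * b ∈ 𝔞 (n + 1) := by
        intro n
        have h1 : x (n + 1) ∈ evKer k := by
          rw [RingHom.mem_ker, ← hρ c (n + 1) _ (hx (n + 1)).symm]
          exact hc
        obtain ⟨a, ha, r, hr, h2⟩ := Submodule.mem_sup.mp (hker (n + 1) h1)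
        obtain ⟨b, rfl⟩ := Ideal.mem_span_singleton'.mp hr
        refine ⟨b, ?_⟩
        rw [← h2, mul_comm, add_sub_cancel_right]
        exact ha
      choose b hb using hb
      rw [Ideal.mem_span_singleton]
      refine ⟨⟨fun n => Ideal.Quotient.mk _ (b n), fun n => ?_⟩, hext _ _ fun n => ?_⟩
      · rw [Ideal.Quotient.factor_mk, Ideal.Quotient.eq]
        refine mem_of_mul_mem h0 hpow hstep n ?_
        have h1 := hcomp c (n + 1) _ _ (hx _).symm (hx _).symm
        have h2 := (hstep (n + 1)).le (hb (n + 1))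
        have h3 := hb n
        have := (𝔞 (n + 1)).add_mem ((𝔞 (n + 1)).sub_mem h3 h2) h1
        convert this using 1
        ring
      · change _ = ((p : C) : ∀ n, MvPolynomial k ℤ ⧸ 𝔞 n) n * Ideal.Quotient.mk _ (b n)
        rw [hpC, ← map_mul, ← hx n, Ideal.Quotient.eq]
        have h1 := hcomp c n _ _ (hx _).symm (hx _).symm
        have h3 := (hstep n).le (hb n)
        have := (𝔞 n).sub_mem h3 h1
        convert this using 1
        ring
    · rw [Ideal.span_singleton_le_iff_mem, RingHom.mem_ker, hρ _ 0 _ (hpC 0)]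
      exact hpJ
  · intro c hc
    refine hext c 0 fun n => ?_
    obtain ⟨d, rfl⟩ := hc (n + 1)
    change (((p : C) : ∀ n, MvPolynomial k ℤ ⧸ 𝔞 n) n) ^ (n + 1) * d.1 n = 0
    rw [hpC, ← map_pow, Ideal.Quotient.eq_zero_iff_mem.mpr (hpow n), zero_mul]

end CohenRing
end GA

namespace GA

section CohenRing

/-- A ring mapping to a local ring as a coefficient ring does: noetherian local, with maximal ideal
generated by one regular element, and inducing a surjection on residue fields. -/
structure CoeffRing (A : Type u) [CommRing A] [IsLocalRing A] (C : Type u) [CommRing C]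
    (ϖ : C) (ψ : C →+* A) : Prop where
  noeth : IsNoetherianRing C
  max : ∃ _ : IsLocalRing C, IsLocalRing.maximalIdeal C = Ideal.span {ϖ}
  nzd : ∀ c, ϖ * c = 0 → c = 0
  mem : ψ ϖ ∈ IsLocalRing.maximalIdeal A
  residue : ∀ a, ∃ c, a - ψ c ∈ IsLocalRing.maximalIdeal A

variable (A : Type u) [CommRing A] [IsLocalRing A]

local notation "𝔪" => IsLocalRing.maximalIdeal A
local notation "κ" => IsLocalRing.ResidueField A

theorem exists_coeffRing_of_charP [IsAdicComplete 𝔪 A] (p : ℕ) [Fact p.Prime] [CharP κ p] :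
    ∃ (C : Type u) (_ : CommRing C) (ϖ : C) (ψ : C →+* A), CoeffRing A C ϖ ψ := by
  obtain ⟨𝔞, h0, h⟩ := exists_cohen_tower κ p
  have hpow := fun n => (h n).1
  have hker := fun n => (h n).2.1
  have hle := fun n => (h n).2.2.1
  have hstep := fun n => (h n).2.2.2
  obtain ⟨⟨hC1, hC2⟩, hC3⟩ := cohen_limit h0 hpow hker hstep
  let θ : κ →+* A ⧸ 𝔪 := RingHom.id _
  choose g hg hg' hg'' using fun (n : ℕ) (f : {f : MvPolynomial κ ℤ →+* A //
      (∀ h, Ideal.Quotient.mk 𝔪 (f h) = θ (ev κ h)) ∧ ∀ h ∈ 𝔞 n, f h ∈ 𝔪 ^ (n + 1)}) =>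
    (hstep n).exists_lift (by omega) (hle n) 𝔪 θ f.2.1 f.2.2
  obtain ⟨F₀, hF₀, hF₀'⟩ := (cohenLevel_one 𝔪 θ p).exists_lift
  let f : ∀ n : ℕ, {f : MvPolynomial κ ℤ →+* A //
      (∀ h, Ideal.Quotient.mk 𝔪 (f h) = θ (ev κ h)) ∧ ∀ h ∈ 𝔞 n, f h ∈ 𝔪 ^ (n + 1)} := fun n =>
    Nat.rec ⟨F₀, hF₀, by rw [h0]; exact hF₀'⟩ (fun n f => ⟨g n f, hg n f, hg'' n f⟩) n
  have hf : ∀ n h, (f (n + 1)).1 h - (f n).1 h ∈ 𝔪 ^ (n + 1) := fun n => hg' n (f n)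
  let C := invLim 𝔞 fun n => (hstep n).le
  let q : ∀ n, C →+* A ⧸ 𝔪 ^ (n + 1) := fun n =>
    (Ideal.quotientMap (𝔪 ^ (n + 1)) (f n).1 fun x hx => (f n).2.2 x hx).comp
      ((Pi.evalRingHom _ n).comp C.subtype)
  have hqx : ∀ (n : ℕ) (c : C) (x : MvPolynomial κ ℤ),
      (c : ∀ n, MvPolynomial κ ℤ ⧸ 𝔞 n) n = Ideal.Quotient.mk _ x →
      q n c = Ideal.Quotient.mk _ ((f n).1 x) := by
    intro n c x hx
    change Ideal.quotientMap (𝔪 ^ (n + 1)) (f n).1 (fun x hx => (f n).2.2 x hx) (c.1 n) = _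
    rw [hx]
    rfl
  have ha : StrictMono fun n : ℕ => n + 1 := fun a b h => by simpa using h
  have hq : ∀ {m}, (Ideal.Quotient.factorPow 𝔪 (ha.monotone m.le_succ)).comp (q (m + 1)) = q m := by
    intro m
    ext c
    obtain ⟨x, hx⟩ := Ideal.Quotient.mk_surjective ((c : ∀ n, MvPolynomial κ ℤ ⧸ 𝔞 n) (m + 1))
    have hx' : (c : ∀ n, MvPolynomial κ ℤ ⧸ 𝔞 n) m = Ideal.Quotient.mk _ x := by
      rw [← c.2 m, ← hx, Ideal.Quotient.factor_mk]
    rw [RingHom.comp_apply, hqx _ c x hx.symm, hqx _ c x hx']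
    exact Ideal.Quotient.eq.mpr (hf m x)
  let ψ : C →+* A := IsAdicComplete.StrictMono.liftRingHom 𝔪 ha q hq
  have hψ : ∀ c, Ideal.Quotient.mk (𝔪 ^ (0 + 1)) (ψ c) = q 0 c :=
    fun c => IsAdicComplete.StrictMono.mk_liftRingHom 𝔪 ha q hq c
  refine ⟨C, inferInstance, (p : C), ψ, hC1, hC2, hC3, ?_, ?_⟩
  · rw [map_natCast, ← IsLocalRing.residue_eq_zero_iff, map_natCast]
    exact CharP.cast_eq_zero _ p
  · intro a
    let x : MvPolynomial κ ℤ := .X (IsLocalRing.residue A a)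
    let c : C := ⟨fun n => Ideal.Quotient.mk _ x, fun n => Ideal.Quotient.factor_mk _ _⟩
    refine ⟨c, ?_⟩
    have h1 := hψ c
    rw [hqx 0 c x rfl, Ideal.Quotient.eq] at h1
    replace h1 := Ideal.pow_le_self (by omega) h1
    have h2 := (f 0).2.1 x
    rw [show θ (ev κ x) = Ideal.Quotient.mk 𝔪 a from ev_X (IsLocalRing.residue A a), Ideal.Quotient.eq] at h2
    have := (𝔪).neg_mem ((𝔪).add_mem h1 h2)
    convert this using 1
    ring

theorem exists_coeffRing_of_charZero [IsAdicComplete 𝔪 A] [CharZero κ] :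
    ∃ (C : Type u) (_ : CommRing C) (ϖ : C) (ψ : C →+* A), CoeffRing A C ϖ ψ := by
  have hunit : ∀ n : ℕ, n ≠ 0 → IsUnit (n : A) := by
    intro n hn
    by_contra hcon
    have h1 : (n : A) ∈ 𝔪 := (IsLocalRing.mem_maximalIdeal _).mpr hcon
    rw [← IsLocalRing.residue_eq_zero_iff, map_natCast] at h1
    exact hn (Nat.cast_eq_zero.mp h1)
  let e : ℚ →+* A := IsLocalization.lift (M := nonZeroDivisors ℤ) (g := Int.castRingHom A) (by
    rintro ⟨y, hy⟩
    have hy0 : y ≠ 0 := nonZeroDivisors.ne_zero hy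
    have := hunit y.natAbs (by simpa using hy0)
    rcases Int.natAbs_eq y with h | h
    · change IsUnit ((y : ℤ) : A)
      rw [h]; simpa using this
    · change IsUnit ((y : ℤ) : A)
      rw [h]; simpa using this)
  let : Algebra ℚ A := e.toAlgebra
  let : Algebra ℚ κ := DivisionRing.toRatAlgebra
  have hsm : Algebra.FormallySmooth ℚ κ := by
    obtain ⟨s, hs⟩ := exists_isTranscendenceBasis ℚ κ
    have : Algebra.IsAlgebraic (IntermediateField.adjoin ℚ (Set.range ((↑) : s → κ))) κ :=
      hs.isAlgebraic_field
    have : Algebra.IsSeparable (IntermediateField.adjoin ℚ (Set.range ((↑) : s → κ))) κ :=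
      inferInstance
    exact .of_algebraicIndependent_of_isSeparable hs.1
  let ι₀ : κ →+* A ⧸ 𝔪 := RingHom.id κ
  let ι : κ →ₐ[ℚ] A ⧸ 𝔪 := { ι₀ with
    commutes' := fun r => RingHom.congr_fun
      (Subsingleton.elim (ι₀.comp (algebraMap ℚ κ)) (algebraMap ℚ (A ⧸ 𝔪))) r }
  obtain ⟨g, hg⟩ := Algebra.FormallySmooth.exists_mkₐ_comp_eq_of_isAdicComplete ι
  refine ⟨PowerSeries κ, inferInstance, PowerSeries.X,
    g.toRingHom.comp PowerSeries.constantCoeff, inferInstance, ⟨inferInstance, ?_⟩, ?_, ?_, ?_⟩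
  · exact PowerSeries.maximalIdeal_eq_span_X
  · intro c hc
    exact (mul_eq_zero.mp hc).resolve_left PowerSeries.X_ne_zero
  · simp
  · intro a
    refine ⟨PowerSeries.C (IsLocalRing.residue A a), ?_⟩
    have := AlgHom.congr_fun hg (IsLocalRing.residue A a)
    rw [← Ideal.Quotient.eq_zero_iff_mem, map_sub, sub_eq_zero]
    rw [RingHom.comp_apply, PowerSeries.constantCoeff_C]
    exact this.symm

theorem exists_coeffRing [IsAdicComplete 𝔪 A] :
    ∃ (C : Type u) (_ : CommRing C) (ϖ : C) (ψ : C →+* A), CoeffRing A C ϖ ψ := by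
  obtain ⟨p, hp⟩ := CharP.exists κ
  rcases CharP.char_is_prime_or_zero κ p with h | rfl
  · have : Fact p.Prime := ⟨h⟩
    exact exists_coeffRing_of_charP A p
  · have : CharZero κ := CharP.charP_to_charZero κ
    exact exists_coeffRing_of_charZero A

end CohenRing
end GA

namespace GA

open RingTheory.Sequence Pointwise in
lemma isWeaklyRegular_cons_iff_map {S T : Type u} [CommRing S] [CommRing T] {f : S →+* T}
    (hf : Surjective f) {x : S} (hx : RingHom.ker f = Ideal.span {x}) (l : List S) :
    IsWeaklyRegular S (x :: l) ↔ IsSMulRegular S x ∧ IsWeaklyRegular T (l.map f) := by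
  rw [isWeaklyRegular_cons_iff]
  refine and_congr_right fun _ ↦ ?_
  have hk : (x • (⊤ : Submodule S S)).toAddSubgroup = f.toAddMonoidHom.ker := by
    ext s
    have : s ∈ RingHom.ker f ↔ s ∈ Ideal.span {x} := by rw [hx]
    rw [Ideal.mem_span_singleton', RingHom.mem_ker] at this
    change s ∈ x • (⊤ : Submodule S S) ↔ f s = 0
    rw [this, Submodule.mem_smul_pointwise_iff_exists]
    exact ⟨fun ⟨b, _, h⟩ ↦ ⟨b, by rw [mul_comm]; exact h⟩,
      fun ⟨b, h⟩ ↦ ⟨b, trivial, by rw [mul_comm] at h; exact h⟩⟩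
  let e : QuotSMulTop x S ≃+ T :=
    (QuotientAddGroup.quotientAddEquivOfEq hk).trans
      (QuotientAddGroup.quotientKerEquivOfSurjective f.toAddMonoidHom hf)
  refine e.isWeaklyRegular_congr (List.forall₂_map_right_iff.mpr (List.forall₂_same.mpr ?_))
  intro r _ y
  induction y using Submodule.Quotient.induction_on with
  | _ y => exact map_mul f r y

lemma ofList_cons_eq_comap {S T : Type u} [CommRing S] [CommRing T] {f : S →+* T}
    (hf : Surjective f) {x : S} (hx : RingHom.ker f = Ideal.span {x}) (l : List S) :
    Ideal.ofList (x :: l) = (Ideal.ofList (l.map f)).comap f := by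
  rw [← Ideal.map_ofList, Ideal.comap_map_of_surjective' f hf, hx, Ideal.ofList_cons, sup_comm]

open IsLocalRing RingTheory.Sequence in
lemma mvPowerSeries_regular {C : Type u} [CommRing C] [IsLocalRing C] {ϖ : C}
    (hϖ : maximalIdeal C = Ideal.span {ϖ}) (hz : ∀ c, ϖ * c = 0 → c = 0) (n : ℕ) :
    IsWeaklyRegular (MvPowerSeries (Fin n) C)
        (List.ofFn (MvPowerSeries.X : Fin n → MvPowerSeries (Fin n) C) ++ [MvPowerSeries.C ϖ]) ∧
      Ideal.ofList
        (List.ofFn (MvPowerSeries.X : Fin n → MvPowerSeries (Fin n) C) ++ [MvPowerSeries.C ϖ]) =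
        maximalIdeal (MvPowerSeries (Fin n) C) := by
  induction n with
  | zero =>
    simp only [List.ofFn_zero, List.nil_append]
    have hs : Surjective (MvPowerSeries.C : C →+* MvPowerSeries (Fin 0) C) := fun p ↦
      ⟨MvPowerSeries.constantCoeff p, by
        ext d; rw [Subsingleton.elim d 0]; simp⟩
    constructor
    · rw [isWeaklyRegular_singleton_iff]
      intro a b h
      obtain ⟨a, rfl⟩ := hs a
      obtain ⟨b, rfl⟩ := hs b
      simp only [smul_eq_mul, ← map_mul] at h
      have h' := congrArg MvPowerSeries.constantCoeff h
      simp only [MvPowerSeries.constantCoeff_C] at h'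
      rw [sub_eq_zero.mp (hz (a - b) (by rw [mul_sub, h', sub_self]))]
    · rw [Ideal.ofList_singleton]
      ext p
      obtain ⟨a, rfl⟩ := hs p
      rw [mem_maximalIdeal, mem_nonunits_iff, MvPowerSeries.isUnit_iff_constantCoeff,
        MvPowerSeries.constantCoeff_C, ← mem_nonunits_iff, ← mem_maximalIdeal, hϖ,
        Ideal.mem_span_singleton, Ideal.mem_span_singleton]
      constructor
      · intro h
        simpa using map_dvd (MvPowerSeries.constantCoeff) h
      · exact fun h ↦ map_dvd _ h
  | succ n ih =>
    let e := (MvPowerSeries.finSuccEquiv C n).toRingEquiv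
    let f : MvPowerSeries (Fin (n + 1)) C →+* MvPowerSeries (Fin n) C :=
      (PowerSeries.constantCoeff).comp (e : _ →+* _)
    have hfe : ∀ p, f p = PowerSeries.constantCoeff (MvPowerSeries.finSuccEquiv C n p) :=
      fun _ ↦ rfl
    have hf : Surjective f := fun p ↦ ⟨e.symm (PowerSeries.C p), by
      change PowerSeries.constantCoeff (e (e.symm _)) = p
      rw [e.apply_symm_apply]; simp⟩
    have hx : RingHom.ker f = Ideal.span {MvPowerSeries.X 0} := by
      ext p
      rw [RingHom.mem_ker, hfe, Ideal.mem_span_singleton, ← PowerSeries.X_dvd_iff,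
        ← MvPowerSeries.finSuccEquiv_X_zero]
      exact map_dvd_iff (MvPowerSeries.finSuccEquiv C n)
    have hreg : IsSMulRegular (MvPowerSeries (Fin (n + 1)) C)
        (MvPowerSeries.X 0 : MvPowerSeries (Fin (n + 1)) C) := by
      intro a b h
      have h' := congrArg (MvPowerSeries.finSuccEquiv C n) h
      simp only [smul_eq_mul, map_mul, MvPowerSeries.finSuccEquiv_X_zero] at h'
      exact (MvPowerSeries.finSuccEquiv C n).injective (PowerSeries.X_mul_cancel h')
    have hl : (List.ofFn (fun i : Fin n ↦ (MvPowerSeries.X i.succ : MvPowerSeries (Fin (n + 1)) C))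
        ++ [MvPowerSeries.C ϖ]).map f =
        List.ofFn (MvPowerSeries.X : Fin n → MvPowerSeries (Fin n) C) ++ [MvPowerSeries.C ϖ] := by
      rw [List.map_append, List.map_ofFn, List.map_singleton, hfe, MvPowerSeries.finSuccEquiv_C]
      congr 2
      · funext i
        simp [hfe, MvPowerSeries.finSuccEquiv_X_succ]
    rw [List.ofFn_succ, List.cons_append, isWeaklyRegular_cons_iff_map hf hx,
      ofList_cons_eq_comap hf hx, hl, ih.2]
    have := IsLocalHom.of_surjective f hf
    exact ⟨⟨hreg, ih.1⟩, maximalIdeal_comap f⟩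

end GA

namespace GA

open IsLocalRing

theorem exists_evalHom {A C : Type u} [CommRing A] [CommRing C] (I : Ideal A) [IsAdicComplete I A]
    (ψ : C →+* A) {n : ℕ} (x : Fin n → A) (hx : ∀ i, x i ∈ I) :
    ∃ Φ : MvPowerSeries (Fin n) C →+* A, (∀ c, Φ (MvPowerSeries.C c) = ψ c) ∧
      ∀ i, Φ (MvPowerSeries.X i) = x i := by
  let J := MvPolynomial.idealOfVars (Fin n) C
  let ev : MvPolynomial (Fin n) C →+* A := MvPolynomial.eval₂Hom ψ x
  have hJ : J.map ev ≤ I := by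
    rw [Ideal.map_le_iff_le_comap, show J = Ideal.span (Set.range MvPolynomial.X) from rfl,
      Ideal.span_le]
    rintro _ ⟨i, rfl⟩
    simpa [ev] using hx i
  have hJk (k : ℕ) : J ^ k ≤ (I ^ k).comap ev := by
    rw [← Ideal.map_le_iff_le_comap, Ideal.map_pow]
    exact Ideal.pow_right_mono hJ k
  let f (k : ℕ) : MvPowerSeries (Fin n) C →+* A ⧸ I ^ k :=
    (Ideal.quotientMap (I ^ k) ev (hJk k)).comp
      (MvPowerSeries.truncTotalAlgHom (Fin n) C k : MvPowerSeries (Fin n) C →+* _)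
  have hfk (k : ℕ) (p) : f k p = Ideal.Quotient.mk (I ^ k) (ev (MvPowerSeries.truncTotal k p)) :=
    rfl
  have hf : ∀ {m k : ℕ} (hle : m ≤ k), (Ideal.Quotient.factorPow I hle).comp (f k) = f m := by
    intro m k hle
    ext p
    change Ideal.Quotient.mk (I ^ m) (ev (MvPowerSeries.truncTotal k p)) =
      Ideal.Quotient.mk (I ^ m) (ev (MvPowerSeries.truncTotal m p))
    rw [Ideal.Quotient.eq, ← map_sub]
    exact hJk m (MvPowerSeries.truncTotal_sub_truncTotal_mem_pow_idealOfVars hle le_rfl p)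
  let Φ := IsAdicComplete.liftRingHom I f hf
  have key (p : MvPolynomial (Fin n) C) : Φ (p : MvPowerSeries (Fin n) C) = ev p := by
    rw [IsHausdorff.eq_iff_smodEq (I := I)]
    intro k
    rw [SModEq.sub_mem, smul_eq_mul, Ideal.mul_top, ← Ideal.Quotient.eq]
    rw [IsAdicComplete.mk_liftRingHom, hfk, Ideal.Quotient.eq, ← map_sub]
    refine hJk k ((MvPolynomial.mem_pow_idealOfVars_iff' ..).mpr fun d hd ↦ ?_)
    simp [MvPowerSeries.coeff_truncTotal _ hd]
  refine ⟨Φ, fun c ↦ ?_, fun i ↦ ?_⟩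
  · rw [← MvPolynomial.coe_C, key]; simp [ev]
  · rw [← MvPolynomial.coe_X, key]; simp [ev]

theorem exists_minimal_generators {A : Type u} [CommRing A] [IsLocalRing A]
    (hfg : (maximalIdeal A).FG) : ∃ (n : ℕ) (x : Fin n → A),
      Ideal.span (Set.range x) = maximalIdeal A ∧
      ∀ a : Fin n → A, ∑ i, a i * x i = 0 → ∀ i, a i ∈ maximalIdeal A := by
  classical
  have hex : ∃ (n : ℕ) (x : Fin n → A), Ideal.span (Set.range x) = maximalIdeal A :=
    Submodule.fg_iff_exists_fin_generating_family.mp hfg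
  obtain ⟨x, hx⟩ := Nat.find_spec hex
  refine ⟨Nat.find hex, x, hx, fun a ha i ↦ ?_⟩
  by_contra hi
  have hmin : ∀ k, k < Nat.find hex → ¬ ∃ x : Fin k → A, Ideal.span (Set.range x) = maximalIdeal A :=
    fun k hk ↦ Nat.find_min hex hk
  generalize Nat.find hex = n at *
  obtain _ | n := n
  · exact i.elim0
  refine hmin n (Nat.lt_succ_self n) ⟨x ∘ i.succAbove, ?_⟩
  rw [← hx]
  refine le_antisymm (Ideal.span_mono (Set.range_comp_subset_range _ _)) ?_
  rw [Ideal.span_le]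
  rintro _ ⟨j, rfl⟩
  obtain rfl | ⟨j, rfl⟩ := Fin.eq_self_or_eq_succAbove i j
  · rw [Fin.sum_univ_succAbove _ j] at ha
    have hu : IsUnit (a j) := by simpa [mem_maximalIdeal] using hi
    obtain ⟨u, hu⟩ := hu
    have : x j = - (↑u⁻¹ * ∑ i, a (j.succAbove i) * x (j.succAbove i)) := by
      rw [← hu] at ha
      rw [eq_neg_iff_add_eq_zero, ← mul_eq_zero_of_right (↑u⁻¹ : A) ha, mul_add,
        Units.inv_mul_cancel_left]
    rw [SetLike.mem_coe, this]
    exact neg_mem (Ideal.mul_mem_left _ _ (sum_mem fun i _ ↦ Ideal.mul_mem_left _ _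
      (Ideal.subset_span ⟨i, rfl⟩)))
  · exact Ideal.subset_span ⟨j, rfl⟩

end GA

namespace GA

open IsLocalRing RingTheory.Sequence

lemma ofList_ofFn {S : Type u} [CommRing S] {n : ℕ} (x : Fin n → S) :
    Ideal.ofList (List.ofFn x) = Ideal.span (Set.range x) := by
  refine congrArg Ideal.span (Set.ext fun s ↦ ?_)
  exact List.mem_ofFn

lemma ker_le_sq_of_minimal {Q A : Type u} [CommRing Q] [CommRing A] [IsLocalRing Q] [IsLocalRing A]
    {π : Q →+* A} (hπ : Surjective π) {n : ℕ} {X : Fin n → Q}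
    (hX : Ideal.span (Set.range X) = maximalIdeal Q)
    (hmin : ∀ a : Fin n → A, ∑ i, a i * π (X i) = 0 → ∀ i, a i ∈ maximalIdeal A) :
    RingHom.ker π ≤ maximalIdeal Q ^ 2 := by
  have := IsLocalHom.of_surjective π hπ
  intro q hq
  have hq' : q ∈ maximalIdeal Q := le_maximalIdeal (RingHom.ker_ne_top π) hq
  rw [← hX] at hq'
  obtain ⟨c, rfl⟩ := (Submodule.mem_span_range_iff_exists_fun Q).mp hq'
  have h := hmin (fun i ↦ π (c i)) (by simpa [map_sum] using hq)
  refine sum_mem fun i _ ↦ ?_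
  rw [smul_eq_mul, pow_two]
  refine Ideal.mul_mem_mul ?_ (hX ▸ Ideal.subset_span ⟨i, rfl⟩)
  rw [← maximalIdeal_comap π]
  exact h i

theorem exists_regular_presentation (A : Type u) [CommRing A] [IsLocalRing A]
    [IsAdicComplete (maximalIdeal A) A] (hfg : (maximalIdeal A).FG) :
    ∃ (Q : Type u) (_ : CommRing Q) (_ : IsLocalRing Q) (_ : IsNoetherianRing Q) (rs : List Q)
      (π : Q →+* A), IsRegular Q rs ∧ Ideal.ofList rs = maximalIdeal Q ∧ Surjective π ∧
      RingHom.ker π ≤ maximalIdeal Q ^ 2 := by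
  obtain ⟨C, _, ϖ, ψ, hC⟩ := exists_coeffRing A
  obtain ⟨_, hϖ⟩ := hC.max
  have := hC.noeth
  obtain ⟨n, x, hx, hmin⟩ := exists_minimal_generators hfg
  obtain ⟨Φ, hΦC, hΦX⟩ := exists_evalHom (maximalIdeal A) ψ x
    (fun i ↦ hx ▸ Ideal.subset_span ⟨i, rfl⟩)
  let X : Fin n → MvPowerSeries (Fin n) C := MvPowerSeries.X
  have hmap : (Ideal.span (Set.range X)).map Φ = maximalIdeal A := by
    rw [Ideal.map_span, ← Set.range_comp, ← hx]
    congr 2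
    funext i
    exact hΦX i
  have hΦ : Surjective Φ := by
    have : IsHausdorff ((Ideal.span (Set.range X)).map Φ) A := by
      rw [hmap]; infer_instance
    have : IsPrecomplete (Ideal.span (Set.range X)) (MvPowerSeries (Fin n) C) := inferInstance
    refine surjective_of_mk_map_comp_surjective (I := Ideal.span (Set.range X)) Φ fun a ↦ ?_
    obtain ⟨a, rfl⟩ := Ideal.Quotient.mk_surjective a
    obtain ⟨c, hc⟩ := hC.residue a
    refine ⟨MvPowerSeries.C c, ?_⟩
    rw [RingHom.comp_apply, hΦC, eq_comm, Ideal.Quotient.eq, hmap]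
    exact hc
  obtain ⟨hreg, hmax⟩ := mvPowerSeries_regular hϖ hC.nzd n
  obtain ⟨g, hg0, hg⟩ : ∃ g, Φ g = 0 ∧ g - MvPowerSeries.C ϖ ∈ Ideal.ofList (List.ofFn X) := by
    have h := hC.mem
    rw [← hx] at h
    obtain ⟨c, hc⟩ := (Submodule.mem_span_range_iff_exists_fun A).mp h
    choose c' hc' using fun i ↦ hΦ (c i)
    refine ⟨MvPowerSeries.C ϖ - ∑ i, c' i * X i, ?_, ?_⟩
    · rw [map_sub, hΦC, ← hc, map_sum]
      simp [hc', X, hΦX]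
    · rw [ofList_ofFn, sub_sub_cancel_left]
      exact neg_mem (sum_mem fun i _ ↦ Ideal.mul_mem_left _ _ (Ideal.subset_span ⟨i, rfl⟩))
  have hreg' : IsWeaklyRegular (MvPowerSeries (Fin n) C) (List.ofFn X ++ [g]) := by
    rw [isWeaklyRegular_append_singleton] at hreg ⊢
    refine ⟨hreg.1, fun q hq ↦ hreg.2 q ?_⟩
    have h := sub_mem hq (Ideal.mul_mem_right q _ hg)
    rwa [← sub_mul, sub_sub_cancel] at h
  have hmax' : Ideal.ofList (g :: List.ofFn X) = maximalIdeal (MvPowerSeries (Fin n) C) := by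
    rw [← hmax, Ideal.ofList_cons, Ideal.ofList_append, Ideal.ofList_singleton, sup_comm]
    refine le_antisymm (sup_le le_sup_left ?_) (sup_le le_sup_left ?_) <;>
      rw [Ideal.span_singleton_le_iff_mem]
    · rw [← sub_add_cancel g (MvPowerSeries.C ϖ)]
      exact add_mem (Ideal.mem_sup_left hg) (Ideal.mem_sup_right (Ideal.mem_span_singleton_self _))
    · rw [← sub_sub_cancel g (MvPowerSeries.C ϖ)]
      exact sub_mem (Ideal.mem_sup_right (Ideal.mem_span_singleton_self _)) (Ideal.mem_sup_left hg)
  have hperm : (List.ofFn X ++ [g]).Perm (g :: List.ofFn X) := List.perm_append_singleton _ _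
  have hreg'' : IsWeaklyRegular (MvPowerSeries (Fin n) C) (g :: List.ofFn X) := by
    refine isWeaklyRegular_of_perm_of_subset_maximalIdeal hreg' hperm fun r hr ↦ ?_
    rw [← hmax']
    exact Ideal.subset_span (hperm.mem_iff.mp hr)
  have hgm : g ∈ maximalIdeal (MvPowerSeries (Fin n) C) := by
    rw [← hmax']
    exact Ideal.subset_span List.mem_cons_self
  let Q := MvPowerSeries (Fin n) C ⧸ Ideal.span {g}
  have : Nontrivial Q := Ideal.Quotient.nontrivial_iff.mpr fun h ↦
    (maximalIdeal.isMaximal _).ne_top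
      (top_le_iff.mp (h ▸ (Ideal.span_singleton_le_iff_mem _).mpr hgm))
  let p : MvPowerSeries (Fin n) C →+* Q := Ideal.Quotient.mk _
  have hp : Surjective p := Ideal.Quotient.mk_surjective
  have hpk : RingHom.ker p = Ideal.span {g} := Ideal.mk_ker
  have : IsLocalRing Q := .of_surjective' p hp
  have := IsLocalHom.of_surjective p hp
  have hrs : Ideal.ofList ((List.ofFn X).map p) = maximalIdeal Q := by
    apply Ideal.comap_injective_of_surjective p hp
    rw [maximalIdeal_comap, ← hmax', ofList_cons_eq_comap hp hpk]
  let π : Q →+* A := Ideal.Quotient.lift _ Φ fun a ha ↦ by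
    obtain ⟨b, rfl⟩ := Ideal.mem_span_singleton'.mp ha
    rw [map_mul, hg0, mul_zero]
  have hπp (s) : π (p s) = Φ s := Ideal.Quotient.lift_mk _ _ _
  have hπ : Surjective π := fun a ↦ (hΦ a).elim fun s hs ↦ ⟨p s, (hπp s).trans hs⟩
  refine ⟨Q, inferInstance, inferInstance, inferInstance, (List.ofFn X).map p, π,
    ⟨((isWeaklyRegular_cons_iff_map hp hpk _).mp hreg'').2, ?_⟩, hrs, hπ, ?_⟩
  · rw [hrs, smul_eq_mul, Ideal.mul_top]
    exact (maximalIdeal.isMaximal Q).ne_top.symm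
  · refine ker_le_sq_of_minimal hπ (X := p ∘ X) ?_ fun a ha ↦ hmin a ?_
    · rw [← hrs, List.map_ofFn, ofList_ofFn]
    · rw [← ha]
      exact Finset.sum_congr rfl fun i _ ↦ by rw [comp_apply, hπp, hΦX]

end GA

namespace GA

open IsLocalRing RingTheory.Sequence TensorProduct

theorem exists_baseChange_resolution {R B M N : Type u} [CommRing R] [CommRing B] [Algebra R B]
    [Module.Flat R B] [AddCommGroup M] [Module R M] [AddCommGroup N] [Module B N]
    (e : B ⊗[R] M ≃ₗ[B] N) (F : FreeResolution R M) :
    ∃ F' : FreeResolution B N, F'.rank = F.rank := by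
  let ε (n : ℕ) : B ⊗[R] (Fin n → R) ≃ₗ[B] (Fin n → B) := TensorProduct.piScalarRight R B B (Fin n)
  have conj {X Y Z X' Y' Z' : Type u} [AddCommGroup X] [AddCommGroup Y] [AddCommGroup Z]
      [AddCommGroup X'] [AddCommGroup Y'] [AddCommGroup Z'] [Module B X] [Module B Y] [Module B Z]
      [Module B X'] [Module B Y'] [Module B Z'] (f : X →ₗ[B] Y) (g : Y →ₗ[B] Z) (a : X ≃ₗ[B] X')
      (b : Y ≃ₗ[B] Y') (c : Z ≃ₗ[B] Z') (h : Function.Exact f g) :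
      Function.Exact (b.toLinearMap ∘ₗ f ∘ₗ a.symm.toLinearMap)
        (c.toLinearMap ∘ₗ g ∘ₗ b.symm.toLinearMap) := by
    intro y
    constructor
    · intro hy
      obtain ⟨x, hx⟩ := (h (b.symm y)).mp (by simpa using hy)
      exact ⟨a x, by simp [hx]⟩
    · rintro ⟨x, rfl⟩
      simpa using h.apply_apply_eq_zero (a.symm x)
  refine ⟨⟨F.rank, fun i ↦ (ε _).toLinearMap ∘ₗ (F.d i).baseChange B ∘ₗ (ε _).symm.toLinearMap,
    e.toLinearMap ∘ₗ F.aug.baseChange B ∘ₗ (ε _).symm.toLinearMap, ?_, ?_, fun i ↦ ?_⟩, rfl⟩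
  · exact e.surjective.comp
      ((LinearMap.lTensor_surjective B F.aug_surjective).comp (ε _).symm.surjective)
  · exact conj _ _ _ _ _ (Module.Flat.lTensor_exact B F.exact_aug)
  · exact conj _ _ _ _ _ (Module.Flat.lTensor_exact B (F.exact i))

variable (R : Type u) [CommRing R] [IsNoetherianRing R] [IsLocalRing R]

theorem exists_resolution_completion (F : FreeResolution R (ResidueField R)) :
    ∃ F' : FreeResolution (AdicCompletion (maximalIdeal R) R)
      (ResidueField (AdicCompletion (maximalIdeal R) R)), F'.rank = F.rank := by
  have : Module.Flat R (AdicCompletion (maximalIdeal R) R) :=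
    AdicCompletion.flat_of_isNoetherian _
  let e₁ := (Algebra.TensorProduct.quotIdealMapEquivTensorQuot
    (AdicCompletion (maximalIdeal R) R) (maximalIdeal R)).symm.toLinearEquiv
  let e₂ := Submodule.quotEquivOfEq _ _ (AdicCompletion.maximalIdeal_eq_map (R := R)).symm
  exact exists_baseChange_resolution (e₁.trans e₂) F

theorem isCompleteIntersection_of_resolution (F : FreeResolution R (ResidueField R)) {c d : ℕ}
    (hF : ∀ n, F.rank n ≤ c * (n + 1) ^ d) : IsCompleteIntersection R := by
  let A := AdicCompletion (maximalIdeal R) R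
  have hfg : (maximalIdeal A).FG := by
    rw [AdicCompletion.maximalIdeal_eq_map]
    exact (maximalIdeal R).fg_of_isNoetherianRing.map _
  obtain ⟨Q, _, _, _, rs, π, hrs, hm, hπ, hker⟩ := exists_regular_presentation A hfg
  have : IsNoetherianRing A := isNoetherianRing_of_surjective Q A π hπ
  obtain ⟨F', hF'⟩ := exists_resolution_completion R F
  obtain ⟨fs, hfs, hfk⟩ := exists_list hπ hker hrs hm (d + 1) fun s hs ↦
    Stage.e_le_of_resolution hs F' (C := c) (d := d) fun n ↦ by rw [hF']; exact hF n
  refine ⟨Q, inferInstance, ⟨inferInstance, inferInstance, rs, hrs, hm⟩, fs, hfs, ⟨?_⟩⟩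
  exact (RingHom.quotientKerEquivOfSurjective hπ).symm.trans (Ideal.quotEquivOfEq hfk.symm)

end GA

/-- **Corollary 1.4 / 3.8, (4) ⇒ (1) (Araya–Takahashi).**
Let `(R, 𝔪, k)` be a commutative noetherian local ring.  If the residue field `k`
has finite upper reducing projective dimension, then `R` is a complete
intersection. -/
theorem isCompleteIntersection_of_uredPd_residueField_finite
    (R : Type u) [CommRing R] [IsNoetherianRing R] [IsLocalRing R]
    (h : uredDim R (HasFinitePd R) (IsLocalRing.ResidueField R) ≠ ⊤) :
    IsCompleteIntersection R := by
  obtain ⟨F, C, d, hF⟩ := GA.exists_poly_resolution h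
  exact GA.isCompleteIntersection_of_resolution R F hF
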